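/- arXiv:2408.17381 — 4 statements merged into one kernel-verified Lean document; each statement's English description precedes it below -/
import Mathlib

section
/- Fix ρ ∈ (0,1). There exists a constant C > 0, depending only on ρ, such that for every bounded open set E ⊂ ℝ² of diameter h_E that is shape-regular with parameter ρ, and every v : ℝ² → ℝ of class C¹ on an open neighborhood of the closure of E, the squared Gagliardo H^{1/2}(∂E) seminorm of v on the boundary is controlled by the H¹(E) seminorm: ∫_{∂E} ∫_{∂E} |v(x) − v(y)|² / ‖x − y‖² dH¹(x) dH¹(y) ≤ C · ∫_E ‖∇v(x)‖² dx. -/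
open MeasureTheory Metric Set

noncomputable section

/-- A bounded open set `E ⊂ ℝ²` with diameter `h_E` is shape-regular with parameter
`ρ`: it is star-shaped with respect to a closed ball of radius `ρ · h_E`. -/
def ShapeRegular (ρ : ℝ) (E : Set (EuclideanSpace ℝ (Fin 2))) : Prop :=
  ∃ z : EuclideanSpace ℝ (Fin 2), closedBall z (ρ * Metric.diam E) ⊆ E ∧
    ∀ x ∈ E, ∀ y ∈ closedBall z (ρ * Metric.diam E), segment ℝ x y ⊆ E

section Aux

abbrev Pl := EuclideanSpace ℝ (Fin 2)

theorem cone_mem {E : Set Pl} {z : Pl} {R : ℝ} 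
    (hstar : ∀ x ∈ E, ∀ y ∈ closedBall z R, segment ℝ x y ⊆ E)
    {x q : Pl} (hx : x ∈ closure E) {s : ℝ} (hs0 : 0 < s) (hs1 : s ≤ 1)
    (hq : dist q (x + s • (z - x)) < s * R) : q ∈ E := by
  set δ := s * R - dist q (x + s • (z - x)) with hδ
  have hδ0 : 0 < δ := by linarith
  obtain ⟨x', hx', hd⟩ := Metric.mem_closure_iff.1 hx δ hδ0
  set b : Pl := s⁻¹ • (q - (1 - s) • x') with hb
  have hbz : b ∈ closedBall z R := by
    rw [mem_closedBall, dist_eq_norm]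
    have h1 : b - z = s⁻¹ • ((q - (x + s • (z - x))) + (1 - s) • (x - x')) := by
      have : z = s⁻¹ • (s • z) := by rw [smul_smul, inv_mul_cancel₀ hs0.ne', one_smul]
      rw [hb]
      conv_lhs => rw [this]
      rw [← smul_sub]
      congr 1
      module
    rw [h1, norm_smul, Real.norm_of_nonneg (by positivity)]
    have h2 : ‖(q - (x + s • (z - x))) + (1 - s) • (x - x')‖ ≤ s * R := by
      refine (norm_add_le _ _).trans ?_
      rw [norm_smul, Real.norm_of_nonneg (by linarith), ← dist_eq_norm, ← dist_eq_norm]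
      have : (1 - s) * dist x x' ≤ 1 * dist x x' := by gcongr; linarith
      linarith
    calc _ ≤ s⁻¹ * (s * R) := by gcongr
      _ = R := by field_simp
  refine hstar x' hx' b hbz ⟨1 - s, s, by linarith, hs0.le, by ring, ?_⟩
  rw [hb, smul_smul, mul_inv_cancel₀ hs0.ne', one_smul]
  module

def coneK (z : Pl) (R : ℝ) : Set (Pl × Pl) :=
  {a | ∃ s : ℝ, 0 < s ∧ s ≤ 1 ∧ dist a.2 (a.1 + s • (z - a.1)) < s * (R / 2)}

theorem isOpen_coneK (z : Pl) (R : ℝ) : IsOpen (coneK z R) := by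
  have : coneK z R = ⋃ s ∈ Ioc (0:ℝ) 1, {a : Pl × Pl | dist a.2 (a.1 + s • (z - a.1)) < s * (R / 2)} := by
    ext a; simp [coneK, and_assoc]
  rw [this]
  exact isOpen_biUnion fun s _ => isOpen_lt (by fun_prop) (by fun_prop)

theorem coneK_scale {z : Pl} {R : ℝ} {x q : Pl} (h : (x, q) ∈ coneK z R) {t : ℝ} (ht0 : 0 < t)
    (ht1 : t ≤ 1) : (x, x + t • (q - x)) ∈ coneK z R := by
  obtain ⟨s, h0, h1, h2⟩ := h
  refine ⟨t * s, by positivity, by nlinarith, ?_⟩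
  simp only at h2 ⊢
  rw [dist_eq_norm] at h2 ⊢
  have : x + t • (q - x) - (x + (t * s) • (z - x)) = t • (q - (x + s • (z - x))) := by module
  rw [this, norm_smul, Real.norm_of_nonneg ht0.le, mul_assoc]
  gcongr

/-- Shape hypotheses. -/
structure Shp (ρ h : ℝ) (z : Pl) (E : Set Pl) : Prop where
  ρ0 : 0 < ρ
  ρ1 : ρ < 1
  h0 : 0 < h
  op : IsOpen E
  bd : Bornology.IsBounded E
  ball : closedBall z (ρ * h) ⊆ E
  star : ∀ x ∈ E, ∀ y ∈ closedBall z (ρ * h), segment ℝ x y ⊆ E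
  diam : ∀ x ∈ closure E, ∀ y ∈ closure E, dist x y ≤ h

variable {ρ h : ℝ} {z : Pl} {E : Set Pl}

theorem Shp.frontier_closure (_ : Shp ρ h z E) {x : Pl} (hx : x ∈ frontier E) : x ∈ closure E :=
  hx.1

theorem Shp.frontier_not (H : Shp ρ h z E) {x : Pl} (hx : x ∈ frontier E) : x ∉ E := by
  have := hx.2; rwa [H.op.interior_eq] at this

theorem Shp.far (H : Shp ρ h z E) {x q y : Pl} (hx : x ∈ closure E) {s : ℝ} (hs0 : 0 < s) (hs1 : s ≤ 1)
    (hq : dist q (x + s • (z - x)) < s * (ρ * h / 2)) (hy : y ∉ E) : s * (ρ * h / 2) ≤ dist q y := by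
  by_contra! hc
  apply hy
  refine cone_mem H.star hx hs0 hs1 ?_
  have := dist_triangle_left y (x + s • (z - x)) q
  linarith

theorem Shp.near (H : Shp ρ h z E) {x q : Pl} (hx : x ∈ closure E) {s : ℝ} (hs0 : 0 < s)
    (hq : dist q (x + s • (z - x)) < s * (ρ * h / 2)) : ‖q - x‖ ≤ s * h := by
  set b : Pl := s⁻¹ • (q - (1 - s) • x) with hb
  have hR : 0 < ρ * h := mul_pos H.ρ0 H.h0
  have hbE : b ∈ E := by
    apply H.ball
    rw [mem_closedBall, dist_eq_norm]
    have h1 : b - z = s⁻¹ • (q - (x + s • (z - x))) := by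
      have : z = s⁻¹ • (s • z) := by rw [smul_smul, inv_mul_cancel₀ hs0.ne', one_smul]
      rw [hb]
      conv_lhs => rw [this]
      rw [← smul_sub]
      congr 1
      module
    rw [h1, norm_smul, Real.norm_of_nonneg (by positivity), ← dist_eq_norm]
    calc _ ≤ s⁻¹ * (s * (ρ * h / 2)) := by gcongr
      _ = ρ * h / 2 := by field_simp
      _ ≤ _ := by linarith
  have : q - x = s • (b - x) := by
    rw [hb, smul_sub, smul_smul, mul_inv_cancel₀ hs0.ne', one_smul]; module
  rw [this, norm_smul, Real.norm_of_nonneg hs0.le, ← dist_eq_norm]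
  have := H.diam b (subset_closure hbE) x hx
  gcongr

theorem Shp.coneK_mem (H : Shp ρ h z E) {x q : Pl} (hx : x ∈ closure E)
    (hq : (x, q) ∈ coneK z (ρ * h)) : q ∈ E := by
  obtain ⟨s, h0, h1, h2⟩ := hq
  have hR : 0 < ρ * h := mul_pos H.ρ0 H.h0
  refine cone_mem H.star hx h0 h1 (h2.trans ?_)
  have := mul_pos h0 hR
  linarith

theorem Shp.coneK_dist (H : Shp ρ h z E) {x q y : Pl} (hx : x ∈ closure E)
    (hq : (x, q) ∈ coneK z (ρ * h)) (hy : y ∉ E) : ‖q - x‖ ≤ 2 / ρ * dist q y := by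
  obtain ⟨s, h0, h1, h2⟩ := hq
  have a1 := H.near hx h0 h2
  have a2 := H.far hx h0 h1 h2 hy
  have := H.ρ0
  calc _ ≤ s * h := a1
    _ = 2 / ρ * (s * (ρ * h / 2)) := by field_simp
    _ ≤ _ := by gcongr

/-- common ball -/
theorem Shp.common (H : Shp ρ h z E) {x y : Pl} (hx : x ∈ frontier E) (hy : y ∈ frontier E)
    (hxy : x ≠ y) {τ : ℝ} (hτ : τ = dist x y / (dist x y + ρ * h / 2)) {q : Pl}
    (hq : dist q ((1/2 : ℝ) • ((x + τ • (z - x)) + (y + τ • (z - y)))) < ρ * dist x y / 8) :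
    (x, q) ∈ coneK z (ρ * h) ∧ dist x y ≤ 4 / ρ * ‖q - x‖ ∧ ρ / 2 * ‖q - x‖ ≤ dist x y := by
  have hR : 0 < ρ * h := mul_pos H.ρ0 H.h0
  have h0 := H.h0
  have hρ := H.ρ0
  have hρ1 := H.ρ1
  set d := dist x y with hd
  have d0 : 0 < d := dist_pos.2 hxy
  have dh : d ≤ h := H.diam x hx.1 y hy.1
  have hden : 0 < d + ρ * h / 2 := by positivity
  have τ0 : 0 < τ := by rw [hτ]; positivity
  have τ1 : τ ≤ 1 := by rw [hτ, div_le_one hden]; linarith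
  have τd : (1 - τ) * d = τ * (ρ * h / 2) := by rw [hτ]; field_simp; ring
  have τl : d ≤ τ * (2 * h) := by
    rw [hτ, div_mul_eq_mul_div, le_div_iff₀ hden]
    have : ρ * h ≤ 1 * h := by gcongr
    gcongr; linarith
  have τu : τ * (ρ * h / 2) ≤ d := by nlinarith
  have key : dist q (x + τ • (z - x)) < τ * (ρ * h / 2) := by
    have t1 := dist_triangle q ((1/2 : ℝ) • ((x + τ • (z - x)) + (y + τ • (z - y)))) (x + τ • (z - x))
    have t2 : dist ((1/2 : ℝ) • ((x + τ • (z - x)) + (y + τ • (z - y)))) (x + τ • (z - x)) = (1 - τ) / 2 * d := by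
      rw [hd, dist_comm x y, dist_eq_norm, dist_eq_norm]
      have : (1/2 : ℝ) • ((x + τ • (z - x)) + (y + τ • (z - y))) - (x + τ • (z - x)) = ((1 - τ) / 2) • (y - x) := by
        module
      rw [this, norm_smul, Real.norm_of_nonneg (by linarith)]
    have : ρ * d ≤ ρ * (τ * (2 * h)) := by gcongr
    linarith
  refine ⟨⟨τ, τ0, τ1, key⟩, ?_, ?_⟩
  · have := H.far hx.1 τ0 τ1 key (H.frontier_not hx)
    rw [dist_eq_norm] at this
    calc d ≤ τ * (2 * h) := τl
      _ = 4 / ρ * (τ * (ρ * h / 2)) := by field_simp; norm_num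
      _ ≤ _ := by gcongr
  · have := H.near hx.1 τ0 key
    calc _ ≤ ρ / 2 * (τ * h) := by gcongr
      _ = τ * (ρ * h / 2) := by ring
      _ ≤ d := τu

def crs (u w : Pl) : ℝ := u 0 * w 1 - u 1 * w 0

theorem crs_sq (u w : Pl) : ‖u‖ ^ 2 * ‖w‖ ^ 2 = inner ℝ u w ^ 2 + crs u w ^ 2 := by
  rw [EuclideanSpace.real_norm_sq_eq, EuclideanSpace.real_norm_sq_eq]
  simp only [PiLp.inner_apply, Fin.sum_univ_two, crs]
  simp
  ring

theorem crs_sub (u w w' : Pl) : crs u (w - w') = crs u w - crs u w' := by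
  simp [crs]; ring

theorem crs_le (u w : Pl) : |crs u w| ≤ ‖u‖ * ‖w‖ := by
  apply abs_le_of_sq_le_sq _ (by positivity)
  rw [mul_pow, crs_sq]; nlinarith [sq_nonneg (inner ℝ u w)]

theorem Shp.graph_aux (H : Shp ρ h z E) {x0 x y : Pl} (hx0 : x0 ∈ frontier E) (hx : x ∈ frontier E)
    (hy : y ∈ frontier E) (d1 : dist x x0 ≤ ρ * h / 2) (d2 : dist x y ≤ ρ * h / 2)
    (hs : inner ℝ (x0 - z) (y - x) ≤ 0) :
    dist x y ≤ (1 + 2 / ρ) * (|crs (x0 - z) (y - x)| / ‖x0 - z‖) := by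
  have hρ := H.ρ0
  have h0 := H.h0
  set u := x0 - z with hu
  have hR : 0 < ρ * h := mul_pos H.ρ0 H.h0
  have n1 : ρ * h < ‖u‖ := by
    by_contra! hc
    exact H.frontier_not hx0 (H.ball (by rwa [mem_closedBall, dist_eq_norm]))
  have n2 : ‖u‖ ≤ h := by
    rw [hu, ← dist_eq_norm]
    exact H.diam _ hx0.1 _ (subset_closure (H.ball (by simp [hR.le])))
  have n0 : 0 < ‖u‖ := by linarith
  set w := y - x with hw
  have hwd : ‖w‖ = dist x y := by rw [dist_comm, dist_eq_norm]
  set s : ℝ := - inner ℝ u w / ‖u‖ ^ 2 with hsd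
  have s0 : 0 ≤ s := div_nonneg (by linarith) (by positivity)
  have s1 : s ≤ 1 := by
    rw [hsd, div_le_one (by positivity)]
    have := abs_real_inner_le_norm u w
    have := neg_abs_le (inner ℝ u w)
    nlinarith
  set w' := w + s • u with hw'
  have i1 : inner ℝ u w' = 0 := by
    rw [hw', inner_add_right, inner_smul_right, real_inner_self_eq_norm_sq, hsd]
    field_simp; ring
  have i2 : crs u w' = crs u w := by
    simp [hw', crs]; ring
  have i3 : ‖w'‖ = |crs u w| / ‖u‖ := by
    rw [eq_div_iff n0.ne']
    have := crs_sq u w'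
    rw [i1, i2] at this
    rw [← abs_of_nonneg (show 0 ≤ ‖w'‖ * ‖u‖ by positivity)]
    apply (sq_eq_sq_iff_abs_eq_abs _ _).1
    linarith
  rw [← i3]
  have i4 : s * (ρ * h) ≤ ‖w'‖ + s * (ρ * h / 2) := by
    rcases s0.eq_or_lt with h | spos
    · rw [← h]; simp
    by_contra! hc
    apply H.frontier_not hy
    refine cone_mem H.star hx.1 spos s1 (lt_of_le_of_lt ?_ hc)
    rw [dist_eq_norm]
    have : y - (x + s • (z - x)) = w' + s • (x - x0) := by
      rw [hw', hw, hu]; module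
    rw [this]
    refine (norm_add_le _ _).trans ?_
    rw [norm_smul, Real.norm_of_nonneg s0, ← dist_eq_norm]
    gcongr
  have i5 : s * ‖u‖ ≤ 2 / ρ * ‖w'‖ := by
    calc s * ‖u‖ ≤ s * h := by gcongr
      _ = 2 / ρ * (s * (ρ * h / 2)) := by field_simp
      _ ≤ _ := by gcongr; linarith
  have i6 : ‖w‖ ≤ ‖w'‖ + s * ‖u‖ := by
    have : w = w' - s • u := by rw [hw']; module
    calc ‖w‖ = ‖w' - s • u‖ := congrArg _ this
      _ ≤ _ := norm_sub_le _ _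
      _ = _ := by rw [norm_smul, Real.norm_of_nonneg s0]
  rw [← hwd]
  linarith

theorem Shp.graph (H : Shp ρ h z E) {x0 x y : Pl} (hx0 : x0 ∈ frontier E) (hx : x ∈ frontier E)
    (hy : y ∈ frontier E) (d1 : dist x x0 ≤ ρ * h / 2) (d1' : dist y x0 ≤ ρ * h / 2)
    (d2 : dist x y ≤ ρ * h / 2) :
    dist x y ≤ (1 + 2 / ρ) * (|crs (x0 - z) x / ‖x0 - z‖ - crs (x0 - z) y / ‖x0 - z‖|) := by
  rw [← sub_div, abs_div, abs_norm, ← crs_sub]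
  rcases le_total (inner ℝ (x0 - z) (y - x)) 0 with hs | hs
  · have := H.graph_aux hx0 hx hy d1 d2 hs
    rwa [crs_sub, abs_sub_comm, ← crs_sub] at this
  · have := H.graph_aux hx0 hy hx d1' (by rwa [dist_comm]) 
      (by rw [← neg_sub y x, inner_neg_right]; linarith)
    rwa [dist_comm]

theorem Shp.reg_small (H : Shp ρ h z E) (p : Pl) {r : ℝ} (hr0 : 0 < r) (hr : r ≤ ρ * h / 4) :
    μH[1] (frontier E ∩ closedBall p r) ≤ ENNReal.ofReal (2 * (1 + 2 / ρ) * r) := by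
  have hρ := H.ρ0
  set S := frontier E ∩ closedBall p r with hS
  rcases S.eq_empty_or_nonempty with h | ⟨x0, hx0⟩
  · rw [h]; simp
  set f : Pl → ℝ := fun x => crs (x0 - z) x / ‖x0 - z‖ with hf
  have dd : ∀ x ∈ S, ∀ y ∈ S, dist x y ≤ ρ * h / 2 := fun x hx y hy => by
    have := dist_triangle_right x y p
    have := mem_closedBall.1 hx.2
    have := mem_closedBall.1 hy.2
    linarith
  have anti : AntilipschitzWith (Real.toNNReal (1 + 2 / ρ)) (S.domRestrict f) := by
    apply AntilipschitzWith.of_le_mul_dist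
    rintro ⟨x, hx⟩ ⟨y, hy⟩
    rw [Real.coe_toNNReal _ (by positivity)]
    exact H.graph hx0.1 hx.1 hy.1 (dd _ hx _ hx0) (dd _ hy _ hx0) (dd _ hx _ hy)
  have b1 := anti.le_hausdorffMeasure_image zero_le_one univ
  have b2 : (μH[1] : Measure S) univ = μH[1] S := by
    rw [← isometry_subtype_coe.hausdorffMeasure_image (Or.inl zero_le_one)]
    simp
  have b3 : S.domRestrict f '' univ ⊆ closedBall (f p) r := by
    rintro _ ⟨⟨x, hx⟩, -, rfl⟩
    rw [mem_closedBall, Real.dist_eq]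
    change |crs (x0 - z) x / ‖x0 - z‖ - crs (x0 - z) p / ‖x0 - z‖| ≤ r
    rw [← sub_div, ← crs_sub, abs_div, abs_norm]
    have := mem_closedBall.1 hx.2
    rw [dist_eq_norm] at this
    apply div_le_of_le_mul₀ (norm_nonneg _) hr0.le
    refine (crs_le _ _).trans ?_
    rw [mul_comm]; gcongr
  rw [b2, hausdorffMeasure_real] at b1
  refine b1.trans ?_
  calc _ ≤ _ * volume (closedBall (f p) r) := by gcongr
    _ = _ := by
      rw [Real.volume_closedBall, ENNReal.rpow_one]
      change ENNReal.ofReal _ * _ = _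
      rw [← ENNReal.ofReal_mul (by positivity)]
      congr 1; ring

theorem reg_const (ρ : ℝ) (hρ : 0 < ρ) : ∃ A : ℝ, 0 < A ∧ ∀ (h : ℝ) (z : Pl) (E : Set Pl), Shp ρ h z E →
    ∀ p : Pl, ∀ r : ℝ, 0 < r → μH[1] (frontier E ∩ closedBall p r) ≤ ENNReal.ofReal (A * r) := by
  obtain ⟨t, htf, ht⟩ := Metric.totallyBounded_iff.1
    (isCompact_closedBall (0 : Pl) 1).totallyBounded (ρ / 4) (by positivity)
  lift t to Finset Pl using htf
  refine ⟨(t.card + 1) * (2 * (1 + 2 / ρ)), by positivity, fun h z E H p r hr => ?_⟩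
  have h0 := H.h0
  rcases le_total r (ρ * h / 4) with hc | hc
  · refine (H.reg_small p hr hc).trans (ENNReal.ofReal_le_ofReal ?_)
    have : 0 ≤ (t.card : ℝ) * (2 * (1 + 2 / ρ) * r) := by positivity
    linarith
  have hsub : frontier E ∩ closedBall p r ⊆ ⋃ a ∈ t, (frontier E ∩ closedBall (z + h • a) (ρ * h / 4)) := by
    rintro x ⟨hx, -⟩
    have hxz : dist x z ≤ h := H.diam _ hx.1 _ 
      (subset_closure (H.ball (by simp [(mul_pos hρ h0).le])))
    have : h⁻¹ • (x - z) ∈ closedBall (0 : Pl) 1 := by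
      rw [mem_closedBall_zero_iff, norm_smul, Real.norm_of_nonneg (by positivity), ← dist_eq_norm,
        inv_mul_le_iff₀ h0]
      linarith
    obtain ⟨a, ha, hb⟩ := mem_iUnion₂.1 (ht this)
    refine mem_iUnion₂.2 ⟨a, ha, hx, ?_⟩
    rw [mem_closedBall, dist_eq_norm]
    rw [mem_ball, dist_eq_norm] at hb
    have e : x - (z + h • a) = h • (h⁻¹ • (x - z) - a) := by
      rw [smul_sub, smul_smul, mul_inv_cancel₀ h0.ne', one_smul]; abel
    rw [e, norm_smul, Real.norm_of_nonneg h0.le]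
    calc _ ≤ h * (ρ / 4) := by gcongr
      _ = _ := by ring
  calc _ ≤ _ := measure_mono hsub
    _ ≤ _ := measure_biUnion_finset_le _ _
    _ ≤ ∑ a ∈ t, ENNReal.ofReal (2 * (1 + 2 / ρ) * (ρ * h / 4)) := 
      Finset.sum_le_sum fun a _ => H.reg_small _ (by positivity) le_rfl
    _ = ENNReal.ofReal (t.card * (2 * (1 + 2 / ρ) * (ρ * h / 4))) := by
      rw [Finset.sum_const, nsmul_eq_mul, ENNReal.ofReal_mul (p := (t.card : ℝ)) (by positivity),
        ENNReal.ofReal_natCast]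
    _ ≤ _ := by
      apply ENNReal.ofReal_le_ofReal
      have : (t.card : ℝ) * (2 * (1 + 2 / ρ) * (ρ * h / 4)) ≤ t.card * (2 * (1 + 2 / ρ) * r) := by gcongr
      have : 0 ≤ (2 * (1 + 2 / ρ) * r) := by positivity
      linarith

theorem wt_int : ∫⁻ s in Ioc (0:ℝ) 1, ENNReal.ofReal (s ^ (-(1/2) : ℝ)) = 2 := by
  have hi : IntervalIntegrable (fun s : ℝ => s ^ (-(1/2) : ℝ)) volume 0 1 :=
    intervalIntegral.intervalIntegrable_rpow' (by norm_num)
  rw [intervalIntegrable_iff_integrableOn_Ioc_of_le zero_le_one] at hi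
  rw [← ofReal_integral_eq_lintegral_ofReal hi]
  · rw [← intervalIntegral.integral_of_le zero_le_one, integral_rpow (Or.inl (by norm_num))]
    norm_num
  · filter_upwards [self_mem_ae_restrict measurableSet_Ioc] with s hs
    exact Real.rpow_nonneg hs.1.le _

theorem cs_wt {g : ℝ → ENNReal} (hg : Measurable g) :
    (∫⁻ s in Ioc (0:ℝ) 1, g s) ^ 2 ≤ 2 * ∫⁻ s in Ioc (0:ℝ) 1, ENNReal.ofReal (s ^ (1/2 : ℝ)) * g s ^ 2 := by
  have h1 := ENNReal.lintegral_mul_le_Lp_mul_Lq (volume.restrict (Ioc (0:ℝ) 1)) 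
    (Real.HolderConjugate.two_two) (f := fun s => ENNReal.ofReal (s ^ (-(1/4) : ℝ)))
    (g := fun s => ENNReal.ofReal (s ^ (1/4 : ℝ)) * g s) (by fun_prop) (by fun_prop)
  have e1 : ∫⁻ s in Ioc (0:ℝ) 1, ((fun s : ℝ => ENNReal.ofReal (s ^ (-(1/4) : ℝ))) * fun s => ENNReal.ofReal (s ^ (1/4 : ℝ)) * g s) s
      = ∫⁻ s in Ioc (0:ℝ) 1, g s := by
    refine setLIntegral_congr_fun measurableSet_Ioc fun s hs => ?_
    have hs0 : 0 < s := hs.1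
    simp only [Pi.mul_apply]
    rw [← mul_assoc, ← ENNReal.ofReal_mul (by positivity), ← Real.rpow_add hs0]
    norm_num
  have e2 : ∫⁻ s in Ioc (0:ℝ) 1, ENNReal.ofReal (s ^ (-(1/4) : ℝ)) ^ (2:ℝ) = 2 := by
    rw [← wt_int]
    refine setLIntegral_congr_fun measurableSet_Ioc fun s hs => ?_
    have hs0 : 0 < s := hs.1
    rw [ENNReal.ofReal_rpow_of_nonneg (by positivity) (by norm_num), ← Real.rpow_mul hs0.le]
    norm_num
  have e3 : ∫⁻ s in Ioc (0:ℝ) 1, (ENNReal.ofReal (s ^ (1/4 : ℝ)) * g s) ^ (2:ℝ) = 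
      ∫⁻ s in Ioc (0:ℝ) 1, ENNReal.ofReal (s ^ (1/2 : ℝ)) * g s ^ 2 := by
    refine setLIntegral_congr_fun measurableSet_Ioc fun s hs => ?_
    have hs0 : 0 < s := hs.1
    rw [ENNReal.mul_rpow_of_nonneg _ _ (by norm_num), 
      ENNReal.ofReal_rpow_of_nonneg (by positivity) (by norm_num), ← Real.rpow_mul hs0.le]
    norm_num
  rw [e1, e2, e3] at h1
  calc _ ≤ _ := pow_le_pow_left₀ zero_le h1 2
    _ = _ := by
      rw [mul_pow, ← ENNReal.rpow_natCast, ← ENNReal.rpow_natCast, ← ENNReal.rpow_mul, ← ENNReal.rpow_mul]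
      norm_num

theorem seg_est {v : Pl → ℝ} {U : Set Pl} (hU : IsOpen U) (hv : ContDiffOn ℝ 1 v U) {x q : Pl}
    (hseg : ∀ t ∈ Icc (0:ℝ) 1, x + t • (q - x) ∈ U) :
    ‖v x - v q‖ₑ ^ 2 ≤ ‖q - x‖ₑ ^ 2 * 
      (2 * ∫⁻ s in Ioc (0:ℝ) 1, ENNReal.ofReal (s ^ (1/2 : ℝ)) * ‖fderiv ℝ v (x + s • (q - x))‖ₑ ^ 2) := by
  have hc : ContDiffOn ℝ 1 (fun t : ℝ => v (x + t • (q - x))) (Icc 0 1) :=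
    hv.comp (by fun_prop) hseg
  have h1 := enorm_sub_le_lintegral_deriv_of_contDiffOn_Icc hc zero_le_one
  rw [← restrict_Ioc_eq_restrict_Icc] at h1
  have hm : Measurable (fun s : ℝ => ‖fderiv ℝ v (x + s • (q - x))‖ₑ) := by
    have := measurable_fderiv ℝ v
    fun_prop
  have h2 : ∫⁻ t in Ioc (0:ℝ) 1, ‖deriv (fun t : ℝ => v (x + t • (q - x))) t‖ₑ ≤ 
      ‖q - x‖ₑ * ∫⁻ t in Ioc (0:ℝ) 1, ‖fderiv ℝ v (x + t • (q - x))‖ₑ := by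
    rw [← lintegral_const_mul _ hm]
    refine setLIntegral_mono' measurableSet_Ioc fun t ht => ?_
    have hd : DifferentiableAt ℝ v (x + t • (q - x)) := 
      (hv.contDiffAt (hU.mem_nhds (hseg t ⟨ht.1.le, ht.2⟩))).differentiableAt one_ne_zero
    have hl : HasDerivAt (fun t : ℝ => x + t • (q - x)) (q - x) t := by
      simpa using ((hasDerivAt_id t).smul_const (q - x)).const_add x
    have := (hd.hasFDerivAt.comp_hasDerivAt t hl).deriv
    rw [Function.comp_def] at this
    rw [this, mul_comm]
    exact ContinuousLinearMap.le_opENorm _ _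
  have h3 := h1.trans h2
  simp only [one_smul, zero_smul, add_zero, add_sub_cancel] at h3
  rw [← enorm_neg, neg_sub]
  calc _ ≤ _ := pow_le_pow_left₀ zero_le h3 2
    _ ≤ _ := by
      rw [mul_pow]
      gcongr
      exact cs_wt hm

theorem homothety_lintegral {f : Pl → ENNReal} (hf : Measurable f) (x : Pl) {s : ℝ} (hs : 0 < s) :
    ∫⁻ q, f (x + s • (q - x)) = ENNReal.ofReal ((s ^ 2)⁻¹) * ∫⁻ q, f q := by
  rw [lintegral_sub_right_eq_self (fun q => f (x + s • q)) x]
  rw [← lintegral_add_left_eq_self f x]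
  have := Measure.map_addHaar_smul (volume : Measure Pl) hs.ne'
  have h2 : ∫⁻ q, f (x + s • q) = ∫⁻ q, f (x + q) ∂(Measure.map (fun q => s • q) volume) := by
    rw [lintegral_map (by fun_prop) (by fun_prop)]
  rw [h2, this, lintegral_smul_measure]
  simp [abs_of_pos hs]

/-- Step 2 -/
theorem Shp.step2 (H : Shp ρ h z E) {v : Pl → ℝ} {U : Set Pl} (hU : IsOpen U) (hEU : closure E ⊆ U)
    (hv : ContDiffOn ℝ 1 v U) {x : Pl} (hx : x ∈ frontier E) :
    ∫⁻ q, {q | (x, q) ∈ coneK z (ρ * h)}.indicator (fun q => ‖v x - v q‖ₑ ^ 2 * ‖q - x‖ₑ⁻¹ ^ 3) q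
     ≤ 4 * ∫⁻ q, {q | (x, q) ∈ coneK z (ρ * h)}.indicator (fun q => ‖fderiv ℝ v q‖ₑ ^ 2 * ‖q - x‖ₑ⁻¹) q := by
  set K := {q | (x, q) ∈ coneK z (ρ * h)} with hK
  have hKm : MeasurableSet K := ((isOpen_coneK z (ρ * h)).preimage (by fun_prop : Continuous fun q => (x, q))).measurableSet
  have hne : ∀ q ∈ K, ‖q - x‖ₑ ≠ 0 := fun q hq => by
    have : q ∈ E := H.coneK_mem hx.1 hq
    rw [enorm_ne_zero, sub_ne_zero]
    rintro rfl
    exact H.frontier_not hx this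
  have hmf := measurable_fderiv ℝ v
  set Hf : Pl → ENNReal := K.indicator (fun q => ‖fderiv ℝ v q‖ₑ ^ 2 * ‖q - x‖ₑ⁻¹) with hHf
  have hHm : Measurable Hf := Measurable.indicator (by fun_prop) hKm
  have p1 : ∀ q, K.indicator (fun q => ‖v x - v q‖ₑ ^ 2 * ‖q - x‖ₑ⁻¹ ^ 3) q ≤ 
      2 * ∫⁻ s in Ioc (0:ℝ) 1, ENNReal.ofReal (s ^ (3/2 : ℝ)) * Hf (x + s • (q - x)) := by
    intro q
    by_cases hq : q ∈ K
    swap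
    · rw [indicator_of_notMem hq]; exact zero_le
    rw [indicator_of_mem hq]
    have hseg : ∀ t ∈ Icc (0:ℝ) 1, x + t • (q - x) ∈ U := by
      intro t ht
      apply hEU
      rcases ht.1.eq_or_lt with h | h
      · rw [← h]; simpa using hx.1
      · exact subset_closure (H.coneK_mem hx.1 (coneK_scale hq h ht.2))
    have h1 := seg_est hU hv hseg
    set a := ‖q - x‖ₑ with ha
    have a0 : a ≠ 0 := hne q hq
    have at' : a ≠ ⊤ := enorm_ne_top
    calc _ ≤ _ := mul_le_mul_left h1 _
      _ = 2 * (a⁻¹ * ∫⁻ s in Ioc (0:ℝ) 1, ENNReal.ofReal (s ^ (1/2 : ℝ)) * ‖fderiv ℝ v (x + s • (q - x))‖ₑ ^ 2) := by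
        have : a ^ 2 * a⁻¹ ^ 3 = a⁻¹ := by
          rw [pow_succ a⁻¹ 2, ← mul_assoc, ← mul_pow, ENNReal.mul_inv_cancel a0 at']; simp
        calc _ = 2 * ((a ^ 2 * a⁻¹ ^ 3) * ∫⁻ s in Ioc (0:ℝ) 1, ENNReal.ofReal (s ^ (1/2 : ℝ)) * ‖fderiv ℝ v (x + s • (q - x))‖ₑ ^ 2) := by ring
          _ = _ := by rw [this]
      _ = _ := by
        rw [← lintegral_const_mul _ (by fun_prop)]
        congr 1
        refine setLIntegral_congr_fun measurableSet_Ioc fun s hs => ?_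
        have hs0 : 0 < s := hs.1
        have hmem : x + s • (q - x) ∈ K := coneK_scale hq hs.1 hs.2
        simp only [hHf]
        rw [indicator_of_mem hmem, add_sub_cancel_left, enorm_smul, Real.enorm_of_nonneg hs0.le, ← ha,
          ENNReal.mul_inv (Or.inr at') (Or.inr a0), ← ENNReal.ofReal_inv_of_pos hs0]
        have : ENNReal.ofReal (s ^ (1/2 : ℝ)) = ENNReal.ofReal (s ^ (3/2 : ℝ)) * ENNReal.ofReal s⁻¹ := by
          rw [← ENNReal.ofReal_mul (by positivity), ← Real.rpow_neg_one, ← Real.rpow_add hs0]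
          norm_num
        rw [this]; ring
  calc _ ≤ _ := lintegral_mono p1
    _ = 2 * ∫⁻ s in Ioc (0:ℝ) 1, ∫⁻ q, ENNReal.ofReal (s ^ (3/2 : ℝ)) * Hf (x + s • (q - x)) := by
      rw [lintegral_const_mul, lintegral_lintegral_swap]
      · apply Measurable.aemeasurable
        unfold Function.uncurry
        fun_prop
      · apply Measurable.lintegral_prod_right' (f := fun a : Pl × ℝ => ENNReal.ofReal (a.2 ^ (3/2 : ℝ)) * Hf (x + a.2 • (a.1 - x)))
        fun_prop
    _ = 2 * ∫⁻ s in Ioc (0:ℝ) 1, ENNReal.ofReal (s ^ (-(1/2) : ℝ)) * ∫⁻ q, Hf q := by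
      congr 1
      refine setLIntegral_congr_fun measurableSet_Ioc fun s hs => ?_
      have hs0 : 0 < s := hs.1
      rw [lintegral_const_mul _ (by fun_prop), homothety_lintegral hHm x hs0, ← mul_assoc,
        ← ENNReal.ofReal_mul (by positivity), ← Real.rpow_natCast, ← Real.rpow_neg hs0.le, ← Real.rpow_add hs0]
      norm_num
    _ = _ := by
      rw [lintegral_mul_const _ (by fun_prop), wt_int, ← mul_assoc]; norm_num

def HasReg (A : ℝ) (E : Set Pl) : Prop :=
  ∀ p : Pl, ∀ r : ℝ, 0 < r → μH[1] (frontier E ∩ closedBall p r) ≤ ENNReal.ofReal (A * r)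

theorem Shp.finite (H : Shp ρ h z E) {A : ℝ} (hA : HasReg A E) :
    IsFiniteMeasure ((μH[1] : Measure Pl).restrict (frontier E)) := by
  refine ⟨?_⟩
  rw [Measure.restrict_apply_univ]
  have : frontier E = frontier E ∩ closedBall z h := by
    symm; rw [inter_eq_left]
    intro x hx
    exact H.diam _ hx.1 _ (subset_closure (H.ball (by simp [(mul_pos H.ρ0 H.h0).le])))
  rw [this]
  exact (hA z h H.h0).trans_lt ENNReal.ofReal_lt_top

theorem enorm_le_of {x y : Pl} {t : ℝ} (ht : 0 ≤ t) (hh : ‖x‖ ≤ t * ‖y‖) :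
    ‖x‖ₑ ≤ ENNReal.ofReal t * ‖y‖ₑ := by
  rw [← ofReal_norm, ← ofReal_norm, ← ENNReal.ofReal_mul ht]
  exact ENNReal.ofReal_le_ofReal hh

theorem inv_le_of_le_mul {a b c : ENNReal} (hc0 : c ≠ 0) (hct : c ≠ ⊤) (hh : a ≤ c * b) : b⁻¹ ≤ c * a⁻¹ := by
  have : (c * b)⁻¹ ≤ a⁻¹ := ENNReal.inv_le_inv.2 hh
  rw [ENNReal.mul_inv (Or.inl hc0) (Or.inl hct)] at this
  calc b⁻¹ = c * (c⁻¹ * b⁻¹) := by rw [← mul_assoc, ENNReal.mul_inv_cancel hc0 hct, one_mul]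
    _ ≤ _ := by gcongr

theorem ofReal_mul_norm {t : ℝ} (ht : 0 ≤ t) (x : Pl) : ENNReal.ofReal (t * ‖x‖) = ENNReal.ofReal t * ‖x‖ₑ := by
  rw [ENNReal.ofReal_mul ht, ofReal_norm]

theorem Shp.step3 (H : Shp ρ h z E) {A : ℝ} (hA0 : 0 < A) (hA : HasReg A E) (v : Pl → ℝ) :
    ∫⁻ x in frontier E, (∫⁻ q, {q | (x, q) ∈ coneK z (ρ * h)}.indicator (fun q => ‖fderiv ℝ v q‖ₑ ^ 2 * ‖q - x‖ₑ⁻¹) q) ∂μH[1]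
    ≤ (ENNReal.ofReal (2 / ρ) * ENNReal.ofReal (A * (2 / ρ))) * ∫⁻ q in E, ‖fderiv ℝ v q‖ₑ ^ 2 := by
  have hρ := H.ρ0
  have hmf := measurable_fderiv ℝ v
  have := H.finite hA
  have hKm : MeasurableSet (coneK z (ρ * h)) := (isOpen_coneK z (ρ * h)).measurableSet
  have hfe : MeasurableSet (frontier E) := isClosed_frontier.measurableSet
  rw [lintegral_lintegral_swap]
  swap
  · apply Measurable.aemeasurable
    have : Measurable ((coneK z (ρ * h)).indicator (fun a : Pl × Pl => ‖fderiv ℝ v a.2‖ₑ ^ 2 * ‖a.2 - a.1‖ₑ⁻¹)) :=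
      Measurable.indicator (by fun_prop) hKm
    exact this
  rw [← lintegral_indicator H.op.measurableSet, ← lintegral_const_mul]
  swap
  · exact Measurable.indicator (by fun_prop) H.op.measurableSet
  refine lintegral_mono fun p => ?_
  by_cases hex : ∃ x0 ∈ frontier E, (x0, p) ∈ coneK z (ρ * h)
  swap
  · push Not at hex
    refine (setLIntegral_mono' hfe (g := fun _ => 0) fun x hx => ?_).trans (by simp)
    rw [indicator_of_notMem]; exact hex x hx
  obtain ⟨x0, hx0, hp⟩ := hex
  have hpE : p ∈ E := H.coneK_mem hx0.1 hp
  rw [indicator_of_mem hpE]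
  have hn0 : 0 < ‖p - x0‖ := by
    rw [norm_pos_iff, sub_ne_zero]; rintro rfl; exact H.frontier_not hx0 hpE
  set B := closedBall p (2 / ρ * ‖p - x0‖) with hB
  have hc0 : ENNReal.ofReal (2 / ρ) ≠ 0 := by simp; positivity
  have key : ∀ x ∈ frontier E, {q | (x, q) ∈ coneK z (ρ * h)}.indicator (fun q => ‖fderiv ℝ v q‖ₑ ^ 2 * ‖q - x‖ₑ⁻¹) p
     ≤ B.indicator (fun _ => ‖fderiv ℝ v p‖ₑ ^ 2 * (ENNReal.ofReal (2 / ρ) * ‖p - x0‖ₑ⁻¹)) x := by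
    intro x hx
    by_cases hq : (x, p) ∈ coneK z (ρ * h)
    swap
    · rw [indicator_of_notMem (show p ∉ {q | (x, q) ∈ coneK z (ρ * h)} from hq)]; exact zero_le
    have d1 := H.coneK_dist hx.1 hq (H.frontier_not hx0)
    have d2 := H.coneK_dist hx0.1 hp (H.frontier_not hx)
    rw [dist_eq_norm] at d1 d2
    have hxB : x ∈ B := by rw [hB, mem_closedBall, dist_comm, dist_eq_norm]; exact d1
    rw [indicator_of_mem (show p ∈ {q | (x, q) ∈ coneK z (ρ * h)} from hq), indicator_of_mem hxB]
    gcongr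
    apply inv_le_of_le_mul hc0 ENNReal.ofReal_ne_top
    rw [← ofReal_mul_norm (by positivity), ← ofReal_norm]
    exact ENNReal.ofReal_le_ofReal d2
  refine (setLIntegral_mono' hfe key).trans ?_
  rw [lintegral_indicator_const isClosed_closedBall.measurableSet,
    Measure.restrict_apply isClosed_closedBall.measurableSet, inter_comm]
  have hm := hA p (2 / ρ * ‖p - x0‖) (by positivity)
  rw [← mul_assoc, ofReal_mul_norm (by positivity)] at hm
  have e0 : ‖p - x0‖ₑ ≠ 0 := by rw [enorm_ne_zero]; exact norm_pos_iff.1 hn0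
  calc _ ≤ _ := mul_le_mul_right hm _
    _ = (ENNReal.ofReal (2 / ρ) * ENNReal.ofReal (A * (2 / ρ))) * ‖fderiv ℝ v p‖ₑ ^ 2 * (‖p - x0‖ₑ⁻¹ * ‖p - x0‖ₑ) := by ring
    _ ≤ _ := by rw [ENNReal.inv_mul_cancel e0 enorm_ne_top, mul_one]

def kS (ρ h : ℝ) (z : Pl) : Set ((Pl × Pl) × Pl) :=
  {a | (a.1.1, a.2) ∈ coneK z (ρ * h) ∧ dist a.1.1 a.1.2 ≤ 4 / ρ * ‖a.2 - a.1.1‖}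

def kF (ρ h : ℝ) (z : Pl) (w : Pl → ℝ) : (Pl × Pl) × Pl → ENNReal :=
  (kS ρ h z).indicator fun a => ‖w a.1.1 - w a.2‖ₑ ^ 2 * ‖a.2 - a.1.1‖ₑ⁻¹ ^ 4

theorem kF_meas (ρ h : ℝ) (z : Pl) {w : Pl → ℝ} (hw : Measurable w) : Measurable (kF ρ h z w) := by
  refine Measurable.indicator (by fun_prop) ?_
  apply MeasurableSet.inter
  · exact ((isOpen_coneK z (ρ * h)).preimage (by fun_prop : Continuous fun a : (Pl × Pl) × Pl => (a.1.1, a.2))).measurableSet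
  · exact (isClosed_le (by fun_prop : Continuous fun a : (Pl × Pl) × Pl => dist a.1.1 a.1.2)
      (by fun_prop : Continuous fun a : (Pl × Pl) × Pl => 4 / ρ * ‖a.2 - a.1.1‖)).measurableSet

theorem Shp.step1 (H : Shp ρ h z E) {w : Pl → ℝ} (hw : Measurable w) {x y : Pl} (hx : x ∈ frontier E) (hy : y ∈ frontier E) :
    ‖w x - w y‖ₑ ^ 2 * ‖x - y‖ₑ⁻¹ ^ 2 ≤ 
      ((ENNReal.ofReal (ρ / 8)) ^ 2 * NNReal.pi)⁻¹ * (2 * ENNReal.ofReal (2 / ρ) ^ 4) * 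
       ((∫⁻ q, kF ρ h z w ((x, y), q)) + ∫⁻ q, kF ρ h z w ((y, x), q)) := by
  have hρ := H.ρ0
  rcases eq_or_ne x y with rfl | hxy
  · simp
  set c := ENNReal.ofReal (2 / ρ) with hc
  have hc0 : c ≠ 0 := by simp [hc]; positivity
  set V := (ENNReal.ofReal (ρ / 8)) ^ 2 * (NNReal.pi : ENNReal) with hV
  have hV0 : V ≠ 0 := by
    rw [hV]; refine mul_ne_zero (pow_ne_zero _ ?_) ?_
    · simp; positivity
    · simp [NNReal.pi_ne_zero]
  have hVt : V ≠ ⊤ := by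
    rw [hV]; exact ENNReal.mul_ne_top (ENNReal.pow_ne_top ENNReal.ofReal_ne_top) ENNReal.coe_ne_top
  set τ := dist x y / (dist x y + ρ * h / 2) with hτ
  set m := (1/2 : ℝ) • ((x + τ • (z - x)) + (y + τ • (z - y))) with hm
  set D := ‖x - y‖ₑ with hD
  have hD0 : D ≠ 0 := by rw [hD, enorm_ne_zero, sub_ne_zero]; exact hxy
  have hDt : D ≠ ⊤ := enorm_ne_top
  have half : ∀ x y : Pl, ∀ q : Pl, (x, q) ∈ coneK z (ρ * h) ∧ dist x y ≤ 4 / ρ * ‖q - x‖ ∧ ρ / 2 * ‖q - x‖ ≤ dist x y → 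
      ‖w x - w q‖ₑ ^ 2 * ‖x - y‖ₑ⁻¹ ^ 4 ≤ c ^ 4 * kF ρ h z w ((x, y), q) := by
    rintro x y q ⟨h1, h2, h3⟩
    rw [kF, indicator_of_mem (show ((x, y), q) ∈ kS ρ h z from ⟨h1, h2⟩)]
    have : ‖x - y‖ₑ⁻¹ ≤ c * ‖q - x‖ₑ⁻¹ := by
      apply inv_le_of_le_mul hc0 ENNReal.ofReal_ne_top
      rw [hc, ← ofReal_mul_norm (by positivity), ← ofReal_norm]
      apply ENNReal.ofReal_le_ofReal
      rw [dist_eq_norm] at h3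
      calc _ = 2 / ρ * (ρ / 2 * ‖q - x‖) := by field_simp
        _ ≤ _ := by gcongr
    calc _ ≤ ‖w x - w q‖ₑ ^ 2 * (c * ‖q - x‖ₑ⁻¹) ^ 4 := by gcongr
      _ = _ := by ring
  have pt : ∀ q ∈ Metric.ball m (ρ * dist x y / 8), ‖w x - w y‖ₑ ^ 2 * D⁻¹ ^ 4 ≤ 
      2 * c ^ 4 * (kF ρ h z w ((x, y), q) + kF ρ h z w ((y, x), q)) := by
    intro q hq
    have g1 := half x y q (H.common hx hy hxy hτ (mem_ball.1 hq))
    have g2 := half y x q (H.common hy hx hxy.symm (τ := τ) (by rw [dist_comm]) (by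
      rw [dist_comm y x, add_comm (y + _)]; exact mem_ball.1 hq))
    have hDs : ‖y - x‖ₑ = D := by rw [hD, ← enorm_neg, neg_sub]
    rw [hDs] at g2
    have tri : ‖w x - w y‖ₑ ^ 2 ≤ 2 * (‖w x - w q‖ₑ ^ 2 + ‖w y - w q‖ₑ ^ 2) := by
      simp only [Real.enorm_eq_ofReal_abs, ← ENNReal.ofReal_pow (abs_nonneg _), sq_abs]
      rw [← ENNReal.ofReal_add (by positivity) (by positivity), ← ENNReal.ofReal_ofNat,
        ← ENNReal.ofReal_mul (by positivity)]
      apply ENNReal.ofReal_le_ofReal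
      nlinarith [sq_nonneg ((w x - w q) + (w y - w q))]
    calc _ ≤ 2 * (‖w x - w q‖ₑ ^ 2 + ‖w y - w q‖ₑ ^ 2) * D⁻¹ ^ 4 := by gcongr
      _ = 2 * (‖w x - w q‖ₑ ^ 2 * D⁻¹ ^ 4 + ‖w y - w q‖ₑ ^ 2 * D⁻¹ ^ 4) := by ring
      _ ≤ 2 * (c ^ 4 * kF ρ h z w ((x, y), q) + c ^ 4 * kF ρ h z w ((y, x), q)) := by gcongr
      _ = _ := by ring
  have kx : ∀ x y : Pl, Measurable fun q => kF ρ h z w ((x, y), q) := fun x y =>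
    (kF_meas ρ h z hw).comp (by fun_prop)
  have vol : volume (Metric.ball m (ρ * dist x y / 8)) = V * D ^ 2 := by
    rw [EuclideanSpace.volume_ball_fin_two, hV, hD, dist_eq_norm, mul_div_right_comm,
      ofReal_mul_norm (by positivity), ← NNReal.coe_real_pi, ENNReal.ofReal_coe_nnreal]
    ring
  have int : V * D ^ 2 * (‖w x - w y‖ₑ ^ 2 * D⁻¹ ^ 4) ≤ 2 * c ^ 4 *
      ((∫⁻ q, kF ρ h z w ((x, y), q)) + ∫⁻ q, kF ρ h z w ((y, x), q)) := by
    rw [← vol, mul_comm, ← setLIntegral_const, ← lintegral_add_left (kx x y), 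
      ← lintegral_const_mul _ (by fun_prop)]
    exact (setLIntegral_mono' measurableSet_ball pt).trans (setLIntegral_le_lintegral _ _)
  calc _ = V⁻¹ * (V * D ^ 2 * (‖w x - w y‖ₑ ^ 2 * D⁻¹ ^ 4)) := by
        calc _ = (V⁻¹ * V) * (D * D⁻¹) ^ 2 * (‖w x - w y‖ₑ ^ 2 * D⁻¹ ^ 2) := by
              rw [ENNReal.inv_mul_cancel hV0 hVt, ENNReal.mul_inv_cancel hD0 hDt]; simp
          _ = _ := by ring
    _ ≤ _ := by rw [mul_assoc V⁻¹]; exact mul_le_mul_right int _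

theorem Shp.inner_y (H : Shp ρ h z E) {A : ℝ} (hA0 : 0 < A) (hA : HasReg A E) {w : Pl → ℝ} (hw : Measurable w) 
    {x : Pl} (hx : x ∈ frontier E) :
    ∫⁻ y in frontier E, (∫⁻ q, kF ρ h z w ((x, y), q)) ∂μH[1] ≤ ENNReal.ofReal (A * (4 / ρ)) *
    ∫⁻ q, {q | (x, q) ∈ coneK z (ρ * h)}.indicator (fun q => ‖w x - w q‖ₑ ^ 2 * ‖q - x‖ₑ⁻¹ ^ 3) q := by
  have hρ := H.ρ0
  have := H.finite hA
  have hKm : MeasurableSet {q | (x, q) ∈ coneK z (ρ * h)} := ((isOpen_coneK z (ρ * h)).preimage (by fun_prop : Continuous fun q => (x, q))).measurableSet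
  rw [lintegral_lintegral_swap, ← lintegral_const_mul]
  rotate_left
  · exact Measurable.indicator (by fun_prop) hKm
  · exact ((kF_meas ρ h z hw).comp (by fun_prop : Measurable fun a : Pl × Pl => ((x, a.1), a.2))).aemeasurable
  refine lintegral_mono fun q => ?_
  by_cases hq : (x, q) ∈ coneK z (ρ * h)
  swap
  · refine (lintegral_mono (g := fun _ => 0) fun y => ?_).trans (by simp)
    rw [kF, indicator_of_notMem]; exact fun hh => hq hh.1
  rw [indicator_of_mem (show q ∈ {q | (x, q) ∈ coneK z (ρ * h)} from hq)]
  have hqE : q ∈ E := H.coneK_mem hx.1 hq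
  have hn0 : 0 < ‖q - x‖ := by
    rw [norm_pos_iff, sub_ne_zero]; rintro rfl; exact H.frontier_not hx hqE
  set a := ‖q - x‖ₑ with ha
  have a0 : a ≠ 0 := by rw [ha, enorm_ne_zero]; exact norm_pos_iff.1 hn0
  have at' : a ≠ ⊤ := enorm_ne_top
  have e : ∀ y, kF ρ h z w ((x, y), q) = (closedBall x (4 / ρ * ‖q - x‖)).indicator 
      (fun _ => ‖w x - w q‖ₑ ^ 2 * a⁻¹ ^ 4) y := by
    intro y
    unfold kF
    simp only [indicator]
    congr 1
    rw [mem_closedBall, dist_comm y x]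
    simp [kS, hq]
  simp_rw [e]
  rw [lintegral_indicator_const isClosed_closedBall.measurableSet,
    Measure.restrict_apply isClosed_closedBall.measurableSet, inter_comm]
  have hm := hA x (4 / ρ * ‖q - x‖) (by positivity)
  rw [← mul_assoc, ofReal_mul_norm (by positivity)] at hm
  calc _ ≤ _ := mul_le_mul_right hm _
    _ = ENNReal.ofReal (A * (4 / ρ)) * (‖w x - w q‖ₑ ^ 2 * a⁻¹ ^ 3) * (a⁻¹ * a) := by rw [← ha]; ring
    _ ≤ _ := by rw [ENNReal.inv_mul_cancel a0 at', mul_one]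

theorem main_enn (ρ : ℝ) (hρ : 0 < ρ) : ∃ C : ENNReal, C ≠ ⊤ ∧ ∀ (h : ℝ) (z : Pl) (E : Set Pl), Shp ρ h z E →
    ∀ (v : Pl → ℝ) (U : Set Pl), IsOpen U → closure E ⊆ U → ContDiffOn ℝ 1 v U →
    ∫⁻ x in frontier E, ∫⁻ y in frontier E, ‖v x - v y‖ₑ ^ 2 * ‖x - y‖ₑ⁻¹ ^ 2 ∂μH[1] ∂μH[1] ≤
      C * ∫⁻ q in E, ‖fderiv ℝ v q‖ₑ ^ 2 := by
  obtain ⟨A, hA0, hA⟩ := reg_const ρ hρ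
  set C1 := ((ENNReal.ofReal (ρ / 8)) ^ 2 * (NNReal.pi : ENNReal))⁻¹ * (2 * ENNReal.ofReal (2 / ρ) ^ 4) with hC1
  set C2 := ENNReal.ofReal (A * (4 / ρ)) with hC2
  set C3 := ENNReal.ofReal (2 / ρ) * ENNReal.ofReal (A * (2 / ρ)) with hC3
  have hC1t : C1 ≠ ⊤ := by
    refine ENNReal.mul_ne_top (ENNReal.inv_ne_top.2 (mul_ne_zero (pow_ne_zero _ ?_) ?_)) 
      (ENNReal.mul_ne_top (by simp) (ENNReal.pow_ne_top ENNReal.ofReal_ne_top))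
    · simp; positivity
    · simp [NNReal.pi_ne_zero]
  have hC3t : C3 ≠ ⊤ := ENNReal.mul_ne_top ENNReal.ofReal_ne_top ENNReal.ofReal_ne_top
  refine ⟨C1 * (2 * (C2 * (4 * C3))), ?_, fun h z E H v U hU hEU hv => ?_⟩
  · exact ENNReal.mul_ne_top hC1t (ENNReal.mul_ne_top (by simp) (ENNReal.mul_ne_top ENNReal.ofReal_ne_top
      (ENNReal.mul_ne_top (by simp) hC3t)))
  have hAE : HasReg A E := hA h z E H
  have := H.finite hAE
  have hfe : MeasurableSet (frontier E) := isClosed_frontier.measurableSet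
  set w := (closure E).indicator v with hw
  have hwe : ∀ x ∈ closure E, w x = v x := fun x hx => indicator_of_mem hx _
  have hwm : Measurable w := by
    have := (hv.continuousOn.mono hEU)
    classical
    have h2 := this.measurable_piecewise (g := 0) continuousOn_const
      isClosed_closure.measurableSet
    rwa [piecewise_eq_indicator] at h2
  set F : Pl × Pl → ENNReal := fun a => ∫⁻ q, kF ρ h z w (a, q) with hF
  have hFm : Measurable F := (kF_meas ρ h z hwm).lintegral_prod_right'
  set I := ∫⁻ x in frontier E, ∫⁻ y in frontier E, F (x, y) ∂μH[1] ∂μH[1] with hI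
  have s1 : ∫⁻ x in frontier E, ∫⁻ y in frontier E, ‖v x - v y‖ₑ ^ 2 * ‖x - y‖ₑ⁻¹ ^ 2 ∂μH[1] ∂μH[1] ≤ 
      C1 * (2 * I) := by
    calc _ ≤ ∫⁻ x in frontier E, ∫⁻ y in frontier E, C1 * (F (x, y) + F (y, x)) ∂μH[1] ∂μH[1] := by
          refine setLIntegral_mono' hfe fun x hx => setLIntegral_mono' hfe fun y hy => ?_
          rw [← hwe x hx.1, ← hwe y hy.1]
          exact H.step1 hwm hx hy
      _ = C1 * (I + ∫⁻ x in frontier E, ∫⁻ y in frontier E, F (y, x) ∂μH[1] ∂μH[1]) := by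
          have m1 : Measurable fun x => ∫⁻ y in frontier E, F (x, y) ∂μH[1] := hFm.lintegral_prod_right'
          have m2 : Measurable fun x => ∫⁻ y in frontier E, F (y, x) ∂μH[1] := hFm.lintegral_prod_left'
          rw [hI, ← lintegral_add_left m1, ← lintegral_const_mul _ (by fun_prop)]
          refine lintegral_congr fun x => ?_
          rw [lintegral_const_mul _ (by fun_prop), lintegral_add_left (by fun_prop)]
      _ = _ := by
          rw [lintegral_lintegral_swap (f := fun x y => F (y, x)), ← two_mul]
          exact (hFm.comp measurable_swap).aemeasurable
  have s2 : I ≤ C2 * (4 * (C3 * ∫⁻ q in E, ‖fderiv ℝ v q‖ₑ ^ 2)) := by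
    have hKm := (isOpen_coneK z (ρ * h)).measurableSet
    have hmf := measurable_fderiv ℝ v
    have m3 : Measurable fun x => ∫⁻ q, {q | (x, q) ∈ coneK z (ρ * h)}.indicator (fun q => ‖fderiv ℝ v q‖ₑ ^ 2 * ‖q - x‖ₑ⁻¹) q := by
      have : Measurable ((coneK z (ρ * h)).indicator (fun a : Pl × Pl => ‖fderiv ℝ v a.2‖ₑ ^ 2 * ‖a.2 - a.1‖ₑ⁻¹)) :=
        Measurable.indicator (by fun_prop) hKm
      exact this.lintegral_prod_right'
    calc I ≤ ∫⁻ x in frontier E, C2 * (4 * ∫⁻ q, {q | (x, q) ∈ coneK z (ρ * h)}.indicator (fun q => ‖fderiv ℝ v q‖ₑ ^ 2 * ‖q - x‖ₑ⁻¹) q) ∂μH[1] := by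
          refine setLIntegral_mono' hfe fun x hx => (H.inner_y hA0 hAE hwm hx).trans ?_
          refine mul_le_mul_right (le_trans (le_of_eq ?_) (H.step2 hU hEU hv hx)) _
          refine lintegral_congr fun q => ?_
          refine congrFun (indicator_congr fun q hq => ?_) q
          rw [hwe x hx.1, hwe q (subset_closure (H.coneK_mem hx.1 hq))]
      _ ≤ _ := by
          rw [lintegral_const_mul _ (by fun_prop), lintegral_const_mul _ m3]
          gcongr
          exact H.step3 hA0 hAE v
  calc _ ≤ _ := s1
    _ ≤ C1 * (2 * (C2 * (4 * (C3 * ∫⁻ q in E, ‖fderiv ℝ v q‖ₑ ^ 2)))) := by gcongr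
    _ = _ := by ring

end Aux

/-- Lemma 3.2 (trace estimate): on a shape-regular element `E`, the squared Gagliardo
`H^{1/2}(∂E)` seminorm of `v` is controlled by the `H¹(E)` seminorm:
`|v|²_{1/2,∂E} ≲ |v|²_{1,E}`, with a constant depending only on `ρ`. -/
theorem trace_estimate_H_half (ρ : ℝ) (hρ : ρ ∈ Set.Ioo (0 : ℝ) 1) :
    ∃ C > (0 : ℝ), ∀ E : Set (EuclideanSpace ℝ (Fin 2)),
      IsOpen E → Bornology.IsBounded E → ShapeRegular ρ E →
      ∀ v : EuclideanSpace ℝ (Fin 2) → ℝ,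
      ∀ U : Set (EuclideanSpace ℝ (Fin 2)), IsOpen U → closure E ⊆ U →
        ContDiffOn ℝ 1 v U →
        (∫ x in frontier E, ∫ y in frontier E,
            |v x - v y| ^ 2 / ‖x - y‖ ^ 2 ∂μH[1] ∂μH[1]) ≤
          C * ∫ x in E, ‖gradient v x‖ ^ 2 := by
  obtain ⟨C, hCt, hC⟩ := main_enn ρ hρ.1
  refine ⟨C.toReal + 1, by positivity, fun E hE hb hsr v U hU hEU hv => ?_⟩
  obtain ⟨z, hz1, hz2⟩ := hsr
  have hzE : z ∈ E := hz1 (mem_closedBall_self (mul_nonneg hρ.1.le diam_nonneg))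
  have hd : 0 < diam E := by
    obtain ⟨ε, hε, hB⟩ := Metric.isOpen_iff.1 hE z hzE
    obtain ⟨u, hu⟩ := exists_norm_eq Pl (show (0:ℝ) ≤ ε / 2 by positivity)
    have hzu : z + u ∈ E := hB (by rw [Metric.mem_ball, dist_eq_norm, add_sub_cancel_left, hu]; linarith)
    have := dist_le_diam_of_mem hb hzu hzE
    rw [dist_eq_norm, add_sub_cancel_left, hu] at this
    linarith
  have H : Shp ρ (diam E) z E := ⟨hρ.1, hρ.2, hd, hE, hb, hz1, hz2, fun x hx y hy => by
    rw [← diam_closure E]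
    exact dist_le_diam_of_mem hb.closure hx hy⟩
  have main := hC _ z E H v U hU hEU hv
  have gn : ∀ x, ‖gradient v x‖ = ‖fderiv ℝ v x‖ := fun x => by simp [gradient]
  simp_rw [gn]
  set J := ∫⁻ q in E, ‖fderiv ℝ v q‖ₑ ^ 2 with hJ
  have hcl : IsCompact (closure E) := hb.isCompact_closure
  have hJt : J ≠ ⊤ := by
    have hcont : ContinuousOn (fun q => ‖fderiv ℝ v q‖ₑ ^ 2) (closure E) := by
      have := (hv.continuousOn_fderiv_of_isOpen hU le_rfl).mono hEU
      exact (ENNReal.continuous_pow 2).comp_continuousOn this.enorm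
    rcases hcl.exists_isMaxOn ⟨z, subset_closure hzE⟩ hcont with ⟨p, hp, hmax⟩
    have : J ≤ ∫⁻ q in E, ‖fderiv ℝ v p‖ₑ ^ 2 := 
      setLIntegral_mono' hE.measurableSet fun q hq => hmax (subset_closure hq)
    refine ne_top_of_le_ne_top ?_ this
    rw [setLIntegral_const]
    exact ENNReal.mul_ne_top (ENNReal.pow_ne_top enorm_ne_top) hb.measure_lt_top.ne
  have hR : ∫ x in E, ‖fderiv ℝ v x‖ ^ 2 = J.toReal := by
    rw [integral_eq_lintegral_of_nonneg_ae (Filter.Eventually.of_forall fun _ => by positivity)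
      ((measurable_fderiv ℝ v).norm.pow_const 2).aestronglyMeasurable]
    congr 1
    refine lintegral_congr fun x => ?_
    rw [ENNReal.ofReal_pow (norm_nonneg _), ofReal_norm]
  rw [hR]
  have hL : ‖∫ x in frontier E, ∫ y in frontier E,
            |v x - v y| ^ 2 / ‖x - y‖ ^ 2 ∂μH[1] ∂μH[1]‖ₑ ≤ C * J := by
    refine le_trans ?_ main
    refine (enorm_integral_le_lintegral_enorm _).trans ?_
    refine lintegral_mono fun x => ?_
    refine (enorm_integral_le_lintegral_enorm _).trans ?_
    refine lintegral_mono fun y => ?_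
    rcases eq_or_ne x y with rfl | hxy
    · simp
    have : 0 < ‖x - y‖ := norm_pos_iff.2 (sub_ne_zero.2 hxy)
    rw [div_eq_mul_inv, enorm_mul, ← inv_pow, enorm_pow, enorm_pow, enorm_inv this.ne']
    simp
  have := ENNReal.toReal_mono (ENNReal.mul_ne_top hCt hJt) hL
  rw [toReal_enorm, ENNReal.toReal_mul] at this
  have h2 := (le_abs_self _).trans this
  have h3 : 0 ≤ J.toReal := ENNReal.toReal_nonneg
  linarith
end
end

section
/- Fix ρ ∈ (0,1). There exists a constant C > 0, depending only on ρ, such that for every bounded open set E ⊂ ℝ² of diameter h_E that is shape-regular with parameter ρ, and every v : ℝ² → ℝ of class C¹ on an open neighborhood of the closure of E, the following Poincaré–Friedrichs inequality holds: ∫_E v(x)² dx ≤ C · ( h_E² ∫_E ‖∇v(x)‖² dx + ( ∫_{∂E} v dH¹ )² ). -/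
open MeasureTheory Metric Set

noncomputable section

open scoped ENNReal NNReal

/-- Geometric hypotheses, transported to `ℂ` with the centre of the ball at the origin. -/
structure PFGeo (E : Set ℂ) (δ h : ℝ) : Prop where
  op : IsOpen E
  pos : 0 < δ
  le : δ ≤ h
  bdd : E ⊆ closedBall 0 h
  ball : closedBall 0 δ ⊆ E
  star : ∀ x ∈ E, ∀ y ∈ closedBall (0 : ℂ) δ, segment ℝ x y ⊆ E

namespace PFGeo

variable {E : Set ℂ} {δ h : ℝ}

lemma cone (g : PFGeo E δ h) {p y : ℂ} {s : ℝ} (hp : p ∈ closure E) (hs : 0 < s) (hs1 : s ≤ 1)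
    (hy : ‖y‖ < δ) : (1 - s) • p + s • y ∈ E := by
  have hc : Filter.Tendsto (fun q : ℂ => y + ((1 - s) / s) • (p - q)) (nhds p) (nhds y) := by
    have : Continuous (fun q : ℂ => y + ((1 - s) / s) • (p - q)) := by fun_prop
    simpa using this.tendsto p
  have hev : ∀ᶠ q in nhds p, ‖y + ((1 - s) / s) • (p - q)‖ < δ := by
    exact hc.norm.eventually_lt_const hy
  obtain ⟨q, hqE, hq⟩ := ((mem_closure_iff_frequently.1 hp).and_eventually hev).exists
  refine g.star q hqE (y + ((1 - s) / s) • (p - q)) (by rw [mem_closedBall_zero_iff]; exact hq.le)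
    ⟨1 - s, s, by linarith, hs.le, by ring, ?_⟩
  rw [smul_add, smul_smul, mul_div_cancel₀ _ hs.ne', smul_sub]
  abel

lemma frontier_norm_ge (g : PFGeo E δ h) {p : ℂ} (hp : p ∈ frontier E) : δ ≤ ‖p‖ := by
  by_contra! hlt
  have : p ∈ E := g.ball (by simpa using hlt.le)
  rw [g.op.frontier_eq] at hp
  exact hp.2 this

lemma closure_norm_le (g : PFGeo E δ h) {p : ℂ} (hp : p ∈ closure E) : ‖p‖ ≤ h := by
  have := closure_minimal g.bdd isClosed_closedBall hp
  simpa using this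

lemma frontier_notMem (g : PFGeo E δ h) {p : ℂ} (hp : p ∈ frontier E) : p ∉ E := by
  rw [g.op.frontier_eq] at hp
  exact hp.2

lemma frontier_lip_aux (g : PFGeo E δ h) {e e' : ℂ} {r r' : ℝ} (he : ‖e‖ = 1) (he' : ‖e'‖ = 1)
    (hr' : 0 < r') (hrr : r' ≤ r) (hp : r • e ∈ frontier E) (hp' : r' • e' ∈ frontier E) :
    ‖r • e - r' • e'‖ ≤ (h + h ^ 2 / δ) * ‖e - e'‖ := by
  have hd := g.pos
  have hr : 0 < r := by linarith
  have hrh : r ≤ h := by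
    have := g.closure_norm_le (frontier_subset_closure hp)
    rwa [norm_smul, he, mul_one, Real.norm_of_nonneg hr.le] at this
  have key : r - r' ≤ r * r' / δ * ‖e - e'‖ := by
    rcases hrr.eq_or_lt with h0 | hlt
    · rw [h0, sub_self]; positivity
    by_contra! hcon
    set s := 1 - r' / r with hs
    have hs0 : 0 < s := by
      rw [hs, sub_pos, div_lt_one hr]; exact hlt
    have hs1 : s ≤ 1 := by
      have : 0 < r' / r := by positivity
      linarith
    have hy : ‖(r' / s) • (e' - e)‖ < δ := by
      rw [norm_smul, Real.norm_of_nonneg (by positivity), norm_sub_rev]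
      have h1 : s * r = r - r' := by rw [hs]; field_simp
      have h2 : r * r' * ‖e - e'‖ < (r - r') * δ := by
        have := mul_lt_mul_of_pos_right hcon hd
        calc _ = r * r' / δ * ‖e - e'‖ * δ := by field_simp
          _ < _ := this
      rw [div_mul_eq_mul_div, div_lt_iff₀ hs0]
      rw [← h1] at h2
      nlinarith
    have hm := g.cone (frontier_subset_closure hp) hs0 hs1 hy
    have : (1 - s) • (r • e) + s • ((r' / s) • (e' - e)) = r' • e' := by
      rw [smul_smul, smul_smul, mul_div_cancel₀ _ hs0.ne', hs]
      rw [show (1 - (1 - r' / r)) * r = r' by field_simp; ring, smul_sub]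
      abel
    rw [this] at hm
    exact g.frontier_notMem hp' hm
  calc ‖r • e - r' • e'‖ = ‖(r - r') • e + r' • (e - e')‖ := by
        congr 1; rw [sub_smul, smul_sub]; abel
    _ ≤ (r - r') + r' * ‖e - e'‖ := by
        refine (norm_add_le _ _).trans ?_
        rw [norm_smul, norm_smul, he, Real.norm_of_nonneg hr'.le,
          Real.norm_of_nonneg (sub_nonneg.2 hrr), mul_one]
    _ ≤ r * r' / δ * ‖e - e'‖ + r' * ‖e - e'‖ := by linarith
    _ ≤ h ^ 2 / δ * ‖e - e'‖ + h * ‖e - e'‖ := by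
        have : r * r' ≤ h ^ 2 := by nlinarith
        gcongr
        linarith
    _ = _ := by ring

lemma frontier_lip (g : PFGeo E δ h) {e e' : ℂ} {r r' : ℝ} (he : ‖e‖ = 1) (he' : ‖e'‖ = 1)
    (hr : 0 < r) (hr' : 0 < r') (hp : r • e ∈ frontier E) (hp' : r' • e' ∈ frontier E) :
    ‖r • e - r' • e'‖ ≤ (h + h ^ 2 / δ) * ‖e - e'‖ := by
  rcases le_total r' r with hrr | hrr
  · exact g.frontier_lip_aux he he' hr' hrr hp hp'
  · rw [norm_sub_rev, norm_sub_rev e]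
    exact g.frontier_lip_aux he' he hr hrr hp' hp

lemma exists_frontier (g : PFGeo E δ h) {f : ℝ → ℂ} (hf : Continuous f) (h0 : ∃ t, f t ∈ E)
    (h1 : ∃ t, h < ‖f t‖) : ∃ t, f t ∈ frontier E := by
  have : (frontier (f ⁻¹' E)).Nonempty := by
    rw [nonempty_frontier_iff]
    refine ⟨h0, fun hu => ?_⟩
    obtain ⟨t, ht⟩ := h1
    have : f t ∈ E := by
      have : t ∈ f ⁻¹' E := hu ▸ mem_univ t
      exact this
    have := g.bdd this
    simp at this
    linarith
  obtain ⟨t, ht⟩ := this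
  exact ⟨t, hf.frontier_preimage_subset E ht⟩

lemma exists_radius (g : PFGeo E δ h) (θ : ℝ) :
    ∃ r : ℝ, 0 < r ∧ r • Complex.exp (θ * Complex.I) ∈ frontier E := by
  have hd := g.pos
  obtain ⟨t, ht⟩ := g.exists_frontier (f := fun t : ℝ => |t| • Complex.exp (θ * Complex.I))
    (by fun_prop) ⟨0, g.ball (by simp [hd.le])⟩ ⟨h + 1, by
      simp only [norm_smul, Complex.norm_exp_ofReal_mul_I, Real.norm_eq_abs, abs_abs, mul_one]
      exact lt_of_lt_of_le (by linarith) (le_abs_self _)⟩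
  refine ⟨|t|, ?_, ht⟩
  have := g.frontier_norm_ge ht
  simp only [norm_smul, Complex.norm_exp_ofReal_mul_I, Real.norm_eq_abs, abs_abs, mul_one] at this
  linarith

/-- The radial parametrisation of the boundary. -/
def rad (g : PFGeo E δ h) (θ : ℝ) : ℝ := (g.exists_radius θ).choose

lemma rad_pos (g : PFGeo E δ h) (θ : ℝ) : 0 < g.rad θ := (g.exists_radius θ).choose_spec.1

/-- The boundary curve. -/
def cur (g : PFGeo E δ h) (θ : ℝ) : ℂ := g.rad θ • Complex.exp (θ * Complex.I)

lemma cur_mem (g : PFGeo E δ h) (θ : ℝ) : g.cur θ ∈ frontier E :=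
  (g.exists_radius θ).choose_spec.2

lemma rad_ge (g : PFGeo E δ h) (θ : ℝ) : δ ≤ g.rad θ := by
  have := g.frontier_norm_ge (g.cur_mem θ)
  rwa [cur, norm_smul, Complex.norm_exp_ofReal_mul_I, mul_one,
    Real.norm_of_nonneg (g.rad_pos θ).le] at this

lemma exp_lip (a b : ℝ) :
    ‖Complex.exp (a * Complex.I) - Complex.exp (b * Complex.I)‖ ≤ |a - b| := by
  have h1 : Complex.exp (a * Complex.I) - Complex.exp (b * Complex.I)
      = Complex.exp (b * Complex.I) * (Complex.exp (Complex.I * ((a - b : ℝ) : ℂ)) - 1) := by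
    rw [mul_sub, ← Complex.exp_add, mul_one]
    congr 2; push_cast; ring
  rw [h1, norm_mul, Complex.norm_exp_ofReal_mul_I, one_mul]
  simpa using Real.norm_exp_I_mul_ofReal_sub_one_le (x := a - b)

lemma const_nonneg (g : PFGeo E δ h) : 0 ≤ h + h ^ 2 / δ := by
  have := g.pos
  have := g.le
  have : 0 ≤ h := by linarith
  positivity

lemma cur_lip (g : PFGeo E δ h) : LipschitzWith (h + h ^ 2 / δ).toNNReal g.cur := by
  refine LipschitzWith.of_dist_le_mul fun a b => ?_
  rw [Real.coe_toNNReal _ g.const_nonneg, dist_eq_norm, Real.dist_eq]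
  refine (g.frontier_lip (Complex.norm_exp_ofReal_mul_I a) (Complex.norm_exp_ofReal_mul_I b)
    (g.rad_pos a) (g.rad_pos b) (g.cur_mem a) (g.cur_mem b)).trans ?_
  exact mul_le_mul_of_nonneg_left (exp_lip a b) g.const_nonneg

lemma cur_surj (g : PFGeo E δ h) {p : ℂ} (hp : p ∈ frontier E) : g.cur p.arg = p := by
  have hpos : 0 < ‖p‖ := lt_of_lt_of_le g.pos (g.frontier_norm_ge hp)
  have he : ‖p‖ • Complex.exp (p.arg * Complex.I) = p := by
    rw [Complex.real_smul]; exact Complex.norm_mul_exp_arg_mul_I p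
  have := g.frontier_lip (Complex.norm_exp_ofReal_mul_I p.arg)
    (Complex.norm_exp_ofReal_mul_I p.arg) (g.rad_pos p.arg) hpos (g.cur_mem p.arg)
    (by rw [he]; exact hp)
  rw [he, sub_self, norm_zero, mul_zero] at this
  exact sub_eq_zero.1 (norm_le_zero_iff.1 this)

lemma measure_le (g : PFGeo E δ h) :
    (μH[1] : Measure ℂ).restrict (frontier E) ≤
      ENNReal.ofReal (h + h ^ 2 / δ) •
        Measure.map g.cur ((volume : Measure ℝ).restrict (Ioc (-Real.pi) Real.pi)) := by
  refine Measure.le_intro fun A hA _ => ?_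
  have hm := g.cur_lip.continuous.measurable
  rw [Measure.restrict_apply hA, Measure.smul_apply, Measure.map_apply hm hA,
    Measure.restrict_apply (hm hA), smul_eq_mul]
  have hsub : A ∩ frontier E ⊆ g.cur '' (g.cur ⁻¹' A ∩ Ioc (-Real.pi) Real.pi) := by
    rintro p ⟨hpA, hp⟩
    refine ⟨p.arg, ⟨?_, Complex.arg_mem_Ioc p⟩, g.cur_surj hp⟩
    simpa [g.cur_surj hp] using hpA
  refine (measure_mono hsub).trans ?_
  refine (g.cur_lip.hausdorffMeasure_image_le (d := 1) zero_le_one _).trans ?_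
  rw [hausdorffMeasure_real, ENNReal.rpow_one]
  rfl

lemma lintegral_frontier_le (g : PFGeo E δ h) {f : ℂ → ℝ≥0∞} (hf : Measurable f) :
    ∫⁻ p in frontier E, f p ∂μH[1] ≤
      ENNReal.ofReal (h + h ^ 2 / δ) * ∫⁻ θ in Ioo (-Real.pi) Real.pi, f (g.cur θ) := by
  refine (lintegral_mono' g.measure_le le_rfl).trans ?_
  rw [lintegral_smul_measure, lintegral_map hf g.cur_lip.continuous.measurable,
    restrict_Ioo_eq_restrict_Ioc, smul_eq_mul]

lemma frontier_measure_lt_top (g : PFGeo E δ h) : μH[1] (frontier E) < ∞ := by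
  have := g.lintegral_frontier_le (f := fun _ => 1) measurable_const
  simp only [lintegral_const, one_mul, Measure.restrict_apply MeasurableSet.univ, univ_inter,
    Real.volume_Ioo] at this
  exact this.trans_lt (ENNReal.mul_lt_top ENNReal.ofReal_lt_top ENNReal.ofReal_lt_top)

lemma frontier_measure_ge (g : PFGeo E δ h) : ENNReal.ofReal (2 * δ) ≤ μH[1] (frontier E) := by
  have hsub : Icc (-δ) δ ⊆ Complex.re '' frontier E := by
    intro x hx
    obtain ⟨t, ht⟩ := g.exists_frontier (f := fun t : ℝ => (x : ℂ) + t * Complex.I)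
      (by fun_prop) ⟨0, g.ball (by simpa using abs_le.2 hx)⟩ ⟨h + 1, by
        refine lt_of_lt_of_le ?_ (Complex.abs_im_le_norm _)
        simp
        exact lt_of_lt_of_le (by linarith) (le_abs_self _)⟩
    exact ⟨_, ht, by simp⟩
  have hl : LipschitzWith 1 Complex.re := LipschitzWith.of_dist_le_mul fun a b => by
    rw [Real.dist_eq, dist_eq_norm, ← Complex.sub_re]
    simpa using Complex.abs_re_le_norm (a - b)
  calc ENNReal.ofReal (2 * δ) = (μH[1] : Measure ℝ) (Icc (-δ) δ) := by
        rw [hausdorffMeasure_real, Real.volume_Icc]; congr 1; ring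
    _ ≤ μH[1] (Complex.re '' frontier E) := measure_mono hsub
    _ ≤ _ := by simpa using hl.hausdorffMeasure_image_le (d := 1) zero_le_one (frontier E)

end PFGeo

lemma pf_sq_lintegral_le {α : Type*} [MeasurableSpace α] (μ : Measure α) {f : α → ℝ≥0∞}
    (hf : AEMeasurable f μ) : (∫⁻ x, f x ∂μ) ^ 2 ≤ μ univ * ∫⁻ x, f x ^ 2 ∂μ := by
  have h := ENNReal.lintegral_mul_le_Lp_mul_Lq μ Real.HolderConjugate.two_two
    (f := fun _ => 1) (g := f) aemeasurable_const hf
  simp only [Pi.mul_apply, one_mul, ENNReal.one_rpow, lintegral_const] at h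
  calc (∫⁻ x, f x ∂μ) ^ 2 ≤ ((μ univ) ^ (1 / (2 : ℝ)) * (∫⁻ x, f x ^ (2 : ℝ) ∂μ) ^ (1 / (2 : ℝ))) ^ 2 := by
        gcongr
    _ = _ := by
        rw [mul_pow, ← ENNReal.rpow_natCast, ← ENNReal.rpow_natCast, ← ENNReal.rpow_mul,
          ← ENNReal.rpow_mul]
        norm_num

lemma pf_path {v : ℂ → ℝ} {U : Set ℂ} (hU : IsOpen U) (hv : ContDiffOn ℝ 1 v U) {x d : ℂ}
    {a b : ℝ} (hab : a ≤ b) (hseg : ∀ t ∈ Icc a b, x + t • d ∈ U) :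
    ‖v (x + b • d) - v (x + a • d)‖ₑ ≤ ∫⁻ t in Icc a b, ‖fderiv ℝ v (x + t • d)‖ₑ * ‖d‖ₑ := by
  have hp : ContDiff ℝ 1 (fun t : ℝ => x + t • d) := by fun_prop
  have hc : ContDiffOn ℝ 1 (fun t : ℝ => v (x + t • d)) (Icc a b) :=
    hv.comp hp.contDiffOn hseg
  refine (enorm_sub_le_lintegral_deriv_of_contDiffOn_Icc hc hab).trans ?_
  refine setLIntegral_mono' measurableSet_Icc fun t ht => ?_
  have hvd : HasFDerivAt v (fderiv ℝ v (x + t • d)) (x + t • d) :=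
    ((hv.contDiffAt (hU.mem_nhds (hseg t ht))).differentiableAt (by norm_num)).hasFDerivAt
  have hpd : HasDerivAt (fun t : ℝ => x + t • d) d t := by
    simpa using ((hasDerivAt_id t).smul_const d).const_add x
  have := hvd.comp_hasDerivAt t hpd
  have h2 : deriv (fun t : ℝ => v (x + t • d)) t = fderiv ℝ v (x + t • d) d := this.deriv
  rw [h2]
  exact ContinuousLinearMap.le_opENorm _ _

lemma pf_lintegral_affine {G : ℂ → ℝ≥0∞} (hG : Measurable G) (x : ℂ) {t : ℝ} (ht : 1 / 2 ≤ t) :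
    ∫⁻ y, G (x + t • y) ≤ 4 * ∫⁻ y, G y := by
  have ht0 : 0 < t := by linarith
  have h1 : ∫⁻ y, G (x + t • y) = ENNReal.ofReal |(t ^ 2)⁻¹| * ∫⁻ y, G (x + y) := by
    have := lintegral_map (μ := (volume : Measure ℂ)) (f := fun y => G (x + y)) (g := fun y : ℂ => t • y)
      (by fun_prop) (by fun_prop)
    rw [← this]
    have h3 := Measure.map_addHaar_smul (volume : Measure ℂ) ht0.ne'
    rw [Complex.finrank_real_complex] at h3
    change ∫⁻ a, G (x + a) ∂(Measure.map (t • ·) volume) = _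
    rw [h3, lintegral_smul_measure, smul_eq_mul]
  rw [h1, lintegral_add_left_eq_self (fun y => G y) x]
  gcongr
  rw [abs_of_pos (by positivity)]
  have : (t ^ 2)⁻¹ ≤ 4 := by
    rw [inv_le_comm₀ (by positivity) (by norm_num)]
    nlinarith
  calc _ ≤ ENNReal.ofReal 4 := ENNReal.ofReal_le_ofReal this
    _ = 4 := by simp

namespace PFGeo

variable {E : Set ℂ} {δ h : ℝ}

lemma volume_E_le (g : PFGeo E δ h) :
    volume E ≤ ENNReal.ofReal (h ^ 2 / δ ^ 2) * volume (closedBall (0 : ℂ) δ) := by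
  have hd := g.pos
  have hh : 0 < h := lt_of_lt_of_le hd g.le
  refine (measure_mono g.bdd).trans ?_
  rw [Complex.volume_closedBall, Complex.volume_closedBall, ← mul_assoc,
    ← ENNReal.ofReal_pow hd.le, ← ENNReal.ofReal_pow hh.le,
    ← ENNReal.ofReal_mul (by positivity)]
  gcongr
  rw [div_mul_cancel₀ _ (by positivity)]

lemma seg_bound (g : PFGeo E δ h) {v : ℂ → ℝ} {U : Set ℂ} (hU : IsOpen U) (hEU : closure E ⊆ U)
    (hv : ContDiffOn ℝ 1 v U) {x y : ℂ} (hx : x ∈ E) (hy : y ∈ closedBall (0 : ℂ) δ) :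
    ‖v x - v y‖ₑ ^ 2 ≤ ENNReal.ofReal (4 * h ^ 2) *
      ∫⁻ t in Icc (0 : ℝ) 1, E.indicator (fun p => ‖fderiv ℝ v p‖ₑ ^ 2) ((1 - t) • x + t • y) := by
  have hseg : ∀ t ∈ Icc (0 : ℝ) 1, x + t • (y - x) ∈ E := by
    intro t ht
    refine g.star x hx y hy ⟨1 - t, t, by linarith [ht.2], ht.1, by ring, ?_⟩
    rw [sub_smul, one_smul, smul_sub]; abel
  have h1 := pf_path hU hv zero_le_one (fun t ht => hEU (subset_closure (hseg t ht)))
  simp only [one_smul, zero_smul, add_zero, add_sub_cancel] at h1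
  have hm : Measurable (fun t : ℝ => ‖fderiv ℝ v (x + t • (y - x))‖ₑ) :=
    ((measurable_fderiv ℝ v).comp (by fun_prop : Measurable fun t : ℝ => x + t • (y - x))).enorm
  rw [lintegral_mul_const _ hm] at h1
  have hxn : ‖x‖ ≤ h := by simpa using g.bdd hx
  have hyn : ‖y‖ ≤ h := by simpa using g.bdd (g.ball hy)
  have hh : 0 ≤ h := (norm_nonneg _).trans hxn
  have hd : ‖y - x‖ₑ ≤ ENNReal.ofReal (2 * h) := by
    rw [← ofReal_norm]
    exact ENNReal.ofReal_le_ofReal ((norm_sub_le _ _).trans (by linarith))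
  have h2 := pf_sq_lintegral_le (volume.restrict (Icc (0 : ℝ) 1)) hm.aemeasurable
  simp only [Measure.restrict_apply MeasurableSet.univ, univ_inter, Real.volume_Icc, sub_zero,
    ENNReal.ofReal_one, one_mul] at h2
  calc ‖v x - v y‖ₑ ^ 2 = ‖v y - v x‖ₑ ^ 2 := by
        rw [← edist_eq_enorm_sub, edist_comm, edist_eq_enorm_sub]
    _ ≤ ((∫⁻ t in Icc (0 : ℝ) 1, ‖fderiv ℝ v (x + t • (y - x))‖ₑ) * ENNReal.ofReal (2 * h)) ^ 2 := by
        gcongr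
        exact h1.trans (by gcongr)
    _ = ENNReal.ofReal (4 * h ^ 2) * (∫⁻ t in Icc (0 : ℝ) 1, ‖fderiv ℝ v (x + t • (y - x))‖ₑ) ^ 2 := by
        rw [mul_pow, ← ENNReal.ofReal_pow (by positivity), mul_comm]
        congr 2; ring
    _ ≤ ENNReal.ofReal (4 * h ^ 2) * ∫⁻ t in Icc (0 : ℝ) 1, ‖fderiv ℝ v (x + t • (y - x))‖ₑ ^ 2 := by
        gcongr
    _ = _ := by
        congr 1
        refine setLIntegral_congr_fun measurableSet_Icc fun t ht => ?_
        have : (1 - t) • x + t • y = x + t • (y - x) := by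
          rw [sub_smul, one_smul, smul_sub]; abel
        simp only [this, indicator_of_mem (hseg t ht)]

lemma double_bound (g : PFGeo E δ h) {G : ℂ → ℝ≥0∞} (hG : Measurable G) {t : ℝ} :
    ∫⁻ y in closedBall (0 : ℂ) δ, ∫⁻ x in E, G ((1 - t) • x + t • y) ≤
      4 * volume E * ∫⁻ x, G x := by
  have hBE : volume (closedBall (0 : ℂ) δ) ≤ volume E := measure_mono g.ball
  rcases le_total t (1 / 2) with ht | ht
  · have : ∀ y : ℂ, ∫⁻ x in E, G ((1 - t) • x + t • y) ≤ 4 * ∫⁻ x, G x := fun y => by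
      refine (setLIntegral_le_lintegral _ _).trans ?_
      simp_rw [add_comm _ (t • y)]
      exact pf_lintegral_affine hG _ (by linarith)
    calc _ ≤ ∫⁻ y in closedBall (0 : ℂ) δ, 4 * ∫⁻ x, G x := lintegral_mono this
      _ = 4 * volume (closedBall (0 : ℂ) δ) * ∫⁻ x, G x := by
        rw [setLIntegral_const]; ring
      _ ≤ _ := by gcongr
  · rw [lintegral_lintegral_swap (by fun_prop)]
    have : ∀ x : ℂ, ∫⁻ y in closedBall (0 : ℂ) δ, G ((1 - t) • x + t • y) ≤ 4 * ∫⁻ x, G x :=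
      fun x => (setLIntegral_le_lintegral _ _).trans (pf_lintegral_affine hG _ ht)
    calc _ ≤ ∫⁻ y in E, 4 * ∫⁻ x, G x := lintegral_mono this
      _ = _ := by rw [setLIntegral_const]; ring

lemma poincare (g : PFGeo E δ h) {v : ℂ → ℝ} {U : Set ℂ} (hU : IsOpen U) (hEU : closure E ⊆ U)
    (hv : ContDiffOn ℝ 1 v U) : ∃ c : ℝ, ∫⁻ x in E, ‖v x - c‖ₑ ^ 2 ≤
      ENNReal.ofReal (16 * h ^ 4 / δ ^ 2) * ∫⁻ x in E, ‖fderiv ℝ v x‖ₑ ^ 2 := by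
  have hd := g.pos
  set G : ℂ → ℝ≥0∞ := E.indicator (fun p => ‖fderiv ℝ v p‖ₑ ^ 2) with hGdef
  have hG : Measurable G :=
    ((measurable_fderiv ℝ v).enorm.pow_const 2).indicator g.op.measurableSet
  set B := closedBall (0 : ℂ) δ
  have hB0 : volume B ≠ 0 := by
    rw [Complex.volume_closedBall]
    have := Real.pi_pos
    simp [hd, NNReal.pi_ne_zero]
  have hBt : volume B ≠ ∞ := measure_closedBall_lt_top.ne
  set H : ℂ → ℝ≥0∞ := fun y => ∫⁻ x in E, ∫⁻ t in Icc (0 : ℝ) 1, G ((1 - t) • x + t • y) with hH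
  have hmeas : Measurable H := by
    have : Measurable (fun q : (ℂ × ℂ) × ℝ => G ((1 - q.2) • q.1.2 + q.2 • q.1.1)) := by fun_prop
    exact (this.lintegral_prod_right' (ν := volume.restrict (Icc (0:ℝ) 1))).lintegral_prod_right'
  obtain ⟨y, hyB, hy⟩ := exists_le_setLAverage hB0 hBt hmeas.aemeasurable
  refine ⟨v y, ?_⟩
  have hHint : ∫⁻ y in B, H y ≤ 4 * volume E * ∫⁻ x, G x := by
    have h1 : ∀ y, H y = ∫⁻ t in Icc (0 : ℝ) 1, ∫⁻ x in E, G ((1 - t) • x + t • y) := fun y =>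
      lintegral_lintegral_swap (by fun_prop)
    simp_rw [h1]
    rw [lintegral_lintegral_swap]
    · calc _ ≤ ∫⁻ t in Icc (0 : ℝ) 1, 4 * volume E * ∫⁻ x, G x :=
            lintegral_mono fun t => g.double_bound hG
        _ = _ := by simp
    · have : Measurable (fun q : (ℂ × ℝ) × ℂ => G ((1 - q.1.2) • q.2 + q.1.2 • q.1.1)) := by fun_prop
      exact (this.lintegral_prod_right' (ν := volume.restrict E)).aemeasurable
  have hGi : ∫⁻ x, G x = ∫⁻ x in E, ‖fderiv ℝ v x‖ₑ ^ 2 := lintegral_indicator g.op.measurableSet _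
  have hHy : H y ≤ 4 * ENNReal.ofReal (h ^ 2 / δ ^ 2) * ∫⁻ x, G x := by
    refine hy.trans ?_
    rw [setLAverage_eq]
    refine ENNReal.div_le_of_le_mul (hHint.trans ?_)
    calc 4 * volume E * ∫⁻ x, G x
        ≤ 4 * (ENNReal.ofReal (h ^ 2 / δ ^ 2) * volume B) * ∫⁻ x, G x := by
          gcongr; exact g.volume_E_le
      _ = _ := by ring
  calc ∫⁻ x in E, ‖v x - v y‖ₑ ^ 2
      ≤ ∫⁻ x in E, ENNReal.ofReal (4 * h ^ 2) * ∫⁻ t in Icc (0 : ℝ) 1, G ((1 - t) • x + t • y) :=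
        setLIntegral_mono' g.op.measurableSet fun x hx => g.seg_bound hU hEU hv hx hyB
    _ = ENNReal.ofReal (4 * h ^ 2) * H y := by
        rw [lintegral_const_mul' _ _ ENNReal.ofReal_ne_top]
    _ ≤ ENNReal.ofReal (4 * h ^ 2) * (4 * ENNReal.ofReal (h ^ 2 / δ ^ 2) * ∫⁻ x, G x) := by gcongr
    _ = _ := by
        rw [hGi, ← mul_assoc, ← mul_assoc]
        congr 1
        rw [show (4 : ℝ≥0∞) = ENNReal.ofReal 4 by simp, ← ENNReal.ofReal_mul (by positivity),
          ← ENNReal.ofReal_mul (by positivity)]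
        congr 1; ring

end PFGeo

lemma pf_add_sq_le (a b : ℝ≥0∞) : (a + b) ^ 2 ≤ 4 * (a ^ 2 + b ^ 2) := by
  rcases le_total a b with hab | hab
  · calc (a + b) ^ 2 ≤ (b + b) ^ 2 := by gcongr
      _ = 4 * (0 + b ^ 2) := by ring
      _ ≤ _ := by gcongr; exact zero_le
  · calc (a + b) ^ 2 ≤ (a + a) ^ 2 := by gcongr
      _ = 4 * (a ^ 2 + 0) := by ring
      _ ≤ _ := by gcongr; exact zero_le

lemma pf_polar {F : ℂ → ℝ≥0∞} (hF : Measurable F) :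
    ∫⁻ θ in Ioo (-Real.pi) Real.pi, ∫⁻ r in Ioi (0 : ℝ),
      ENNReal.ofReal r * F (r • Complex.exp (θ * Complex.I)) = ∫⁻ p, F p := by
  rw [← Complex.lintegral_comp_polarCoord_symm F]
  have hm : Measurable (fun p : ℝ × ℝ =>
      ENNReal.ofReal p.1 * F (p.1 • Complex.exp (p.2 * Complex.I))) := by fun_prop
  have : ∀ p : ℝ × ℝ, ENNReal.ofReal p.1 • F (Complex.polarCoord.symm p) =
      ENNReal.ofReal p.1 * F (p.1 • Complex.exp (p.2 * Complex.I)) := by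
    intro p
    rw [Complex.polarCoord_symm_apply, Complex.real_smul, Complex.exp_mul_I, smul_eq_mul,
      Complex.ofReal_cos, Complex.ofReal_sin]
  simp_rw [this]
  rw [polarCoord_target, Measure.volume_eq_prod, ← Measure.prod_restrict,
    lintegral_prod_symm _ hm.aemeasurable]

lemma pf_measurable_indicator {s : Set ℂ} (hs : MeasurableSet s) {f : ℂ → ℝ}
    (hf : ContinuousOn f s) : Measurable (s.indicator f) := by
  classical
  rw [← piecewise_eq_indicator]
  exact hf.measurable_piecewise continuousOn_const hs

namespace PFGeo

variable {E : Set ℂ} {δ h : ℝ}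

lemma ray_mem (g : PFGeo E δ h) (θ : ℝ) {s : ℝ} (hs : 0 ≤ s) (hsR : s < g.rad θ) :
    s • Complex.exp (θ * Complex.I) ∈ E := by
  have hR := g.rad_pos θ
  have := g.cone (frontier_subset_closure (g.cur_mem θ)) (s := 1 - s / g.rad θ) (y := 0)
    (by rw [sub_pos, div_lt_one hR]; exact hsR)
    (by have : 0 ≤ s / g.rad θ := by positivity
        linarith) (by simpa using g.pos)
  rw [cur, smul_zero, add_zero, smul_smul] at this
  rwa [show (1 - (1 - s / g.rad θ)) * g.rad θ = s by field_simp; ring] at this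

lemma ray_bound (g : PFGeo E δ h) {v : ℂ → ℝ} {U : Set ℂ} (hU : IsOpen U) (hEU : closure E ⊆ U)
    (hv : ContDiffOn ℝ 1 v U) (c θ : ℝ) :
    ENNReal.ofReal (δ / 2) * ‖v (g.cur θ) - c‖ₑ ≤ ENNReal.ofReal (2 / δ) *
      ∫⁻ r in Ioi (0 : ℝ), ENNReal.ofReal r * E.indicator
        (fun p => ‖v p - c‖ₑ + ENNReal.ofReal δ * ‖fderiv ℝ v p‖ₑ)
          (r • Complex.exp (θ * Complex.I)) := by
  have hd := g.pos
  set e := Complex.exp (θ * Complex.I) with he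
  set R := g.rad θ with hR
  have hRδ : δ ≤ R := g.rad_ge θ
  have hne : ‖e‖ₑ = 1 := by
    rw [← ofReal_norm, he, Complex.norm_exp_ofReal_mul_I]; simp
  have hcl : ∀ s ∈ Icc 0 R, s • e ∈ U := by
    intro s hs
    rcases hs.2.eq_or_lt with h1 | h1
    · rw [h1]; exact hEU (frontier_subset_closure (g.cur_mem θ))
    · exact hEU (subset_closure (g.ray_mem θ hs.1 h1))
  have hDm : Measurable (fun s : ℝ => ‖fderiv ℝ v (s • e)‖ₑ) :=
    ((measurable_fderiv ℝ v).comp (by fun_prop : Measurable fun t : ℝ => t • e)).enorm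
  set D := ∫⁻ s in Ioo (δ / 2) R, ‖fderiv ℝ v (s • e)‖ₑ with hD
  have step : ∀ r ∈ Ioo (δ / 2) δ, ‖v (g.cur θ) - c‖ₑ ≤ ‖v (r • e) - c‖ₑ + D := by
    intro r hr
    have h1 := pf_path hU hv (x := 0) (d := e) (a := r) (b := R) (by linarith [hr.2])
      (fun t ht => by rw [zero_add]; exact hcl t ⟨by linarith [ht.1, hr.1], ht.2⟩)
    simp only [zero_add, hne, mul_one] at h1
    rw [← restrict_Ioo_eq_restrict_Icc] at h1
    have h2 : ∫⁻ t in Ioo r R, ‖fderiv ℝ v (t • e)‖ₑ ≤ D :=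
      lintegral_mono_set (Ioo_subset_Ioo_left hr.1.le)
    calc ‖v (g.cur θ) - c‖ₑ = ‖(v (r • e) - c) + (v (R • e) - v (r • e))‖ₑ := by
          congr 1; rw [cur]; ring
      _ ≤ _ := (enorm_add_le _ _).trans (by gcongr; exact h1.trans h2)
  calc ENNReal.ofReal (δ / 2) * ‖v (g.cur θ) - c‖ₑ
      = ∫⁻ r in Ioo (δ / 2) δ, ‖v (g.cur θ) - c‖ₑ := by
        rw [setLIntegral_const, Real.volume_Ioo, mul_comm]; congr 2; ring
    _ ≤ ∫⁻ r in Ioo (δ / 2) δ, (‖v (r • e) - c‖ₑ + D) := setLIntegral_mono' measurableSet_Ioo step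
    _ = (∫⁻ r in Ioo (δ / 2) δ, ‖v (r • e) - c‖ₑ) + ENNReal.ofReal (δ / 2) * D := by
        rw [lintegral_add_right _ measurable_const, setLIntegral_const, Real.volume_Ioo,
          mul_comm D]
        congr 3; ring
    _ ≤ (∫⁻ r in Ioo (δ / 2) R, ‖v (r • e) - c‖ₑ) + ENNReal.ofReal δ * D := by
        gcongr
        linarith
    _ = ∫⁻ r in Ioo (δ / 2) R, (‖v (r • e) - c‖ₑ + ENNReal.ofReal δ * ‖fderiv ℝ v (r • e)‖ₑ) := by
        rw [lintegral_add_right _ (hDm.const_mul _), lintegral_const_mul _ hDm]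
    _ ≤ ∫⁻ r in Ioo (δ / 2) R, ENNReal.ofReal (2 / δ) * (ENNReal.ofReal r * E.indicator
        (fun p => ‖v p - c‖ₑ + ENNReal.ofReal δ * ‖fderiv ℝ v p‖ₑ) (r • e)) := by
        refine setLIntegral_mono' measurableSet_Ioo fun r hr => ?_
        rw [indicator_of_mem (g.ray_mem θ (by linarith [hr.1]) hr.2), ← mul_assoc,
          ← ENNReal.ofReal_mul (by positivity)]
        refine le_mul_of_one_le_left zero_le ?_
        rw [ENNReal.one_le_ofReal, div_mul_eq_mul_div, one_le_div hd]
        linarith [hr.1]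
    _ ≤ ∫⁻ r in Ioi (0 : ℝ), ENNReal.ofReal (2 / δ) * (ENNReal.ofReal r * E.indicator
        (fun p => ‖v p - c‖ₑ + ENNReal.ofReal δ * ‖fderiv ℝ v p‖ₑ) (r • e)) :=
        lintegral_mono_set fun r hr => (by linarith [hr.1] : (0:ℝ) < r)
    _ = _ := lintegral_const_mul' _ _ ENNReal.ofReal_ne_top

lemma trace (g : PFGeo E δ h) {v : ℂ → ℝ} {U : Set ℂ} (hU : IsOpen U) (hEU : closure E ⊆ U)
    (hv : ContDiffOn ℝ 1 v U) (c : ℝ) :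
    ∫⁻ p in frontier E, ‖v p - c‖ₑ ∂μH[1] ≤ ENNReal.ofReal ((h + h ^ 2 / δ) * (4 / δ ^ 2)) *
      ∫⁻ p in E, (‖v p - c‖ₑ + ENNReal.ofReal δ * ‖fderiv ℝ v p‖ₑ) := by
  have hd := g.pos
  have hcont : ContinuousOn (fun p => v p - c) (closure E) :=
    (hv.continuousOn.mono hEU).sub continuousOn_const
  have hW : Measurable (fun p => ‖(closure E).indicator (fun p => v p - c) p‖ₑ) :=
    (pf_measurable_indicator isClosed_closure.measurableSet hcont).enorm
  have hF : Measurable (E.indicator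
        (fun p => ‖v p - c‖ₑ + ENNReal.ofReal δ * ‖fderiv ℝ v p‖ₑ)) := by
    have h1 : E.indicator (fun p => ‖v p - c‖ₑ + ENNReal.ofReal δ * ‖fderiv ℝ v p‖ₑ) =
      fun p => ‖E.indicator (fun p => v p - c) p‖ₑ +
        E.indicator (fun p => ENNReal.ofReal δ * ‖fderiv ℝ v p‖ₑ) p := by
      funext p
      by_cases hp : p ∈ E <;> simp [hp]
    rw [h1]
    exact (pf_measurable_indicator g.op.measurableSet (hcont.mono subset_closure)).enorm.add
      (((measurable_fderiv ℝ v).enorm.const_mul _).indicator g.op.measurableSet)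
  have h1 : ∫⁻ p in frontier E, ‖v p - c‖ₑ ∂μH[1] =
      ∫⁻ p in frontier E, ‖(closure E).indicator (fun p => v p - c) p‖ₑ ∂μH[1] := by
    refine setLIntegral_congr_fun isClosed_frontier.measurableSet fun p hp => ?_
    simp only [indicator_of_mem (frontier_subset_closure hp)]
  have h2 : ∀ θ, ‖(closure E).indicator (fun p => v p - c) (g.cur θ)‖ₑ = ‖v (g.cur θ) - c‖ₑ :=
    fun θ => by rw [indicator_of_mem (frontier_subset_closure (g.cur_mem θ))]
  have h3 : ENNReal.ofReal (δ / 2) * ∫⁻ θ in Ioo (-Real.pi) Real.pi, ‖v (g.cur θ) - c‖ₑ ≤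
      ENNReal.ofReal (2 / δ) *
        ∫⁻ p in E, (‖v p - c‖ₑ + ENNReal.ofReal δ * ‖fderiv ℝ v p‖ₑ) := by
    rw [← lintegral_const_mul' _ _ ENNReal.ofReal_ne_top,
      ← lintegral_indicator g.op.measurableSet, ← pf_polar hF,
      ← lintegral_const_mul' _ _ ENNReal.ofReal_ne_top]
    exact lintegral_mono fun θ => g.ray_bound hU hEU hv c θ
  rw [h1]
  refine (g.lintegral_frontier_le hW).trans ?_
  simp_rw [h2]
  rw [ENNReal.ofReal_mul g.const_nonneg, mul_assoc]
  gcongr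
  calc ∫⁻ θ in Ioo (-Real.pi) Real.pi, ‖v (g.cur θ) - c‖ₑ
      = ENNReal.ofReal (2 / δ) * (ENNReal.ofReal (δ / 2) *
          ∫⁻ θ in Ioo (-Real.pi) Real.pi, ‖v (g.cur θ) - c‖ₑ) := by
        rw [← mul_assoc, ← ENNReal.ofReal_mul (by positivity),
          show 2 / δ * (δ / 2) = 1 by field_simp, ENNReal.ofReal_one, one_mul]
    _ ≤ ENNReal.ofReal (2 / δ) * (ENNReal.ofReal (2 / δ) *
        ∫⁻ p in E, (‖v p - c‖ₑ + ENNReal.ofReal δ * ‖fderiv ℝ v p‖ₑ)) := by gcongr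
    _ = _ := by
        rw [← mul_assoc, ← ENNReal.ofReal_mul (by positivity)]
        congr 2; ring

lemma volume_le (g : PFGeo E δ h) : volume E ≤ ENNReal.ofReal (4 * h ^ 2) := by
  have hh : 0 ≤ h := g.pos.le.trans g.le
  refine (measure_mono g.bdd).trans ?_
  rw [Complex.volume_closedBall, ← ENNReal.ofReal_pow hh]
  rw [show (NNReal.pi : ℝ≥0∞) = ENNReal.ofReal Real.pi by
    rw [← NNReal.coe_real_pi, ENNReal.ofReal_coe_nnreal], ← ENNReal.ofReal_mul (by positivity)]
  refine ENNReal.ofReal_le_ofReal ?_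
  nlinarith [Real.pi_le_four, sq_nonneg h]

lemma trace_sq {ρ : ℝ} (hρ : 0 < ρ) (g : PFGeo E (ρ * h) h) {v : ℂ → ℝ} {U : Set ℂ}
    (hU : IsOpen U) (hEU : closure E ⊆ U) (hv : ContDiffOn ℝ 1 v U) {c : ℝ}
    (hc : ∫⁻ x in E, ‖v x - c‖ₑ ^ 2 ≤
      ENNReal.ofReal (16 * h ^ 4 / (ρ * h) ^ 2) * ∫⁻ x in E, ‖fderiv ℝ v x‖ₑ ^ 2) :
    (∫⁻ p in frontier E, ‖v p - c‖ₑ ∂μH[1]) ^ 2 ≤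
      ENNReal.ofReal (256 * (1 + 1 / ρ) ^ 2 / ρ ^ 4 * (16 / ρ ^ 2 + ρ ^ 2) * h ^ 2) *
        ∫⁻ x in E, ‖fderiv ℝ v x‖ₑ ^ 2 := by
  have hh : 0 < h := lt_of_lt_of_le g.pos g.le
  set A := ∫⁻ x in E, ‖fderiv ℝ v x‖ₑ ^ 2
  have hDm : Measurable (fun p : ℂ => ‖fderiv ℝ v p‖ₑ) := (measurable_fderiv ℝ v).enorm
  have hum : AEMeasurable (fun p => ‖v p - c‖ₑ) (volume.restrict E) :=
    (((hv.continuousOn.mono (subset_closure.trans hEU)).sub continuousOn_const).aemeasurable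
      g.op.measurableSet).enorm
  have h1 := pf_sq_lintegral_le (volume.restrict E)
    (hum.add (hDm.const_mul (ENNReal.ofReal (ρ * h))).aemeasurable)
  simp only [Measure.restrict_apply MeasurableSet.univ, univ_inter, Pi.add_apply] at h1
  have h2 : ∫⁻ p in E, (‖v p - c‖ₑ + ENNReal.ofReal (ρ * h) * ‖fderiv ℝ v p‖ₑ) ^ 2 ≤
      ENNReal.ofReal (4 * (16 * h ^ 4 / (ρ * h) ^ 2 + (ρ * h) ^ 2)) * A := by
    calc _ ≤ ∫⁻ p in E, 4 * (‖v p - c‖ₑ ^ 2 + ENNReal.ofReal ((ρ * h) ^ 2) * ‖fderiv ℝ v p‖ₑ ^ 2) :=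
          lintegral_mono fun p => by
            refine (pf_add_sq_le _ _).trans ?_
            rw [mul_pow, ENNReal.ofReal_pow (by positivity)]
      _ = 4 * ((∫⁻ p in E, ‖v p - c‖ₑ ^ 2) + ENNReal.ofReal ((ρ * h) ^ 2) * A) := by
          rw [lintegral_const_mul' _ _ (by simp), lintegral_add_right _ (by fun_prop),
            lintegral_const_mul' _ _ (by simp)]
      _ ≤ 4 * (ENNReal.ofReal (16 * h ^ 4 / (ρ * h) ^ 2) * A + ENNReal.ofReal ((ρ * h) ^ 2) * A) := by
          gcongr
      _ = _ := by
          rw [← add_mul, ← ENNReal.ofReal_add (by positivity) (by positivity), ← mul_assoc,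
            show (4 : ℝ≥0∞) = ENNReal.ofReal 4 by simp, ← ENNReal.ofReal_mul (by positivity)]
  calc (∫⁻ p in frontier E, ‖v p - c‖ₑ ∂μH[1]) ^ 2
      ≤ (ENNReal.ofReal ((h + h ^ 2 / (ρ * h)) * (4 / (ρ * h) ^ 2)) *
        ∫⁻ p in E, (‖v p - c‖ₑ + ENNReal.ofReal (ρ * h) * ‖fderiv ℝ v p‖ₑ)) ^ 2 := by
        gcongr; exact g.trace hU hEU hv c
    _ ≤ ENNReal.ofReal (((h + h ^ 2 / (ρ * h)) * (4 / (ρ * h) ^ 2)) ^ 2) *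
        (ENNReal.ofReal (4 * h ^ 2) *
          (ENNReal.ofReal (4 * (16 * h ^ 4 / (ρ * h) ^ 2 + (ρ * h) ^ 2)) * A)) := by
        rw [mul_pow, ENNReal.ofReal_pow (by positivity)]
        gcongr
        refine h1.trans ?_
        gcongr
        exact g.volume_le
    _ = _ := by
        rw [← mul_assoc, ← mul_assoc, ← ENNReal.ofReal_mul (by positivity),
          ← ENNReal.ofReal_mul (by positivity)]
        congr 2
        field_simp
        ring

lemma core {ρ : ℝ} (hρ : 0 < ρ) (g : PFGeo E (ρ * h) h) {v : ℂ → ℝ} {U : Set ℂ}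
    (hU : IsOpen U) (hEU : closure E ⊆ U) (hv : ContDiffOn ℝ 1 v U) :
    ∫ x in E, v x ^ 2 ≤ (36 / ρ ^ 2 +
        4 / ρ ^ 2 * (256 * (1 + 1 / ρ) ^ 2 / ρ ^ 4 * (16 / ρ ^ 2 + ρ ^ 2))) *
      (h ^ 2 * (∫ x in E, ‖fderiv ℝ v x‖ ^ 2) + (∫ x in frontier E, v x ∂μH[1]) ^ 2) := by
  have hh : 0 < h := lt_of_lt_of_le g.pos g.le
  obtain ⟨c, hc⟩ := g.poincare hU hEU hv
  have hT := g.trace_sq hρ hU hEU hv hc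
  set M := 256 * (1 + 1 / ρ) ^ 2 / ρ ^ 4 * (16 / ρ ^ 2 + ρ ^ 2) with hM
  have hM0 : 0 ≤ M := by positivity
  have hK : IsCompact (closure E) :=
    ((isBounded_closedBall).subset g.bdd).isCompact_closure
  have hvc : ContinuousOn v (closure E) := hv.continuousOn.mono hEU
  have hDc : ContinuousOn (fun x => fderiv ℝ v x) (closure E) :=
    (hv.continuousOn_fderiv_of_isOpen hU le_rfl).mono hEU
  have hi : ∀ f : ℂ → ℝ, ContinuousOn f (closure E) → IntegrableOn f E := fun f hf =>
    (hf.integrableOn_compact hK).mono_set subset_closure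
  have hfin : μH[1] (frontier E) < ∞ := g.frontier_measure_lt_top
  have hib : ∀ f : ℂ → ℝ, ContinuousOn f (closure E) → IntegrableOn f (frontier E) μH[1] := by
    intro f hf
    obtain ⟨B, hB⟩ := hK.exists_bound_of_continuousOn hf
    refine IntegrableOn.of_bound hfin
      ((hf.mono frontier_subset_closure).aestronglyMeasurable isClosed_frontier.measurableSet) B ?_
    exact ae_restrict_of_forall_mem isClosed_frontier.measurableSet
      fun x hx => hB x (frontier_subset_closure hx)
  -- real quantities
  have hDi : IntegrableOn (fun x => ‖fderiv ℝ v x‖ ^ 2) E := hi _ (hDc.norm.pow 2)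
  have eA : ∫⁻ x in E, ‖fderiv ℝ v x‖ₑ ^ 2 = ENNReal.ofReal (∫ x in E, ‖fderiv ℝ v x‖ ^ 2) := by
    rw [ofReal_integral_eq_lintegral_ofReal hDi
      (Filter.Eventually.of_forall fun x => by positivity)]
    refine lintegral_congr fun x => ?_
    rw [ENNReal.ofReal_pow (norm_nonneg _), ofReal_norm]
  have huc : ContinuousOn (fun x => v x - c) (closure E) := hvc.sub continuousOn_const
  have hui : IntegrableOn (fun x => (v x - c) ^ 2) E := hi _ (huc.pow 2)
  have eP : ∫⁻ x in E, ‖v x - c‖ₑ ^ 2 = ENNReal.ofReal (∫ x in E, (v x - c) ^ 2) := by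
    rw [ofReal_integral_eq_lintegral_ofReal hui
      (Filter.Eventually.of_forall fun x => by positivity)]
    refine lintegral_congr fun x => ?_
    rw [← sq_abs, ENNReal.ofReal_pow (abs_nonneg _), ← Real.norm_eq_abs, ofReal_norm]
  have eT : ∫⁻ x in frontier E, ‖v x - c‖ₑ ∂μH[1] =
      ENNReal.ofReal (∫ x in frontier E, ‖v x - c‖ ∂μH[1]) :=
    (ofReal_integral_norm_eq_lintegral_enorm (hib _ huc)).symm
  set A := ∫ x in E, ‖fderiv ℝ v x‖ ^ 2 with hA
  have hA0 : 0 ≤ A := integral_nonneg fun x => by positivity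
  rw [eA, eP, ← ENNReal.ofReal_mul (by positivity),
    ENNReal.ofReal_le_ofReal_iff (by positivity)] at hc
  set T := ∫ x in frontier E, ‖v x - c‖ ∂μH[1] with hTdef
  have hT0 : 0 ≤ T := integral_nonneg fun x => by positivity
  rw [eA, eT, ← ENNReal.ofReal_pow hT0, ← ENNReal.ofReal_mul (by positivity),
    ENNReal.ofReal_le_ofReal_iff (by positivity)] at hT
  set J := ∫ x in frontier E, v x ∂μH[1] with hJ
  set L := (μH[1] : Measure ℂ).real (frontier E) with hL
  have hL2 : 2 * (ρ * h) ≤ L := by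
    rw [hL, Measure.real, ← ENNReal.ofReal_le_iff_le_toReal hfin.ne]
    exact g.frontier_measure_ge
  have hVol : volume.real E ≤ 4 * h ^ 2 :=
    ENNReal.toReal_le_of_le_ofReal (by positivity) g.volume_le
  have hJc : |J - c * L| ≤ T := by
    have : ∫ x in frontier E, (v x - c) ∂μH[1] = J - c * L := by
      rw [integral_sub (hib v hvc) (hib _ continuousOn_const), setIntegral_const, smul_eq_mul,
        mul_comm]
    rw [← this]
    rw [← Real.norm_eq_abs]
    exact norm_integral_le_integral_norm _
  have hc2 : c ^ 2 * (4 * (ρ * h) ^ 2) ≤ 2 * J ^ 2 + 2 * T ^ 2 := by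
    have h1 : (J - c * L) ^ 2 ≤ T ^ 2 := sq_le_sq' (abs_le.1 hJc).1 (abs_le.1 hJc).2
    have h2 : 4 * (ρ * h) ^ 2 ≤ L ^ 2 := by
      have : 0 < ρ * h := g.pos
      nlinarith
    have h3 : c ^ 2 * (4 * (ρ * h) ^ 2) ≤ c ^ 2 * L ^ 2 := by gcongr
    nlinarith [sq_nonneg (J + (J - c * L))]
  have hcv : c ^ 2 * volume.real E ≤ 2 / ρ ^ 2 * (J ^ 2 + T ^ 2) := by
    calc c ^ 2 * volume.real E ≤ c ^ 2 * (4 * h ^ 2) := by gcongr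
      _ = c ^ 2 * (4 * (ρ * h) ^ 2) / ρ ^ 2 := by field_simp
      _ ≤ (2 * J ^ 2 + 2 * T ^ 2) / ρ ^ 2 := by gcongr
      _ = _ := by ring
  have hmain : ∫ x in E, v x ^ 2 ≤ 2 * (∫ x in E, (v x - c) ^ 2) + 2 * (c ^ 2 * volume.real E) := by
    have : ∫ x in E, (2 * (v x - c) ^ 2 + 2 * c ^ 2) =
        2 * (∫ x in E, (v x - c) ^ 2) + 2 * (c ^ 2 * volume.real E) := by
      rw [integral_add (hui.const_mul 2) (hi _ continuousOn_const),
        integral_const_mul, setIntegral_const, smul_eq_mul]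
      ring
    rw [← this]
    refine integral_mono (hi _ (hvc.pow 2))
      ((hui.const_mul 2).add (hi _ continuousOn_const)) fun x => ?_
    change v x ^ 2 ≤ 2 * (v x - c) ^ 2 + 2 * c ^ 2
    nlinarith [sq_nonneg (v x - 2 * c)]
  have hc' : 16 * h ^ 4 / (ρ * h) ^ 2 * A = 16 / ρ ^ 2 * (h ^ 2 * A) := by
    field_simp
  rw [hc'] at hc
  have hhA : 0 ≤ h ^ 2 * A := by positivity
  calc ∫ x in E, v x ^ 2 ≤ 2 * (16 / ρ ^ 2 * (h ^ 2 * A)) + 2 * (2 / ρ ^ 2 * (J ^ 2 + M * h ^ 2 * A)) := by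
        have : 2 / ρ ^ 2 * (J ^ 2 + T ^ 2) ≤ 2 / ρ ^ 2 * (J ^ 2 + M * h ^ 2 * A) := by gcongr
        linarith
    _ = (32 / ρ ^ 2 + 4 / ρ ^ 2 * M) * (h ^ 2 * A) + 4 / ρ ^ 2 * J ^ 2 := by ring
    _ ≤ (36 / ρ ^ 2 + 4 / ρ ^ 2 * M) * (h ^ 2 * A) + (36 / ρ ^ 2 + 4 / ρ ^ 2 * M) * J ^ 2 := by
        gcongr
        · norm_num
        · have h1 : 4 / ρ ^ 2 ≤ 36 / ρ ^ 2 := by gcongr; norm_num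
          have h2 : 0 ≤ 4 / ρ ^ 2 * M := by positivity
          linarith
    _ = _ := by ring

end PFGeo

/-- First-order Poincaré–Friedrichs inequality (3.5):
`‖v‖²_{0,E} ≤ C (h_E² |v|²_{1,E} + (∫_{∂E} v dH¹)²)` on shape-regular elements. -/
theorem poincare_friedrichs_first_order (ρ : ℝ) (hρ : ρ ∈ Set.Ioo (0 : ℝ) 1) :
    ∃ C > (0 : ℝ), ∀ E : Set (EuclideanSpace ℝ (Fin 2)),
      IsOpen E → Bornology.IsBounded E → ShapeRegular ρ E →
      ∀ v : EuclideanSpace ℝ (Fin 2) → ℝ,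
      ∀ U : Set (EuclideanSpace ℝ (Fin 2)), IsOpen U → closure E ⊆ U →
        ContDiffOn ℝ 1 v U →
        (∫ x in E, v x ^ 2) ≤
          C * (Metric.diam E ^ 2 * (∫ x in E, ‖gradient v x‖ ^ 2) +
               (∫ x in frontier E, v x ∂μH[1]) ^ 2) := by
  have hρ0 : 0 < ρ := hρ.1
  refine ⟨36 / ρ ^ 2 + 4 / ρ ^ 2 * (256 * (1 + 1 / ρ) ^ 2 / ρ ^ 4 * (16 / ρ ^ 2 + ρ ^ 2)),
    by positivity, ?_⟩
  rintro E hE hb ⟨z, hball, hstar⟩ v U hU hEU hv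
  set h := Metric.diam E with hh
  have hh0 : 0 ≤ h := Metric.diam_nonneg
  have hzE : z ∈ E := hball (mem_closedBall_self (by positivity))
  let ι : ℂ ≃ₗᵢ[ℝ] EuclideanSpace ℝ (Fin 2) := Complex.orthonormalBasisOneI.repr
  let Φ : ℂ ≃ᵢ EuclideanSpace ℝ (Fin 2) := ι.toIsometryEquiv.trans (IsometryEquiv.addRight z)
  have hΦ : ∀ w, Φ w = ι w + z := fun w => rfl
  have hdist : ∀ w, dist (Φ w) z = ‖w‖ := fun w => by rw [hΦ, dist_eq_norm]; simp
  have hpos : 0 < h := by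
    obtain ⟨ε, hε, hεE⟩ := Metric.isOpen_iff.1 hE z hzE
    have hm : Φ ((ε / 2 : ℝ) : ℂ) ∈ E := hεE (by
      rw [mem_ball, hdist, Complex.norm_real, Real.norm_of_nonneg (by positivity)]; linarith)
    have := Metric.dist_le_diam_of_mem hb hm hzE
    rw [hdist, Complex.norm_real, Real.norm_of_nonneg (by positivity)] at this
    linarith
  have hmem : ∀ w ∈ closedBall (0 : ℂ) (ρ * h), Φ w ∈ closedBall z (ρ * h) := fun w hw => by
    rw [mem_closedBall, hdist]; simpa using hw
  have g : PFGeo (Φ ⁻¹' E) (ρ * h) h :=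
    { op := hE.preimage Φ.continuous
      pos := by positivity
      le := by nlinarith [hρ.2]
      bdd := fun w hw => by
        rw [mem_closedBall_zero_iff, ← hdist]
        exact Metric.dist_le_diam_of_mem hb hw hzE
      ball := fun w hw => hball (hmem w hw)
      star := by
        rintro x hx y hy w ⟨a, b, ha, hb', hab, rfl⟩
        refine hstar _ hx _ (hmem y hy) ⟨a, b, ha, hb', hab, ?_⟩
        rw [hΦ, hΦ, hΦ, map_add, map_smul, map_smul, smul_add, smul_add]
        have : z = a • z + b • z := by rw [← add_smul, hab, one_smul]
        nth_rewrite 3 [this]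
        abel }
  have hcl : closure (Φ ⁻¹' E) = Φ ⁻¹' closure E := (Φ.toHomeomorph.preimage_closure E).symm
  have hfr : frontier (Φ ⁻¹' E) = Φ ⁻¹' frontier E := (Φ.toHomeomorph.preimage_frontier E).symm
  have hΦd : ContDiff ℝ 1 (fun w => Φ w) := by
    simp_rw [hΦ]
    exact ι.contDiff.add contDiff_const
  have hcore := g.core hρ0 (v := fun w => v (Φ w)) (U := Φ ⁻¹' U) (hU.preimage Φ.continuous)
    (by rw [hcl]; exact preimage_mono hEU)
    (hv.comp hΦd.contDiffOn fun w hw => hw)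
  have hvol : MeasurePreserving Φ volume volume :=
    (measurePreserving_add_right volume z).comp ι.measurePreserving
  have hemb : MeasurableEmbedding Φ := Φ.toHomeomorph.measurableEmbedding
  have hgrad : ∀ w, ‖fderiv ℝ (fun w => v (Φ w)) w‖ = ‖gradient v (Φ w)‖ := by
    intro w
    have h1 : fderiv ℝ (fun w => v (Φ w)) w =
        (fderiv ℝ v (Φ w)).comp (ι.toContinuousLinearEquiv : ℂ →L[ℝ] _) := by
      have h2 := ι.toContinuousLinearEquiv.comp_right_fderiv (f := fun x => v (x + z)) (x := w)
      rw [fderiv_comp_add_right] at h2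
      exact h2
    rw [h1, gradient, LinearIsometryEquiv.norm_map]
    exact ContinuousLinearMap.opNorm_comp_linearIsometryEquiv _ ι
  rw [hfr, hvol.setIntegral_preimage_emb hemb (fun x => v x ^ 2),
    (Φ.measurePreserving_hausdorffMeasure 1).setIntegral_preimage_emb hemb v] at hcore
  simp_rw [hgrad] at hcore
  rw [hvol.setIntegral_preimage_emb hemb (fun x => ‖gradient v x‖ ^ 2)] at hcore
  exact hcore
end
end

section
/- Fix ρ ∈ (0,1). There exists a constant C > 0, depending only on ρ, such that for every bounded open set E ⊂ ℝ² of diameter h_E that is shape-regular with parameter ρ, and every v : ℝ² → ℝ of class C² on an open neighborhood of the closure of E, the following second-order Poincaré–Friedrichs inequality holds: ∫_E v(x)² dx ≤ C · ( h_E⁴ ∫_E Σ_{i,j=1}^2 (∂_i∂_j v)(x)² dx + ( ∫_{∂E} v dH¹ )² + h_E² · ‖ ∫_{∂E} ∇v dH¹ ‖² ). -/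
open MeasureTheory Metric Set

noncomputable section

/-- Second partial derivative `∂_i ∂_j u` of `u : ℝ² → ℝ`. -/
def pd2 (u : EuclideanSpace ℝ (Fin 2) → ℝ) (i j : Fin 2)
    (x : EuclideanSpace ℝ (Fin 2)) : ℝ :=
  fderiv ℝ (fun y => fderiv ℝ u y (EuclideanSpace.single i 1)) x (EuclideanSpace.single j 1)



/-- direction vector -/
def uu (t : ℝ) : EuclideanSpace ℝ (Fin 2) := !₂[Real.cos t, Real.sin t]

lemma uu_norm (t : ℝ) : ‖uu t‖ = 1 := by
  simp [uu, EuclideanSpace.norm_eq, Fin.sum_univ_two]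

lemma uu_lip (a b : ℝ) : ‖uu a - uu b‖ ≤ |a - b| := by
  rw [EuclideanSpace.norm_eq]
  apply Real.sqrt_le_iff.2 ⟨abs_nonneg _, ?_⟩
  simp only [uu, Fin.sum_univ_two, Real.norm_eq_abs, sq_abs, PiLp.sub_apply]
  simp
  have h1 := Real.one_sub_sq_div_two_le_cos (x := a - b)
  rw [Real.cos_sub] at h1
  nlinarith [Real.sin_sq_add_cos_sq a, Real.sin_sq_add_cos_sq b]

lemma uu_polar (x : EuclideanSpace ℝ (Fin 2)) :
    ∃ t ∈ Ioc (-Real.pi) Real.pi, x = ‖x‖ • uu t := by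
  set c : ℂ := ⟨x 0, x 1⟩ with hc
  have hn : ‖c‖ = ‖x‖ := by
    rw [EuclideanSpace.norm_eq, Complex.norm_eq_sqrt_sq_add_sq]
    simp [Fin.sum_univ_two, hc]
  refine ⟨c.arg, ⟨Complex.neg_pi_lt_arg c, Complex.arg_le_pi c⟩, ?_⟩
  rw [← hn]
  ext i
  fin_cases i
  · simp [uu, Complex.norm_mul_cos_arg, hc]
  · simp [uu, Complex.norm_mul_sin_arg, hc]

lemma star_closure {E : Set (EuclideanSpace ℝ (Fin 2))} {z : EuclideanSpace ℝ (Fin 2)} {r : ℝ}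
    (hstar : ∀ x ∈ E, ∀ y ∈ closedBall z r, segment ℝ x y ⊆ E)
    {x : EuclideanSpace ℝ (Fin 2)} (hx : x ∈ closure E) {y : EuclideanSpace ℝ (Fin 2)}
    (hy : ‖y - z‖ < r) {t : ℝ} (ht : 0 < t) (ht1 : t ≤ 1) : (1 - t) • x + t • y ∈ E := by
  obtain ⟨xs, hxs, hlim⟩ := mem_closure_iff_seq_limit.1 hx
  have h1 : Filter.Tendsto (fun n => ‖(y + ((1 - t) / t) • (x - xs n)) - z‖) Filter.atTop
      (nhds ‖(y + ((1 - t) / t) • (x - x)) - z‖) :=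
    ((((hlim.const_sub x).const_smul ((1 - t) / t)).const_add y).sub_const z).norm
  have h2 : ‖(y + ((1 - t) / t) • (x - x)) - z‖ < r := by simpa using hy
  obtain ⟨n, hn⟩ := (h1.eventually (gt_mem_nhds h2)).exists
  have h3 := hstar (xs n) (hxs n) (y + ((1 - t) / t) • (x - xs n))
    (by rw [mem_closedBall, dist_eq_norm]; exact hn.le)
  apply h3
  refine ⟨1 - t, t, by linarith, ht.le, by ring, ?_⟩
  rw [smul_add, smul_smul, mul_div_cancel₀ _ ht.ne']
  module

lemma radial {E : Set (EuclideanSpace ℝ (Fin 2))} {z : EuclideanSpace ℝ (Fin 2)} {r : ℝ}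
    (hE : IsOpen E) (hb : Bornology.IsBounded E) (hr : 0 < r) (hball : closedBall z r ⊆ E)
    (hstar : ∀ x ∈ E, ∀ y ∈ closedBall z r, segment ℝ x y ⊆ E) :
    ∃ R : ℝ → ℝ, (∀ t, r ≤ R t) ∧ (∀ t, R t ≤ diam E) ∧
      (∀ t s, 0 ≤ s → (z + s • uu t ∈ E ↔ s < R t)) ∧
      (∀ t, z + R t • uu t ∈ frontier E) ∧
      (∀ x ∈ frontier E, ∃ t ∈ Ioc (-Real.pi) Real.pi, x = z + R t • uu t) ∧
      (∀ a b, |R a - R b| ≤ diam E ^ 2 / r * |a - b|) := by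
  have hzE : z ∈ E := hball (mem_closedBall_self hr.le)
  have hdist : ∀ t s, 0 ≤ s → z + s • uu t ∈ closure E → s ≤ diam E := by
    intro t s hs h
    have := dist_le_diam_of_mem hb.closure h (subset_closure hzE)
    rw [diam_closure, dist_eq_norm, add_sub_cancel_left, norm_smul, uu_norm, mul_one,
      Real.norm_of_nonneg hs] at this
    exact this
  set S : ℝ → Set ℝ := fun t => {s | 0 ≤ s ∧ z + s • uu t ∈ E} with hS
  set R : ℝ → ℝ := fun t => sSup (S t) with hR
  have hbdd : ∀ t, BddAbove (S t) := fun t =>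
    ⟨diam E, fun s hs => hdist t s hs.1 (subset_closure hs.2)⟩
  have hrS : ∀ t, r ∈ S t := fun t => ⟨hr.le, hball (by
    rw [mem_closedBall, dist_eq_norm, add_sub_cancel_left, norm_smul, uu_norm, mul_one,
      Real.norm_of_nonneg hr.le])⟩
  have h1 : ∀ t, r ≤ R t := fun t => le_csSup (hbdd t) (hrS t)
  have hcont : ∀ t : ℝ, Continuous fun s : ℝ => z + s • uu t := fun t => by fun_prop
  have hcl : ∀ t, z + R t • uu t ∈ closure E := by
    intro t
    have := csSup_mem_closure ⟨r, hrS t⟩ (hbdd t)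
    exact map_mem_closure (f := fun s : ℝ => z + s • uu t) (hcont t) this (fun s hs => hs.2)
  have hin : ∀ t s s' : ℝ, 0 ≤ s → s < s' → z + s' • uu t ∈ closure E → z + s • uu t ∈ E := by
    intro t s s' hs hs' h
    have hs'0 : 0 < s' := by linarith
    have := star_closure hstar h (y := z) (by simpa using hr) (t := 1 - s / s')
      (by rw [sub_pos, div_lt_one hs'0]; exact hs') (by have := div_nonneg hs hs'0.le; linarith)
    convert this using 1
    rw [sub_sub_cancel, smul_add, smul_smul, div_mul_cancel₀ _ hs'0.ne']
    module
  have hnot : ∀ t, z + R t • uu t ∉ E := by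
    intro t h
    have ho : IsOpen ((fun s : ℝ => z + s • uu t) ⁻¹' E) := hE.preimage (hcont t)
    obtain ⟨e, he, hsub⟩ := Metric.isOpen_iff.1 ho (R t) h
    have : R t + e / 2 ∈ S t := ⟨by linarith [h1 t], hsub (by
      rw [mem_ball, Real.dist_eq]; simp; rw [abs_of_pos] <;> linarith)⟩
    have := le_csSup (hbdd t) this
    change R t + e / 2 ≤ R t at this
    linarith
  have h3 : ∀ t s, 0 ≤ s → (z + s • uu t ∈ E ↔ s < R t) := by
    intro t s hs
    refine ⟨fun h => ?_, fun h => hin t s _ hs h (hcl t)⟩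
    refine lt_of_le_of_ne (le_csSup (hbdd t) ⟨hs, h⟩) ?_
    rintro rfl
    exact hnot t h
  have hfr : frontier E = closure E \ E := hE.frontier_eq
  have h2 : ∀ t, R t ≤ diam E := fun t => hdist t _ (by linarith [h1 t]) (hcl t)
  refine ⟨R, h1, h2, h3, fun t => hfr ▸ ⟨hcl t, hnot t⟩, ?_, ?_⟩
  · intro x hx
    rw [hfr] at hx
    obtain ⟨t, ht, hxt⟩ := uu_polar (x - z)
    refine ⟨t, ht, ?_⟩
    have hx' : x = z + ‖x - z‖ • uu t := by rw [← hxt]; abel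
    have hx0 := norm_nonneg (x - z)
    set s := ‖x - z‖
    suffices s = R t by rw [← this]; exact hx'
    apply le_antisymm
    · by_contra hlt
      push Not at hlt
      exact hnot t (hin t _ s (by linarith [h1 t]) hlt (hx' ▸ hx.1))
    · by_contra hlt
      push Not at hlt
      exact hx.2 (hx' ▸ (h3 t s hx0).2 hlt)
  · have key : ∀ a b, R b ≤ R a → R a - R b ≤ diam E ^ 2 / r * |a - b| := by
      intro a b hab
      rcases hab.eq_or_lt with h | h
      · rw [h, sub_self]; positivity
      have ha := h1 a
      have hb' := h1 b
      have ha0 : 0 < R a := by linarith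
      have hb0 : 0 < R b := by linarith
      set t := 1 - R b / R a with htdef
      have ht : 0 < t := by rw [htdef, sub_pos, div_lt_one ha0]; exact h
      have ht1 : t ≤ 1 := by have := div_pos hb0 ha0; linarith
      have h4 : r ≤ ‖(R b / t) • (uu b - uu a)‖ := by
        by_contra hlt
        push Not at hlt
        have := star_closure hstar (hcl a) (y := z + (R b / t) • (uu b - uu a))
          (by rwa [add_sub_cancel_left]) ht ht1
        apply hnot b
        convert this using 1
        rw [smul_add, smul_add, smul_smul, smul_smul, mul_div_cancel₀ _ ht.ne']
        have : (1 - t) * R a = R b := by rw [htdef]; field_simp; ring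
        rw [this]; module
      rw [norm_smul, Real.norm_of_nonneg (by positivity), div_mul_eq_mul_div, le_div_iff₀ ht] at h4
      have h5 : R b * ‖uu b - uu a‖ ≤ R b * |a - b| := by
        rw [abs_sub_comm]; exact mul_le_mul_of_nonneg_left (uu_lip b a) hb0.le
      have h6 : r * (R a - R b) ≤ R a * R b * |a - b| := by
        have : R a - R b = t * R a := by rw [htdef]; field_simp
        rw [this]
        nlinarith
      have h7 : R a * R b ≤ diam E ^ 2 := by rw [sq]; exact mul_le_mul (h2 a) (h2 b) hb0.le (by linarith [h2 a])
      rw [div_mul_eq_mul_div, le_div_iff₀ hr]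
      nlinarith [abs_nonneg (a - b)]
    intro a b
    rcases le_total (R b) (R a) with h | h
    · rw [abs_of_nonneg (by linarith)]; exact key a b h
    · rw [abs_sub_comm, abs_sub_comm a, abs_of_nonneg (by linarith)]; exact key b a h

lemma uu_cont : Continuous uu := by
  unfold uu; fun_prop

lemma uu_deriv (t : ℝ) : HasDerivAt uu (uu (t + Real.pi / 2)) t := by
  have : HasDerivAt (fun t => ![Real.cos t, Real.sin t]) ![-Real.sin t, Real.cos t] t := by
    rw [hasDerivAt_pi]
    intro i
    fin_cases i
    · exact Real.hasDerivAt_cos t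
    · exact Real.hasDerivAt_sin t
  have h2 := (PiLp.continuousLinearEquiv 2 ℝ (fun _ : Fin 2 => ℝ)).symm.hasFDerivAt.comp_hasDerivAt t this
  have h3 : uu (t + Real.pi / 2) = (PiLp.continuousLinearEquiv 2 ℝ (fun _ : Fin 2 => ℝ)).symm
      ![-Real.sin t, Real.cos t] := by
    simp [uu, Real.cos_add_pi_div_two, Real.sin_add_pi_div_two]
  rw [h3]
  exact h2

lemma cs_integral {α : Type*} [MeasurableSpace α] (μ : Measure α) [IsFiniteMeasure μ] (f : α → ℝ)
    (hf : Integrable f μ) (hf2 : Integrable (fun x => f x ^ 2) μ) :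
    (∫ x, f x ∂μ) ^ 2 ≤ μ.real univ * ∫ x, f x ^ 2 ∂μ := by
  rcases eq_or_ne μ 0 with h | h
  · simp [h]
  have hM : 0 < μ.real univ := by
    have := Measure.measure_univ_ne_zero.2 h
    exact ENNReal.toReal_pos this (measure_ne_top _ _)
  set M := μ.real univ with hMd
  set J := ∫ x, f x ∂μ with hJ
  have h0 : 0 ≤ ∫ x, (f x - J / M) ^ 2 ∂μ := integral_nonneg fun x => sq_nonneg _
  have h1 : ∫ x, (f x - J / M) ^ 2 ∂μ = (∫ x, f x ^ 2 ∂μ) - 2 * (J / M) * J + M * (J / M) ^ 2 := by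
    have : ∀ x, (f x - J / M) ^ 2 = f x ^ 2 - 2 * (J / M) * f x + (J / M) ^ 2 := fun x => by ring
    simp_rw [this]
    have hs : Integrable (fun x => f x ^ 2 - 2 * (J / M) * f x) μ := hf2.sub (hf.const_mul _)
    rw [integral_add hs (integrable_const _), integral_sub hf2 (hf.const_mul _),
      integral_const_mul, integral_const, smul_eq_mul]
  rw [h1] at h0
  have h2 : (∫ x, f x ^ 2 ∂μ) - 2 * (J / M) * J + M * (J / M) ^ 2 = (∫ x, f x ^ 2 ∂μ) - J ^ 2 / M := by
    field_simp; ring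
  rw [h2, sub_nonneg, div_le_iff₀ hM] at h0
  linarith

lemma ftc_cs {U : Set (EuclideanSpace ℝ (Fin 2))} (hU : IsOpen U)
    {w : EuclideanSpace ℝ (Fin 2) → ℝ} (hw : ContDiffOn ℝ 1 w U)
    {γ γ' : ℝ → EuclideanSpace ℝ (Fin 2)} {k a b : ℝ} (hab : a ≤ b)
    (hγ : ∀ t, HasDerivAt γ (γ' t) t) (hγ' : Continuous γ') (hk : ∀ t, ‖γ' t‖ ≤ k)
    (hin : ∀ t ∈ Icc a b, γ t ∈ U) :
    (w (γ b) - w (γ a)) ^ 2 ≤ (b - a) * (k ^ 2 * ∫ t in a..b, ‖fderiv ℝ w (γ t)‖ ^ 2) := by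
  have hγc : Continuous γ := continuous_iff_continuousAt.2 fun t => (hγ t).continuousAt
  have hD : ContinuousOn (fderiv ℝ w) U := hw.continuousOn_fderiv_of_isOpen hU le_rfl
  have hDγ : ContinuousOn (fun t => fderiv ℝ w (γ t)) (Icc a b) := hD.comp hγc.continuousOn hin
  have hc : ContinuousOn (fun t => fderiv ℝ w (γ t) (γ' t)) (Icc a b) :=
    hDγ.clm_apply hγ'.continuousOn
  have hftc : ∫ t in a..b, fderiv ℝ w (γ t) (γ' t) = w (γ b) - w (γ a) := by
    apply intervalIntegral.integral_eq_sub_of_hasDerivAt (f := fun t => w (γ t))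
    · intro t ht
      rw [uIcc_of_le hab] at ht
      have : DifferentiableAt ℝ w (γ t) :=
        (hw.differentiableOn one_ne_zero).differentiableAt (hU.mem_nhds (hin t ht))
      exact this.hasFDerivAt.comp_hasDerivAt t (hγ t)
    · exact ContinuousOn.intervalIntegrable (by rwa [uIcc_of_le hab])
  rw [← hftc, intervalIntegral.integral_of_le hab, intervalIntegral.integral_of_le hab]
  have hint : ∀ f : ℝ → ℝ, ContinuousOn f (Icc a b) → IntegrableOn f (Ioc a b) := fun f hf =>
    (hf.integrableOn_compact isCompact_Icc).mono_set Ioc_subset_Icc_self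
  refine (cs_integral (volume.restrict (Ioc a b)) _ (hint _ hc) (hint _ (hc.pow 2))).trans ?_
  have : (volume.restrict (Ioc a b)).real univ = b - a := by
    simp [Measure.real, hab]
  rw [this]
  apply mul_le_mul_of_nonneg_left _ (by linarith)
  rw [← integral_const_mul]
  apply integral_mono (hint _ (hc.pow 2)) (hint _ ((hDγ.norm.pow 2).const_mul _))
  intro t
  show (fderiv ℝ w (γ t) (γ' t)) ^ 2 ≤ k ^ 2 * ‖fderiv ℝ w (γ t)‖ ^ 2
  rw [← mul_pow, ← sq_abs]
  apply pow_le_pow_left₀ (abs_nonneg _)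
  calc |fderiv ℝ w (γ t) (γ' t)| ≤ ‖fderiv ℝ w (γ t)‖ * ‖γ' t‖ := (fderiv ℝ w (γ t)).le_opNorm _
    _ ≤ ‖fderiv ℝ w (γ t)‖ * k := mul_le_mul_of_nonneg_left (hk t) (norm_nonneg _)
    _ = _ := mul_comm _ _

lemma polar_integral (z : EuclideanSpace ℝ (Fin 2)) (f : EuclideanSpace ℝ (Fin 2) → ℝ) :
    ∫ x, f x = ∫ p in (Ioi (0 : ℝ)) ×ˢ Ioo (-Real.pi) Real.pi, p.1 * f (z + p.1 • uu p.2) := by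
  rw [← integral_add_left_eq_self f z,
    ← (PiLp.volume_preserving_toLp (Fin 2)).integral_comp
      (MeasurableEquiv.toLp 2 (Fin 2 → ℝ)).measurableEmbedding,
    ← (volume_preserving_finTwoArrow ℝ).symm.integral_comp (MeasurableEquiv.measurableEmbedding _),
    ← integral_comp_polarCoord_symm]
  rw [polarCoord_target]
  congr 1
  ext p
  rw [smul_eq_mul]
  congr 3
  ext i
  fin_cases i <;> simp [uu]

lemma polar_fubini {E : Set (EuclideanSpace ℝ (Fin 2))} {z : EuclideanSpace ℝ (Fin 2)} {r : ℝ}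
    (hE : IsOpen E) (hb : Bornology.IsBounded E) (hr : 0 < r) {R : ℝ → ℝ}
    (hR1 : ∀ t, r ≤ R t) (hR2 : ∀ t, R t ≤ diam E)
    (hR3 : ∀ t s, 0 ≤ s → (z + s • uu t ∈ E ↔ s < R t))
    (F : EuclideanSpace ℝ (Fin 2) → ℝ) (hF : ContinuousOn F (closure E)) :
    (∫ x in E, F x = ∫ t in Ioo (-Real.pi) Real.pi, ∫ s in 0..R t, s * F (z + s • uu t)) ∧
    IntegrableOn (fun t => ∫ s in 0..R t, s * F (z + s • uu t)) (Ioo (-Real.pi) Real.pi) ∧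
    ((∀ x, 0 ≤ F x) → ∃ σ ∈ Ioo (r / 2) r,
      ∫ t in Ioo (-Real.pi) Real.pi, σ * F (z + σ • uu t) ≤ 2 / r * ∫ x in E, F x) := by
  set G := E.indicator F with hG
  set H : ℝ × ℝ → ℝ := fun p => p.1 * G (z + p.1 • uu p.2) with hH
  obtain ⟨K, hK⟩ := hb.isCompact_closure.exists_bound_of_continuousOn hF
  have hGm : Measurable G := by
    classical
    have := ContinuousOn.measurable_piecewise (f := F) (g := fun _ => (0:ℝ)) (s := E)
      (hF.mono subset_closure) continuousOn_const hE.measurableSet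
    convert this using 1
    ext x
    simp [hG, indicator, piecewise]
  have hHm : Measurable H := by
    have h1 : Continuous fun p : ℝ × ℝ => z + p.1 • uu p.2 := by
      have := uu_cont
      fun_prop
    exact measurable_fst.mul (hGm.comp h1.measurable)
  have hGb : ∀ x, |G x| ≤ |K| := by
    intro x
    by_cases hx : x ∈ E
    · simp only [hG, indicator_of_mem hx]
      exact (hK x (subset_closure hx)).trans (le_abs_self K)
    · simp [hG, indicator_of_notMem hx]
  have hG0 : ∀ t s, 0 ≤ s → R t ≤ s → G (z + s • uu t) = 0 := by
    intro t s hs hs'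
    apply indicator_of_notMem
    rw [hR3 t s hs]
    exact not_lt.2 hs'
  have hG1 : ∀ t s, 0 ≤ s → s < R t → G (z + s • uu t) = F (z + s • uu t) := by
    intro t s hs hs'
    exact indicator_of_mem ((hR3 t s hs).2 hs') _
  have hint : IntegrableOn H (Ioi 0 ×ˢ Ioo (-Real.pi) Real.pi) := by
    have h1 : IntegrableOn H (Ioc 0 (diam E) ×ˢ Ioo (-Real.pi) Real.pi) := by
      apply IntegrableOn.of_bound (C := diam E * |K|)
      · exact hHm.aestronglyMeasurable
      · refine (ae_restrict_iff' (measurableSet_Ioc.prod measurableSet_Ioo)).2 (.of_forall ?_)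
        rintro ⟨s, t⟩ ⟨hs, -⟩
        simp only [hH, norm_mul, Real.norm_eq_abs]
        rw [abs_of_pos hs.1]
        exact mul_le_mul hs.2 (hGb _) (abs_nonneg _) diam_nonneg
      · rw [Measure.volume_eq_prod, Measure.prod_prod, Real.volume_Ioc, Real.volume_Ioo]
        exact ENNReal.mul_lt_top ENNReal.ofReal_lt_top ENNReal.ofReal_lt_top
    apply h1.of_forall_sdiff_eq_zero (measurableSet_Ioi.prod measurableSet_Ioo)
    rintro ⟨s, t⟩ ⟨⟨hs, ht⟩, hn⟩
    have hs' : (0:ℝ) < s := hs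
    have : diam E < s := by
      by_contra hle
      exact hn ⟨⟨hs', not_lt.1 hle⟩, ht⟩
    simp only [hH]
    rw [hG0 t s hs'.le (by linarith [hR2 t]), mul_zero]
  have hint' : Integrable H ((volume.restrict (Ioi (0:ℝ))).prod
      (volume.restrict (Ioo (-Real.pi) Real.pi))) := by
    rw [Measure.prod_restrict]; exact hint
  have hEq : ∫ x in E, F x = ∫ p, H p ∂((volume.restrict (Ioi (0:ℝ))).prod
      (volume.restrict (Ioo (-Real.pi) Real.pi))) := by
    rw [← integral_indicator hE.measurableSet, polar_integral z, Measure.prod_restrict]; rfl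
  have hinner : ∀ t, ∫ s in Ioi (0:ℝ), H (s, t) = ∫ s in 0..R t, s * F (z + s • uu t) := by
    intro t
    have hRt : 0 ≤ R t := by linarith [hR1 t]
    rw [intervalIntegral.integral_of_le hRt, integral_Ioc_eq_integral_Ioo]
    rw [setIntegral_eq_of_subset_of_forall_sdiff_eq_zero (s := Ioo 0 (R t)) measurableSet_Ioi
      (fun s hs => hs.1)]
    · refine setIntegral_congr_fun measurableSet_Ioo fun s hs => ?_
      simp only [hH]
      rw [hG1 t s hs.1.le hs.2]
    · rintro s ⟨hs, hn⟩
      have hs' : (0:ℝ) < s := hs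
      simp only [hH]
      rw [hG0 t s hs'.le (not_lt.1 fun h => hn ⟨hs', h⟩), mul_zero]
  refine ⟨?_, ?_, ?_⟩
  · rw [hEq, integral_prod_symm _ hint']
    simp_rw [hinner]
  · have := hint'.integral_prod_right
    simp_rw [hinner] at this
    exact this
  · intro hF0
    have hH0 : ∀ s t, 0 ≤ s → 0 ≤ H (s, t) := fun s t hs =>
      mul_nonneg hs (indicator_nonneg (fun x _ => hF0 x) _)
    set Φ : ℝ → ℝ := fun s => ∫ t in Ioo (-Real.pi) Real.pi, H (s, t) with hΦ
    have hΦi : IntegrableOn Φ (Ioi 0) := hint'.integral_prod_left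
    have hsub : Ioo (r/2) r ⊆ Ioi 0 := fun s hs => by
      have : 0 < s := by linarith [hs.1]
      exact this
    have hv : volume (Ioo (r/2) r) = ENNReal.ofReal (r/2) := by rw [Real.volume_Ioo]; congr 1; ring
    obtain ⟨σ, hσ, hle⟩ := exists_le_setAverage (f := Φ) (s := Ioo (r/2) r) (μ := volume)
      (by rw [hv]; simpa using hr) (by rw [hv]; simp) (hΦi.mono_set hsub)
    refine ⟨σ, hσ, ?_⟩
    have h1 : Φ σ = ∫ t in Ioo (-Real.pi) Real.pi, σ * F (z + σ • uu t) := by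
      apply integral_congr_ae (.of_forall fun t => ?_)
      simp only [hH]
      rw [hG1 t σ (by linarith [hσ.1]) (by linarith [hσ.2, hR1 t])]
    rw [← h1]
    refine hle.trans ?_
    rw [setAverage_eq, Measure.real, hv, ENNReal.toReal_ofReal (by linarith), smul_eq_mul, inv_div]
    apply mul_le_mul_of_nonneg_left _ (by positivity)
    rw [hEq, integral_prod _ hint']
    apply setIntegral_mono_set hΦi _ hsub.eventuallyLE
    refine (ae_restrict_iff' measurableSet_Ioi).2 (.of_forall fun s hs => ?_)
    exact integral_nonneg fun t => hH0 s t (le_of_lt hs)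

lemma boundary_measure {E : Set (EuclideanSpace ℝ (Fin 2))} {z : EuclideanSpace ℝ (Fin 2)} {r : ℝ}
    (hr : 0 < r) {R : ℝ → ℝ}
    (hR1 : ∀ t, r ≤ R t) (hR2 : ∀ t, R t ≤ diam E)
    (hR4 : ∀ t, z + R t • uu t ∈ frontier E)
    (hR5 : ∀ x ∈ frontier E, ∃ t ∈ Ioc (-Real.pi) Real.pi, x = z + R t • uu t)
    (hR6 : ∀ a b, |R a - R b| ≤ diam E ^ 2 / r * |a - b|) :
    Continuous (fun t => z + R t • uu t) ∧
    ((μH[1] : Measure (EuclideanSpace ℝ (Fin 2))).restrict (frontier E) ≤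
      ENNReal.ofReal (diam E ^ 2 / r + diam E) •
        (volume.restrict (Ioc (-Real.pi) Real.pi)).map (fun t => z + R t • uu t)) ∧
    ((μH[1] : Measure (EuclideanSpace ℝ (Fin 2))) (frontier E) < ⊤) ∧
    2 * r ≤ ((μH[1] : Measure (EuclideanSpace ℝ (Fin 2))).restrict (frontier E)).real univ := by
  have hd : 0 < diam E := by linarith [hR1 0, hR2 0]
  set L := diam E ^ 2 / r + diam E with hL
  have hL0 : 0 ≤ L := by positivity
  set φ : ℝ → EuclideanSpace ℝ (Fin 2) := fun t => z + R t • uu t with hφ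
  have hlip : LipschitzWith (Real.toNNReal L) φ := by
    apply LipschitzWith.of_dist_le_mul
    intro a b
    rw [dist_eq_norm, Real.dist_eq, Real.coe_toNNReal _ hL0]
    have : φ a - φ b = (R a - R b) • uu a + R b • (uu a - uu b) := by simp only [hφ]; module
    rw [this]
    refine (norm_add_le _ _).trans ?_
    rw [norm_smul, norm_smul, uu_norm, mul_one, hL, add_mul]
    apply add_le_add (hR6 a b)
    rw [Real.norm_of_nonneg (by linarith [hR1 b])]
    exact mul_le_mul (hR2 b) (uu_lip a b) (norm_nonneg _) hd.le
  have hc : Continuous φ := hlip.continuous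
  have hle : (μH[1] : Measure (EuclideanSpace ℝ (Fin 2))).restrict (frontier E) ≤
      ENNReal.ofReal L • (volume.restrict (Ioc (-Real.pi) Real.pi)).map φ := by
    rw [Measure.le_iff]
    intro A hA
    rw [Measure.restrict_apply hA, Measure.smul_apply, Measure.map_apply hc.measurable hA,
      Measure.restrict_apply (hc.measurable hA)]
    have hsub : A ∩ frontier E ⊆ φ '' (φ ⁻¹' A ∩ Ioc (-Real.pi) Real.pi) := by
      rintro x ⟨hxA, hx⟩
      obtain ⟨t, ht, rfl⟩ := hR5 x hx
      exact ⟨t, ⟨hxA, ht⟩, rfl⟩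
    refine (measure_mono hsub).trans ?_
    refine (hlip.hausdorffMeasure_image_le zero_le_one _).trans ?_
    rw [hausdorffMeasure_real, ENNReal.rpow_one, smul_eq_mul]
    rfl
  have hfin : (μH[1] : Measure (EuclideanSpace ℝ (Fin 2))) (frontier E) < ⊤ := by
    have h1 := hle univ
    rw [Measure.restrict_apply_univ] at h1
    refine h1.trans_lt ?_
    rw [Measure.smul_apply, Measure.map_apply hc.measurable MeasurableSet.univ, preimage_univ,
      Measure.restrict_apply_univ, Real.volume_Ioc, smul_eq_mul]
    exact ENNReal.mul_lt_top ENNReal.ofReal_lt_top ENNReal.ofReal_lt_top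
  refine ⟨hc, hle, hfin, ?_⟩
  -- projection to the first coordinate
  have hproj : LipschitzWith 1 (fun x : EuclideanSpace ℝ (Fin 2) => x 0) := by
    apply LipschitzWith.of_dist_le_mul
    intro x y
    rw [Real.dist_eq, dist_eq_norm, NNReal.coe_one, one_mul]
    exact PiLp.norm_apply_le (x - y) 0
  have hIcc : Icc (z 0 - r) (z 0 + r) ⊆ (fun x : EuclideanSpace ℝ (Fin 2) => x 0) '' frontier E := by
    have hcc : ContinuousOn (fun t => φ t 0) (Icc 0 Real.pi) :=
      (hproj.continuous.comp hc).continuousOn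
    have h1 := intermediate_value_Icc' Real.pi_pos.le hcc
    intro y hy
    have h2 : y ∈ Icc (φ Real.pi 0) (φ 0 0) := by
      simp [hφ, uu]
      constructor <;> linarith [hR1 Real.pi, hR1 0, hy.1, hy.2]
    obtain ⟨t, -, ht⟩ := h1 h2
    exact ⟨φ t, hR4 t, ht⟩
  have h3 : ENNReal.ofReal (2 * r) ≤ (μH[1] : Measure (EuclideanSpace ℝ (Fin 2))) (frontier E) := by
    have := (measure_mono hIcc).trans (hproj.hausdorffMeasure_image_le zero_le_one (frontier E))
    rw [hausdorffMeasure_real, Real.volume_Icc] at this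
    have e : z 0 + r - (z 0 - r) = 2 * r := by ring
    rw [e] at this
    simpa using this
  rw [Measure.real, Measure.restrict_apply_univ]
  exact (ENNReal.ofReal_le_iff_le_toReal hfin.ne).1 h3

set_option maxHeartbeats 2000000 in
lemma first_order (ρ : ℝ) (hρ : ρ ∈ Set.Ioo (0 : ℝ) 1) :
    ∃ C > (0 : ℝ), ∀ E : Set (EuclideanSpace ℝ (Fin 2)),
      IsOpen E → Bornology.IsBounded E → ShapeRegular ρ E →
      (μH[1] : Measure (EuclideanSpace ℝ (Fin 2))) (frontier E) < ⊤ ∧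
      ∀ w : EuclideanSpace ℝ (Fin 2) → ℝ,
      ∀ U : Set (EuclideanSpace ℝ (Fin 2)), IsOpen U → closure E ⊆ U →
        ContDiffOn ℝ 1 w U →
        (∫ x in E, w x ^ 2) ≤
          C * (Metric.diam E ^ 2 * (∫ x in E, ‖fderiv ℝ w x‖ ^ 2) +
               (∫ x in frontier E, w x ∂μH[1]) ^ 2) := by
  obtain ⟨hρ0, hρ1⟩ := hρ
  have hpi := Real.pi_pos
  set κ : ℝ := 4 / ρ + 16 * Real.pi ^ 2 with hκ
  have hκ0 : 0 < κ := by positivity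
  set C1 : ℝ := 2 * κ + 4 * Real.pi * ((1 / ρ ^ 2 + 1 / ρ) * κ) + 2 with hC1
  set C2 : ℝ := 2 * Real.pi / ρ ^ 2 with hC2
  have hC10 : 0 < C1 := by positivity
  have hC20 : 0 < C2 := by positivity
  refine ⟨C1 + C2, by positivity, ?_⟩
  rintro E hE hb ⟨z, hball, hstar⟩
  set h := diam E with hh
  have hzE : z ∈ E := hball (mem_closedBall_self (mul_nonneg hρ0.le diam_nonneg))
  have hh0 : 0 < h := by
    obtain ⟨e, he, hsub⟩ := Metric.isOpen_iff.1 hE z hzE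
    have h1 : z + (e / 2) • uu 0 ∈ E := hsub (by
      rw [mem_ball, dist_eq_norm, add_sub_cancel_left, norm_smul, uu_norm, mul_one,
        Real.norm_of_nonneg (by linarith)]; linarith)
    have := dist_le_diam_of_mem hb h1 hzE
    rw [dist_eq_norm, add_sub_cancel_left, norm_smul, uu_norm, mul_one,
        Real.norm_of_nonneg (by linarith)] at this
    linarith
  set r := ρ * h with hrdef
  have hr : 0 < r := by positivity
  obtain ⟨R, hR1, hR2, hR3, hR4, hR5, hR6⟩ := radial hE hb hr hball hstar
  obtain ⟨hφc, hνle, hνfin, hνge⟩ := boundary_measure hr hR1 hR2 hR4 hR5 hR6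
  refine ⟨hνfin, ?_⟩
  intro w U hU hEU hw
  set φ : ℝ → EuclideanSpace ℝ (Fin 2) := fun t => z + R t • uu t with hφ
  set ν := (μH[1] : Measure (EuclideanSpace ℝ (Fin 2))).restrict (frontier E) with hν
  have hνF : IsFiniteMeasure ν := ⟨by rw [hν, Measure.restrict_apply_univ]; exact hνfin⟩
  have hwc : ContinuousOn w (closure E) := hw.continuousOn.mono hEU
  have hDc : ContinuousOn (fderiv ℝ w) (closure E) :=
    (hw.continuousOn_fderiv_of_isOpen hU le_rfl).mono hEU
  have hPcl : ∀ t s, 0 ≤ s → s ≤ R t → z + s • uu t ∈ closure E := by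
    intro t s hs hs'
    rcases hs'.eq_or_lt with rfl | hlt
    · exact frontier_subset_closure (hR4 t)
    · exact subset_closure ((hR3 t s hs).2 hlt)
  obtain ⟨hw1, hw2, -⟩ := polar_fubini hE hb hr hR1 hR2 hR3 (fun x => w x ^ 2) (hwc.pow 2)
  obtain ⟨hD1, hD2, hD3⟩ := polar_fubini hE hb hr hR1 hR2 hR3 (fun x => ‖fderiv ℝ w x‖ ^ 2)
    (hDc.norm.pow 2)
  obtain ⟨σ, hσ, hσI⟩ := hD3 (fun x => by positivity)
  have hσ0 : 0 < σ := by linarith [hσ.1]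
  set I := ∫ x in E, ‖fderiv ℝ w x‖ ^ 2 with hI
  have hI0 : 0 ≤ I := integral_nonneg fun x => by positivity
  set A : ℝ → ℝ := fun t => ∫ s in 0..R t, s * ‖fderiv ℝ w (z + s • uu t)‖ ^ 2 with hA
  set b : ℝ → ℝ := fun t => w (φ t) with hbdef
  have hbc : Continuous b := hwc.comp_continuous hφc fun t => frontier_subset_closure (hR4 t)
  have hDray : ∀ t, ContinuousOn (fun s : ℝ => fderiv ℝ w (z + s • uu t)) (Icc 0 (R t)) := by
    intro t
    refine hDc.comp (f := fun s : ℝ => z + s • uu t) (by fun_prop) fun s hs => hPcl t s hs.1 hs.2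
  -- radial estimate
  have hrad : ∀ t s, 0 < s → s ≤ R t → s * (b t - w (z + s • uu t)) ^ 2 ≤ h * A t := by
    intro t s hs hsR
    have h1 := ftc_cs hU hw (γ := fun s : ℝ => z + s • uu t) (γ' := fun _ => uu t) (k := 1) hsR
      (fun s => by
        have := ((hasDerivAt_id s).smul_const (uu t)).const_add z
        simpa using this) continuous_const (fun _ => (uu_norm t).le)
      (fun s' hs' => hEU (hPcl t s' (by linarith [hs'.1]) hs'.2))
    rw [one_pow, one_mul] at h1
    have hii : ∀ (f : ℝ → ℝ) a c, ContinuousOn f (Icc 0 (R t)) → 0 ≤ a → a ≤ c → c ≤ R t →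
        IntervalIntegrable f volume a c := by
      intro f a c hf ha hac hc
      apply ContinuousOn.intervalIntegrable
      rw [uIcc_of_le hac]
      exact hf.mono (Icc_subset_Icc ha hc)
    have hRt0 : 0 ≤ R t := by linarith
    have hc1 : ContinuousOn (fun s' : ℝ => ‖fderiv ℝ w (z + s' • uu t)‖ ^ 2) (Icc 0 (R t)) :=
      (hDray t).norm.pow 2
    have hc2 : ContinuousOn (fun s' : ℝ => s' * ‖fderiv ℝ w (z + s' • uu t)‖ ^ 2) (Icc 0 (R t)) :=
      continuousOn_id.mul hc1
    have h2 : s * (∫ s' in s..R t, ‖fderiv ℝ w (z + s' • uu t)‖ ^ 2) ≤ A t := by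
      rw [← intervalIntegral.integral_const_mul]
      have h3 : ∫ s' in s..R t, s * ‖fderiv ℝ w (z + s' • uu t)‖ ^ 2 ≤
          ∫ s' in s..R t, s' * ‖fderiv ℝ w (z + s' • uu t)‖ ^ 2 := by
        apply intervalIntegral.integral_mono_on hsR ((hii _ _ _ hc1 hs.le hsR le_rfl).const_mul s)
          (hii _ _ _ hc2 hs.le hsR le_rfl)
        intro x hx
        exact mul_le_mul_of_nonneg_right hx.1 (by positivity)
      refine h3.trans ?_
      simp only [hA]
      rw [← intervalIntegral.integral_add_adjacent_intervals (hii _ 0 s hc2 le_rfl hs.le hsR)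
        (hii _ s _ hc2 hs.le hsR le_rfl)]
      have : 0 ≤ ∫ s' in 0..s, s' * ‖fderiv ℝ w (z + s' • uu t)‖ ^ 2 :=
        intervalIntegral.integral_nonneg hs.le fun x hx => mul_nonneg hx.1 (by positivity)
      linarith
    have h4 : 0 ≤ ∫ s' in s..R t, ‖fderiv ℝ w (z + s' • uu t)‖ ^ 2 :=
      intervalIntegral.integral_nonneg hsR fun x hx => by positivity
    have h5 : (b t - w (z + s • uu t)) ^ 2 ≤
        h * ∫ s' in s..R t, ‖fderiv ℝ w (z + s' • uu t)‖ ^ 2 :=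
      h1.trans (mul_le_mul_of_nonneg_right (by linarith [hR2 t]) h4)
    calc s * (b t - w (z + s • uu t)) ^ 2
        ≤ s * (h * ∫ s' in s..R t, ‖fderiv ℝ w (z + s' • uu t)‖ ^ 2) :=
          mul_le_mul_of_nonneg_left h5 hs.le
      _ = h * (s * ∫ s' in s..R t, ‖fderiv ℝ w (z + s' • uu t)‖ ^ 2) := by ring
      _ ≤ h * A t := mul_le_mul_of_nonneg_left h2 hh0.le
  have hA0 : ∀ t, 0 ≤ A t := fun t =>
    intervalIntegral.integral_nonneg (by linarith [hR1 t]) fun x hx =>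
      mul_nonneg hx.1 (by positivity)
  -- circle estimate
  set c := w (z + σ • uu (-Real.pi)) with hc
  have hcirc : ∀ t ∈ Ioc (-Real.pi) Real.pi, (w (z + σ • uu t) - c) ^ 2 ≤ 4 * Real.pi * I := by
    intro t ht
    have hmem : ∀ t, z + σ • uu t ∈ closure E := fun t =>
      hPcl t σ hσ0.le (by linarith [hσ.2, hR1 t])
    have h1 := ftc_cs hU hw (γ := fun t : ℝ => z + σ • uu t)
      (γ' := fun t => σ • uu (t + Real.pi / 2)) (k := σ) ht.1.le
      (fun s => by
        have := ((uu_deriv s).const_smul σ).const_add z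
        exact this) (by have := uu_cont; fun_prop)
      (fun _ => by rw [norm_smul, uu_norm, mul_one, Real.norm_of_nonneg hσ0.le])
      (fun s' hs' => hEU (hmem s'))
    have hcc : Continuous fun t => ‖fderiv ℝ w (z + σ • uu t)‖ ^ 2 := by
      have := uu_cont
      exact (hDc.comp_continuous (by fun_prop : Continuous fun t => z + σ • uu t) hmem).norm.pow 2
    have h2 : ∫ s in (-Real.pi)..t, ‖fderiv ℝ w (z + σ • uu s)‖ ^ 2 ≤
        ∫ s in Ioo (-Real.pi) Real.pi, ‖fderiv ℝ w (z + σ • uu s)‖ ^ 2 := by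
      rw [intervalIntegral.integral_of_le ht.1.le, ← integral_Ioc_eq_integral_Ioo]
      apply setIntegral_mono_set hcc.integrableOn_Ioc (.of_forall fun x => by positivity)
      exact (Ioc_subset_Ioc_right ht.2).eventuallyLE
    rw [integral_const_mul] at hσI
    have h3 : 0 ≤ ∫ s in (-Real.pi)..t, ‖fderiv ℝ w (z + σ • uu s)‖ ^ 2 :=
      intervalIntegral.integral_nonneg ht.1.le fun x hx => by positivity
    set Q := ∫ s in Ioo (-Real.pi) Real.pi, ‖fderiv ℝ w (z + σ • uu s)‖ ^ 2
    have h4 : (t - -Real.pi) ≤ 2 * Real.pi := by linarith [ht.2]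
    calc (w (z + σ • uu t) - c) ^ 2 ≤ _ := h1
      _ ≤ 2 * Real.pi * (σ ^ 2 * Q) := by
        apply mul_le_mul h4 (mul_le_mul_of_nonneg_left h2 (by positivity)) (by positivity)
          (by positivity)
      _ = 2 * Real.pi * (σ * (σ * Q)) := by ring
      _ ≤ 2 * Real.pi * (r * (2 / r * I)) := by
        apply mul_le_mul_of_nonneg_left _ (by positivity)
        apply mul_le_mul hσ.2.le hσI _ hr.le
        exact mul_nonneg hσ0.le (h3.trans h2)
      _ = 4 * Real.pi * I := by field_simp; ring
  -- boundary oscillation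
  have hosc : ∀ t ∈ Ioc (-Real.pi) Real.pi, (b t - c) ^ 2 ≤ 4 / ρ * A t + 8 * Real.pi * I := by
    intro t ht
    have h1 := hrad t σ hσ0 (by linarith [hσ.2, hR1 t])
    have h2 := hcirc t ht
    have h3 : (b t - w (z + σ • uu t)) ^ 2 ≤ 2 / ρ * A t := by
      have h4 : r / 2 * (b t - w (z + σ • uu t)) ^ 2 ≤ h * A t :=
        (mul_le_mul_of_nonneg_right hσ.1.le (sq_nonneg _)).trans h1
      have h5 : 2 / ρ * A t = (h * A t) / (r / 2) := by
        rw [hrdef]; field_simp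
      rw [h5, le_div_iff₀ (by positivity)]
      linarith
    have h6 : 4 / ρ * A t = 2 * (2 / ρ * A t) := by ring
    rw [h6]
    linarith [sq_nonneg ((b t - w (z + σ • uu t)) - (w (z + σ • uu t) - c))]
  set B := ∫ t in Ioc (-Real.pi) Real.pi, (b t - c) ^ 2 with hB
  have hD2' : IntegrableOn A (Ioc (-Real.pi) Real.pi) :=
    (integrableOn_Ioc_iff_integrableOn_Ioo).2 hD2
  have hAI : ∫ t in Ioc (-Real.pi) Real.pi, A t = I := by
    rw [integral_Ioc_eq_integral_Ioo]; exact hD1.symm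
  have hvol : (volume.restrict (Ioc (-Real.pi) Real.pi)).real univ = 2 * Real.pi := by
    rw [Measure.real, Measure.restrict_apply_univ, Real.volume_Ioc,
      ENNReal.toReal_ofReal (by linarith)]; ring
  have hcint : ∀ f : ℝ → ℝ, Continuous f → IntegrableOn f (Ioc (-Real.pi) Real.pi) :=
    fun f hf => hf.integrableOn_Ioc
  have hBI : B ≤ κ * I := by
    have h1 : B ≤ ∫ t in Ioc (-Real.pi) Real.pi, (4 / ρ * A t + 8 * Real.pi * I) := by
      apply setIntegral_mono_on (hcint _ (by fun_prop))
        ((hD2'.const_mul _).add (integrable_const _)) measurableSet_Ioc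
      exact hosc
    rw [integral_add (hD2'.const_mul _) (integrable_const _), integral_const_mul, hAI,
      integral_const, hvol, smul_eq_mul] at h1
    rw [hκ]
    linarith
  have hB0 : 0 ≤ B := integral_nonneg fun x => sq_nonneg _
  -- the constant
  set J := ∫ x in frontier E, w x ∂μH[1] with hJ
  set M := ν.real univ with hM
  have hM0 : 0 < M := by linarith
  set L := h ^ 2 / r + h with hL
  have hL0 : 0 ≤ L := by positivity
  have hfrc : IsCompact (frontier E) :=
    hb.isCompact_closure.of_isClosed_subset isClosed_frontier frontier_subset_closure
  have hνint : ∀ f : EuclideanSpace ℝ (Fin 2) → ℝ, ContinuousOn f (closure E) → Integrable f ν :=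
    fun f hf => ContinuousOn.integrableOn_of_subset_isCompact
      (hf.mono frontier_subset_closure) hfrc hfrc.measurableSet subset_rfl hνfin.ne
  have hcB : c ^ 2 ≤ J ^ 2 / (2 * r ^ 2) + L * B / r := by
    have h1 : (∫ x, (w x - c) ∂ν) = J - c * M := by
      rw [integral_sub (hνint _ hwc) (integrable_const _), integral_const, smul_eq_mul, mul_comm c]
    have h2 := cs_integral ν (fun x => w x - c) (hνint _ (hwc.sub continuousOn_const))
      (hνint _ ((hwc.sub continuousOn_const).pow 2))
    have h3 : ∫ x, (w x - c) ^ 2 ∂ν ≤ L * B := by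
      classical
      set g : EuclideanSpace ℝ (Fin 2) → ℝ := (frontier E).indicator (fun x => (w x - c) ^ 2) with hg
      have hgφ : ∀ t, g (φ t) = (b t - c) ^ 2 := fun t => indicator_of_mem (hR4 t) _
      have hgm : Measurable g := by
        have := ContinuousOn.measurable_piecewise (f := fun x => (w x - c) ^ 2)
          (g := fun _ => (0:ℝ)) (s := frontier E)
          (((hwc.sub continuousOn_const).pow 2).mono frontier_subset_closure)
          continuousOn_const isClosed_frontier.measurableSet
        convert this using 1
        ext x
        simp [hg, indicator, piecewise]
      have hgint : Integrable g ((volume.restrict (Ioc (-Real.pi) Real.pi)).map φ) := by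
        rw [integrable_map_measure hgm.aestronglyMeasurable hφc.aemeasurable]
        refine (hcint (fun t => (b t - c) ^ 2) (by fun_prop)).congr (.of_forall fun t => ?_)
        exact (hgφ t).symm
      have hg1 : ∫ x, (w x - c) ^ 2 ∂ν = ∫ x, g x ∂ν :=
        setIntegral_congr_fun isClosed_frontier.measurableSet
          fun x hx => (indicator_of_mem hx (fun x => (w x - c) ^ 2)).symm
      rw [hg1]
      refine (integral_mono_measure hνle (.of_forall fun x => indicator_nonneg
        (fun x _ => sq_nonneg _) x) (hgint.smul_measure ENNReal.ofReal_ne_top)).trans ?_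
      rw [integral_smul_measure, integral_map hφc.aemeasurable hgm.aestronglyMeasurable,
        ENNReal.toReal_ofReal hL0, smul_eq_mul]
      simp_rw [hgφ]
      exact le_rfl
    rw [h1] at h2
    have h4 : (c * M) ^ 2 ≤ 2 * J ^ 2 + 2 * (M * (L * B)) := by
      have := mul_le_mul_of_nonneg_left h3 hM0.le
      linarith [sq_nonneg (c * M - 2 * J)]
    have h5 : c ^ 2 ≤ 2 * J ^ 2 / M ^ 2 + 2 * (L * B) / M := by
      have : 2 * J ^ 2 / M ^ 2 + 2 * (L * B) / M = (2 * J ^ 2 + 2 * (M * (L * B))) / M ^ 2 := by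
        field_simp
      rw [this, le_div_iff₀ (by positivity), ← mul_pow]
      exact h4
    refine h5.trans ?_
    have h6 : 2 * J ^ 2 / M ^ 2 ≤ 2 * J ^ 2 / (2 * r) ^ 2 := by gcongr
    have h7 : 2 * (L * B) / M ≤ 2 * (L * B) / (2 * r) := by gcongr
    have h8 : 2 * J ^ 2 / (2 * r) ^ 2 = J ^ 2 / (2 * r ^ 2) := by
      rw [div_eq_div_iff (by positivity) (by positivity)]; ring
    have h9 : 2 * (L * B) / (2 * r) = L * B / r := by field_simp
    linarith
  have hbb : ∫ t in Ioc (-Real.pi) Real.pi, b t ^ 2 ≤ 2 * B + 4 * Real.pi * c ^ 2 := by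
    have h1 : ∫ t in Ioc (-Real.pi) Real.pi, b t ^ 2 ≤
        ∫ t in Ioc (-Real.pi) Real.pi, (2 * (b t - c) ^ 2 + 2 * c ^ 2) := by
      apply integral_mono (hcint _ (by fun_prop)) (hcint _ (by fun_prop))
      intro t
      show b t ^ 2 ≤ 2 * (b t - c) ^ 2 + 2 * c ^ 2
      linarith [sq_nonneg (b t - 2 * c)]
    rw [integral_add (hcint _ (by fun_prop)) (hcint _ (by fun_prop)), integral_const_mul,
      integral_const, hvol, smul_eq_mul] at h1
    linarith
  -- interior
  have hin : ∀ t, ∫ s in 0..R t, s * w (z + s • uu t) ^ 2 ≤ h ^ 2 * b t ^ 2 + 2 * h ^ 2 * A t := by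
    intro t
    have hRt0 : 0 ≤ R t := by linarith [hR1 t]
    have hcw : ContinuousOn (fun s : ℝ => s * w (z + s • uu t) ^ 2) (Icc 0 (R t)) :=
      continuousOn_id.mul ((hwc.comp (f := fun s : ℝ => z + s • uu t) (by fun_prop)
        fun s hs => hPcl t s hs.1 hs.2).pow 2)
    have h1 : ∫ s in 0..R t, s * w (z + s • uu t) ^ 2 ≤
        ∫ s in 0..R t, (2 * b t ^ 2 * s + 2 * h * A t) := by
      apply intervalIntegral.integral_mono_on hRt0
      · apply ContinuousOn.intervalIntegrable
        rwa [uIcc_of_le hRt0]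
      · exact Continuous.intervalIntegrable (by fun_prop) _ _
      · intro s hs
        rcases hs.1.eq_or_lt with h0 | h0
        · rw [← h0]
          have := hA0 t
          simp only [zero_mul, mul_zero, zero_add]
          positivity
        · have h2 := hrad t s h0 hs.2
          have h3 : w (z + s • uu t) ^ 2 ≤ 2 * b t ^ 2 + 2 * (b t - w (z + s • uu t)) ^ 2 := by
            linarith [sq_nonneg (2 * b t - w (z + s • uu t))]
          have h4 := mul_le_mul_of_nonneg_left h3 h0.le
          linarith
    refine h1.trans ?_
    rw [intervalIntegral.integral_add (Continuous.intervalIntegrable (by fun_prop) _ _)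
      (Continuous.intervalIntegrable (by fun_prop) _ _), intervalIntegral.integral_const_mul,
      integral_id, intervalIntegral.integral_const, smul_eq_mul]
    have h5 : R t ^ 2 ≤ h ^ 2 := pow_le_pow_left₀ hRt0 (hR2 t) 2
    have h6 : R t * (2 * h * A t) ≤ h * (2 * h * A t) :=
      mul_le_mul_of_nonneg_right (hR2 t) (by have := hA0 t; positivity)
    have h7 : b t ^ 2 * R t ^ 2 ≤ b t ^ 2 * h ^ 2 := mul_le_mul_of_nonneg_left h5 (sq_nonneg _)
    linarith
  have hfinal : ∫ x in E, w x ^ 2 ≤ h ^ 2 * (2 * B + 4 * Real.pi * c ^ 2) + 2 * h ^ 2 * I := by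
    rw [hw1, ← integral_Ioc_eq_integral_Ioo]
    have h1 : ∫ t in Ioc (-Real.pi) Real.pi, (∫ s in 0..R t, s * w (z + s • uu t) ^ 2) ≤
        ∫ t in Ioc (-Real.pi) Real.pi, (h ^ 2 * b t ^ 2 + 2 * h ^ 2 * A t) :=
      integral_mono ((integrableOn_Ioc_iff_integrableOn_Ioo).2 hw2)
        ((hcint (fun t => h ^ 2 * b t ^ 2) (by fun_prop)).add (hD2'.const_mul _)) hin
    rw [integral_add (hcint _ (by fun_prop)) (hD2'.const_mul _), integral_const_mul,
      integral_const_mul, hAI] at h1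
    have := mul_le_mul_of_nonneg_left hbb (sq_nonneg h)
    linarith
  -- combine
  have hc2 : h ^ 2 * c ^ 2 ≤ J ^ 2 / (2 * ρ ^ 2) + h ^ 2 * ((1 / ρ ^ 2 + 1 / ρ) * B) := by
    have h1 := mul_le_mul_of_nonneg_left hcB (sq_nonneg h)
    refine h1.trans (le_of_eq ?_)
    rw [hL, hrdef]
    field_simp
  have e1 : h ^ 2 * B ≤ h ^ 2 * (κ * I) := mul_le_mul_of_nonneg_left hBI (sq_nonneg h)
  have e2 : (1 / ρ ^ 2 + 1 / ρ) * (h ^ 2 * B) ≤ (1 / ρ ^ 2 + 1 / ρ) * (h ^ 2 * (κ * I)) :=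
    mul_le_mul_of_nonneg_left e1 (by positivity)
  have e3 : 4 * Real.pi * (h ^ 2 * c ^ 2) ≤ 4 * Real.pi * (J ^ 2 / (2 * ρ ^ 2) +
      (1 / ρ ^ 2 + 1 / ρ) * (h ^ 2 * (κ * I))) := by
    apply mul_le_mul_of_nonneg_left _ (by positivity)
    linarith
  have e4 : 4 * Real.pi * (J ^ 2 / (2 * ρ ^ 2)) = C2 * J ^ 2 := by
    rw [hC2]; field_simp; ring
  have e5 : ∫ x in E, w x ^ 2 ≤ C1 * (h ^ 2 * I) + C2 * J ^ 2 := by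
    rw [← e4, hC1]
    linarith
  have e6 : 0 ≤ C2 * (h ^ 2 * I) := by positivity
  have e7 : 0 ≤ C1 * J ^ 2 := by positivity
  linarith

lemma opnorm_sq_le (T : EuclideanSpace ℝ (Fin 2) →L[ℝ] ℝ) :
    ‖T‖ ^ 2 ≤ ∑ j : Fin 2, T (EuclideanSpace.single j 1) ^ 2 := by
  have h0 : 0 ≤ ∑ j : Fin 2, T (EuclideanSpace.single j 1) ^ 2 :=
    Finset.sum_nonneg fun _ _ => sq_nonneg _
  have : ‖T‖ ≤ Real.sqrt (∑ j : Fin 2, T (EuclideanSpace.single j 1) ^ 2) := by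
    apply T.opNorm_le_bound (Real.sqrt_nonneg _)
    intro x
    have hx : x = x 0 • EuclideanSpace.single (0 : Fin 2) (1:ℝ) +
        x 1 • EuclideanSpace.single (1 : Fin 2) (1:ℝ) := by
      ext i; fin_cases i <;> simp
    have hT : T x = x 0 * T (EuclideanSpace.single 0 1) + x 1 * T (EuclideanSpace.single 1 1) := by
      conv_lhs => rw [hx]
      simp
    rw [EuclideanSpace.norm_eq, ← Real.sqrt_mul h0, Real.norm_eq_abs]
    apply Real.abs_le_sqrt
    rw [hT]
    simp only [Fin.sum_univ_two, Real.norm_eq_abs, sq_abs]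
    nlinarith [sq_nonneg (x 0 * T (EuclideanSpace.single 1 1) - x 1 * T (EuclideanSpace.single 0 1))]
  calc ‖T‖ ^ 2 ≤ _ := pow_le_pow_left₀ (norm_nonneg _) this 2
    _ = _ := Real.sq_sqrt h0

set_option maxHeartbeats 1000000 in
/-- Second-order Poincaré–Friedrichs inequality (3.6):
`‖v‖²_{0,E} ≤ C (h_E⁴ |v|²_{2,E} + (∫_{∂E} v dH¹)² + h_E² ‖∫_{∂E} ∇v dH¹‖²)` on
shape-regular elements. -/
theorem poincare_friedrichs_second_order (ρ : ℝ) (hρ : ρ ∈ Set.Ioo (0 : ℝ) 1) :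
    ∃ C > (0 : ℝ), ∀ E : Set (EuclideanSpace ℝ (Fin 2)),
      IsOpen E → Bornology.IsBounded E → ShapeRegular ρ E →
      ∀ v : EuclideanSpace ℝ (Fin 2) → ℝ,
      ∀ U : Set (EuclideanSpace ℝ (Fin 2)), IsOpen U → closure E ⊆ U →
        ContDiffOn ℝ 2 v U →
        (∫ x in E, v x ^ 2) ≤
          C * (Metric.diam E ^ 4 *
                (∫ x in E, ∑ i : Fin 2, ∑ j : Fin 2, (pd2 v i j x) ^ 2) +
               (∫ x in frontier E, v x ∂μH[1]) ^ 2 +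
               Metric.diam E ^ 2 * ‖∫ x in frontier E, gradient v x ∂μH[1]‖ ^ 2) := by
  obtain ⟨C, hC, hmain⟩ := first_order ρ hρ
  refine ⟨C + C ^ 2, by positivity, ?_⟩
  intro E hE hb hreg v U hU hEU hv
  obtain ⟨hfin, hFO⟩ := hmain E hE hb hreg
  have hv1 : ContDiffOn ℝ 1 v U := hv.of_le (by norm_num)
  have hDv : ContDiffOn ℝ 1 (fderiv ℝ v) U := hv.fderiv_of_isOpen hU (by norm_num)
  set w : Fin 2 → EuclideanSpace ℝ (Fin 2) → ℝ :=
    fun i x => fderiv ℝ v x (EuclideanSpace.single i 1) with hw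
  have hwC : ∀ i, ContDiffOn ℝ 1 (w i) U := fun i => hDv.clm_apply contDiffOn_const
  have hint : ∀ f : EuclideanSpace ℝ (Fin 2) → ℝ, ContinuousOn f U → IntegrableOn f E := by
    intro f hf
    exact ((hf.mono hEU).integrableOn_compact hb.isCompact_closure).mono_set subset_closure
  have hwDc : ∀ i, ContinuousOn (fderiv ℝ (w i)) U := fun i =>
    (hwC i).continuousOn_fderiv_of_isOpen hU le_rfl
  have hpc : ∀ i j, ContinuousOn (pd2 v i j) U := fun i j =>
    (hwDc i).clm_apply continuousOn_const
  set S : Fin 2 → ℝ := fun i => ∫ x in E, ∑ j : Fin 2, (pd2 v i j x) ^ 2 with hS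
  have hSint : ∀ i, IntegrableOn (fun x => ∑ j : Fin 2, (pd2 v i j x) ^ 2) E := fun i =>
    hint _ (continuousOn_finsetSum _ fun j _ => (hpc i j).pow 2)
  have hSsum : ∫ x in E, ∑ i : Fin 2, ∑ j : Fin 2, (pd2 v i j x) ^ 2 = S 0 + S 1 := by
    rw [integral_finsetSum _ fun i _ => hSint i, Fin.sum_univ_two]
  have hSD : ∀ i, ∫ x in E, ‖fderiv ℝ (w i) x‖ ^ 2 ≤ S i := fun i =>
    integral_mono (hint _ ((hwDc i).norm.pow 2)) (hSint i) fun x => opnorm_sq_le _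
  have hDI : ∫ x in E, ‖fderiv ℝ v x‖ ^ 2 ≤ (∫ x in E, w 0 x ^ 2) + ∫ x in E, w 1 x ^ 2 := by
    rw [← integral_add (hint (fun x => w 0 x ^ 2) ((hwC 0).continuousOn.pow 2))
      (hint (fun x => w 1 x ^ 2) ((hwC 1).continuousOn.pow 2))]
    refine integral_mono (hint _ (hDv.continuousOn.norm.pow 2))
      (hint _ (((hwC 0).continuousOn.pow 2).add ((hwC 1).continuousOn.pow 2))) fun x => ?_
    have := opnorm_sq_le (fderiv ℝ v x)
    rw [Fin.sum_univ_two] at this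
    exact this
  have hfrc : IsCompact (frontier E) :=
    hb.isCompact_closure.of_isClosed_subset isClosed_frontier frontier_subset_closure
  have hgc : ContinuousOn (gradient v) U := by
    unfold gradient
    exact (InnerProductSpace.toDual ℝ (EuclideanSpace ℝ (Fin 2))).symm.continuous.comp_continuousOn
      hDv.continuousOn
  have hgint : IntegrableOn (gradient v) (frontier E) μH[1] :=
    ContinuousOn.integrableOn_of_subset_isCompact
      (hgc.mono (frontier_subset_closure.trans hEU)) hfrc hfrc.measurableSet subset_rfl hfin.ne
  set g := ∫ x in frontier E, gradient v x ∂μH[1] with hg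
  have hcoord : ∀ i, ∫ x in frontier E, w i x ∂μH[1] = g i := by
    intro i
    have h1 := (EuclideanSpace.proj (𝕜 := ℝ) i : EuclideanSpace ℝ (Fin 2) →L[ℝ] ℝ).integral_comp_comm
      hgint
    have h2 : ∀ x, w i x = (EuclideanSpace.proj (𝕜 := ℝ) i : EuclideanSpace ℝ (Fin 2) →L[ℝ] ℝ)
        (gradient v x) := by
      intro x
      have h3 : inner ℝ (gradient v x) (EuclideanSpace.single i (1:ℝ)) = w i x := by
        rw [gradient, InnerProductSpace.toDual_symm_apply]
      rw [← h3, EuclideanSpace.inner_single_right]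
      simp
    simp_rw [h2]
    rw [h1]
    rfl
  have hgn : ‖g‖ ^ 2 = g 0 ^ 2 + g 1 ^ 2 := by
    rw [EuclideanSpace.norm_sq_eq, Fin.sum_univ_two]; simp
  have f0 := hFO v U hU hEU hv1
  have f1 : ∀ i, ∫ x in E, w i x ^ 2 ≤ C * (diam E ^ 2 * S i + g i ^ 2) := by
    intro i
    have := hFO (w i) U hU hEU (hwC i)
    rw [hcoord i] at this
    refine this.trans ?_
    have := hSD i
    gcongr
  rw [hSsum, hgn]
  set h := diam E
  set J := ∫ x in frontier E, v x ∂μH[1]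
  have hS0 : ∀ i, 0 ≤ S i := fun i => integral_nonneg fun x =>
    Finset.sum_nonneg fun _ _ => sq_nonneg _
  have k1 : C * h ^ 2 * (∫ x in E, ‖fderiv ℝ v x‖ ^ 2) ≤
      C * h ^ 2 * (C * (h ^ 2 * S 0 + g 0 ^ 2) + C * (h ^ 2 * S 1 + g 1 ^ 2)) := by
    apply mul_le_mul_of_nonneg_left _ (by positivity)
    linarith [f1 0, f1 1]
  have s0 := hS0 0
  have s1 := hS0 1
  have k2 : 0 ≤ C * (h ^ 4 * (S 0 + S 1) + h ^ 2 * (g 0 ^ 2 + g 1 ^ 2)) := by positivity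
  have k3 : 0 ≤ C ^ 2 * J ^ 2 := by positivity
  linarith
end
end

section
/- Fix an integer k ≥ 0 and ρ ∈ (0,1). There exists a constant C > 0, depending only on k and ρ, such that for every bounded open set E ⊂ ℝ² of diameter h_E that is shape-regular with parameter ρ, and every polynomial function p : ℝ² → ℝ of total degree at most k, the following fractional inverse inequality holds: h_E · ∫_E ∫_E Σ_{i,j=1}^2 ( (∂_i∂_j p)(x) − (∂_i∂_j p)(y) )² / ‖x − y‖³ dx dy ≤ C · ∫_E Σ_{i,j=1}^2 (∂_i∂_j p)(x)² dx. -/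
open MeasureTheory Metric Set

noncomputable section

/-- `p : ℝ² → ℝ` is a polynomial function of total degree at most `k`. -/
def IsPolyDeg (k : ℕ) (p : EuclideanSpace ℝ (Fin 2) → ℝ) : Prop :=
  ∃ q : MvPolynomial (Fin 2) ℝ, q.totalDegree ≤ k ∧
    ∀ x : EuclideanSpace ℝ (Fin 2), p x = MvPolynomial.eval (fun i => x i) q

local notation "𝔼" => EuclideanSpace ℝ (Fin 2)

lemma td_pderiv (q : MvPolynomial (Fin 2) ℝ) (i : Fin 2) :
    (MvPolynomial.pderiv i q).totalDegree ≤ q.totalDegree := by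
  rw [MvPolynomial.totalDegree]
  refine Finset.sup_le fun m hm => ?_
  rw [MvPolynomial.mem_support_iff, MvPolynomial.coeff_pderiv] at hm
  have h1 : m + Finsupp.single i 1 ∈ q.support := by
    rw [MvPolynomial.mem_support_iff]
    exact left_ne_zero_of_mul hm
  have h2 := MvPolynomial.le_totalDegree h1
  rw [Finsupp.sum_add_index' (by simp) (by simp)] at h2
  exact le_trans (Nat.le_add_right _ _) h2

lemma td_affine (q : MvPolynomial (Fin 2) ℝ) (k : ℕ) (hq : q.totalDegree ≤ k) (z : 𝔼) (h : ℝ) :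
    ∃ q' : MvPolynomial (Fin 2) ℝ, q'.totalDegree ≤ k ∧ ∀ x : 𝔼,
      MvPolynomial.eval (fun i => x i) q' = MvPolynomial.eval (fun i => (z + h • x) i) q := by
  refine ⟨∑ d ∈ q.support, MvPolynomial.C (q.coeff d) *
    ∏ i, (MvPolynomial.C (z i) + MvPolynomial.C h * MvPolynomial.X i) ^ d i, ?_, ?_⟩
  · refine (MvPolynomial.totalDegree_finsetSum _ _).trans (Finset.sup_le fun d hd => ?_)
    refine (MvPolynomial.totalDegree_mul _ _).trans ?_
    rw [MvPolynomial.totalDegree_C, zero_add]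
    refine (MvPolynomial.totalDegree_finsetProd _ _).trans ?_
    refine le_trans ?_ ((MvPolynomial.le_totalDegree hd).trans hq)
    rw [Finsupp.sum_fintype _ _ (by simp)]
    refine Finset.sum_le_sum fun i _ => ?_
    refine (MvPolynomial.totalDegree_pow _ _).trans ?_
    have : (MvPolynomial.C (z i) + MvPolynomial.C h * MvPolynomial.X i :
        MvPolynomial (Fin 2) ℝ).totalDegree ≤ 1 := by
      refine (MvPolynomial.totalDegree_add _ _).trans ?_
      refine max_le (by simp) ((MvPolynomial.totalDegree_mul _ _).trans (by simp))
    nlinarith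
  · intro x
    rw [MvPolynomial.eval_eq' _ q]
    simp

lemma hasFDerivAt_eval (q : MvPolynomial (Fin 2) ℝ) (x : 𝔼) :
    HasFDerivAt (fun y : 𝔼 => MvPolynomial.eval (fun i => y i) q)
      (∑ i, MvPolynomial.eval (fun i => x i) (MvPolynomial.pderiv i q) •
        (EuclideanSpace.proj i : 𝔼 →L[ℝ] ℝ)) x := by
  induction q using MvPolynomial.induction_on with
  | C a => simpa using hasFDerivAt_const a x
  | add p q hp hq =>
    have := hp.add hq
    simp only [map_add, add_smul, Finset.sum_add_distrib]
    exact this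
  | mul_X p j hp =>
    have hj : HasFDerivAt (fun y : 𝔼 => y j) (EuclideanSpace.proj j : 𝔼 →L[ℝ] ℝ) x :=
      (EuclideanSpace.proj j : 𝔼 →L[ℝ] ℝ).hasFDerivAt
    have := hp.mul hj
    simp only [map_mul, MvPolynomial.eval_X]
    refine this.congr_fderiv ?_
    ext v
    fin_cases j <;> simp [MvPolynomial.pderiv_mul, MvPolynomial.pderiv_X, Pi.single_apply] <;> ring

lemma fderiv_eval (q : MvPolynomial (Fin 2) ℝ) (x : 𝔼) (i : Fin 2) :
    fderiv ℝ (fun y : 𝔼 => MvPolynomial.eval (fun i => y i) q) x (EuclideanSpace.single i 1) =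
      MvPolynomial.eval (fun i => x i) (MvPolynomial.pderiv i q) := by
  rw [(hasFDerivAt_eval q x).fderiv]
  fin_cases i <;> simp

lemma pd2_eval (q : MvPolynomial (Fin 2) ℝ) (i j : Fin 2) (x : 𝔼) :
    pd2 (fun y : 𝔼 => MvPolynomial.eval (fun i => y i) q) i j x =
      MvPolynomial.eval (fun i => x i) (MvPolynomial.pderiv j (MvPolynomial.pderiv i q)) := by
  unfold pd2
  simp_rw [fderiv_eval]

lemma continuous_ev (q : MvPolynomial (Fin 2) ℝ) :
    Continuous (fun y : 𝔼 => MvPolynomial.eval (fun i => y i) q) :=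
  continuous_iff_continuousAt.2 fun x => (hasFDerivAt_eval q x).continuousAt

lemma ev_zero_of_ball (q : MvPolynomial (Fin 2) ℝ) (r : ℝ) (hr : 0 < r)
    (h : ∀ x ∈ ball (0 : 𝔼) r, MvPolynomial.eval (fun i => x i) q = 0) : q = 0 := by
  refine MvPolynomial.funext_set (fun _ => Ioo 0 (r/2)) (fun _ => Ioo_infinite (by linarith)) ?_
  intro x hx
  have := h (WithLp.toLp 2 x) ?_
  · simpa using this
  · have h0 := hx 0 trivial
    have h1 := hx 1 trivial
    rw [mem_ball_zero_iff, EuclideanSpace.norm_eq, Real.sqrt_lt' hr]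
    simp at h0 h1 ⊢
    nlinarith

lemma integral_ev_pos (q : MvPolynomial (Fin 2) ℝ) (r : ℝ) (hr : 0 < r) (hq : q ≠ 0) :
    0 < ∫ x in closedBall (0 : 𝔼) r, (MvPolynomial.eval (fun i => x i) q) ^ 2 := by
  have hc := (continuous_ev q).pow 2
  have hI : IntegrableOn (fun x : 𝔼 => (MvPolynomial.eval (fun i => x i) q) ^ 2)
    (closedBall 0 r) := hc.continuousOn.integrableOn_compact (isCompact_closedBall _ _)
  rw [setIntegral_pos_iff_support_of_nonneg_ae (Filter.Eventually.of_forall fun x => sq_nonneg _) hI]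
  by_contra hcon
  apply hq
  refine ev_zero_of_ball q r hr ?_
  by_contra! hx
  obtain ⟨x, hx, hne⟩ := hx
  apply hcon
  have ho : IsOpen (Function.support (fun x : 𝔼 => (MvPolynomial.eval (fun i => x i) q) ^ 2)
     ∩ ball 0 r) := hc.isOpen_support.inter isOpen_ball
  refine (ho.measure_pos volume ⟨x, by simpa using hne, hx⟩).trans_le (measure_mono ?_)
  exact inter_subset_inter_right _ ball_subset_closedBall

lemma ev_lip (q : MvPolynomial (Fin 2) ℝ) : ∃ L : ℝ, 0 ≤ L ∧
    ∀ x ∈ closedBall (0 : 𝔼) 1, ∀ y ∈ closedBall (0 : 𝔼) 1,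
      |MvPolynomial.eval (fun i => x i) q - MvPolynomial.eval (fun i => y i) q| ≤ L * ‖x - y‖ := by
  have hc : Continuous fun x : 𝔼 => (∑ i, MvPolynomial.eval (fun i => x i) (MvPolynomial.pderiv i q)
     • (EuclideanSpace.proj i : 𝔼 →L[ℝ] ℝ)) := by
    refine continuous_finsetSum _ fun i _ => ?_
    exact (continuous_ev _).smul continuous_const
  obtain ⟨L, hL⟩ := (isCompact_closedBall (0 : 𝔼) 1).exists_bound_of_continuousOn hc.continuousOn
  refine ⟨L, (norm_nonneg _).trans (hL 0 (by simp)), fun x hx y hy => ?_⟩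
  exact (convex_closedBall (0 : 𝔼) 1).norm_image_sub_le_of_norm_hasFDerivWithin_le
    (fun z _ => (hasFDerivAt_eval q z).hasFDerivWithinAt) hL hy hx

lemma ref_est (k : ℕ) (ρ : ℝ) (hρ : 0 < ρ) : ∃ C > (0 : ℝ), ∀ q : MvPolynomial (Fin 2) ℝ,
    q.totalDegree ≤ k → ∀ x ∈ closedBall (0 : 𝔼) 1, ∀ y ∈ closedBall (0 : 𝔼) 1,
      (MvPolynomial.eval (fun i => x i) q - MvPolynomial.eval (fun i => y i) q) ^ 2 ≤
      C * ‖x - y‖ ^ 2 *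
        ∫ x in closedBall (0 : 𝔼) ρ, (MvPolynomial.eval (fun i => x i) q) ^ 2 := by
  let S : Finset (Fin 2 →₀ ℕ) := Finset.Iic (Finsupp.equivFunOnFinite.symm (fun _ => k))
  let Q : (S → ℝ) → MvPolynomial (Fin 2) ℝ := fun c => ∑ d : S, MvPolynomial.monomial d.1 (c d)
  have hQsurj : ∀ q : MvPolynomial (Fin 2) ℝ, q.totalDegree ≤ k → Q (fun d => q.coeff d) = q := by
    intro q hq
    conv_rhs => rw [q.as_sum]
    have : Q (fun d => q.coeff d) = ∑ d ∈ S, MvPolynomial.monomial d (q.coeff d) :=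
      Finset.sum_coe_sort S (fun d => MvPolynomial.monomial d (q.coeff d))
    rw [this]
    symm
    refine Finset.sum_subset ?_ ?_
    · intro d hd
      simp only [S, Finset.mem_Iic]
      intro i
      have := (MvPolynomial.monomial_le_degreeOf i hd).trans
        ((MvPolynomial.degreeOf_le_totalDegree q i).trans hq)
      simpa using this
    · intro d _ hd
      rw [MvPolynomial.notMem_support_iff.1 hd]; simp
  have hQinj : ∀ c, Q c = 0 → c = 0 := by
    intro c hc
    ext d
    have := congrArg (MvPolynomial.coeff d.1) hc
    simp only [Q, MvPolynomial.coeff_sum, MvPolynomial.coeff_monomial, MvPolynomial.coeff_zero] at this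
    simpa [Subtype.ext_iff.symm] using this
  have hev : ∀ c (x : 𝔼), MvPolynomial.eval (fun i => x i) (Q c) =
      ∑ d : S, c d * MvPolynomial.eval (fun i => x i) (MvPolynomial.monomial d.1 1) := by
    intro c x
    simp [Q, MvPolynomial.eval_monomial]
  choose L hL0 hL using fun d : S => ev_lip (MvPolynomial.monomial d.1 1)
  let F : (S → ℝ) → ℝ := fun c =>
    ∫ x in closedBall (0 : 𝔼) ρ, (MvPolynomial.eval (fun i => x i) (Q c)) ^ 2
  have hF : Continuous F := by
    refine continuous_parametric_integral_of_continuous ?_ (isCompact_closedBall _ _)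
    simp only [Function.uncurry_def, hev]
    refine Continuous.pow (continuous_finsetSum _ fun d _ => ?_) 2
    exact ((continuous_apply d).comp continuous_fst).mul ((continuous_ev _).comp continuous_snd)
  obtain ⟨δ, hδ, hδF⟩ := (isCompact_sphere (0 : S → ℝ) 1).exists_forall_le' hF.continuousOn
    (a := 0) (fun c hc => integral_ev_pos _ _ hρ (fun h0 => by
      have := hQinj c h0; subst this; simp at hc))
  have hFs : ∀ (t : ℝ) c, F (t • c) = t ^ 2 * F c := by
    intro t c
    simp only [F]
    rw [← integral_const_mul]
    congr 1; ext x
    rw [hev, hev, ← mul_pow, Finset.mul_sum]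
    simp [mul_assoc]
  have hFc : ∀ c, δ * ‖c‖ ^ 2 ≤ F c := by
    intro c
    by_cases h0 : c = 0
    · subst h0
      simp only [norm_zero]
      have := hFs 0 0
      simp at this
      simp [this]
    · have hn : 0 < ‖c‖ := norm_pos_iff.2 h0
      have h1 := hδF (‖c‖⁻¹ • c) (by simp [norm_smul, hn.ne'])
      rw [hFs] at h1
      rw [inv_pow, ← div_eq_inv_mul, le_div_iff₀ (by positivity)] at h1
      exact h1
  refine ⟨((∑ d, L d) ^ 2 + 1) / δ, by positivity, fun q hq x hx y hy => ?_⟩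
  rw [← hQsurj q hq]
  generalize (fun d : S => q.coeff d.1) = c
  have h1 : |MvPolynomial.eval (fun i => x i) (Q c) - MvPolynomial.eval (fun i => y i) (Q c)|
      ≤ ‖c‖ * (∑ d, L d) * ‖x - y‖ := by
    rw [hev, hev, ← Finset.sum_sub_distrib, Finset.mul_sum, Finset.sum_mul]
    refine (Finset.abs_sum_le_sum_abs _ _).trans (Finset.sum_le_sum fun d _ => ?_)
    rw [← mul_sub, abs_mul, mul_assoc]
    exact mul_le_mul (norm_le_pi_norm c d) (hL d x hx y hy) (abs_nonneg _) (norm_nonneg _)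
  have h2 := hFc c
  change _ ≤ _ * F c
  have h3 : ‖c‖ ^ 2 ≤ F c / δ := by rw [le_div_iff₀ hδ]; linarith
  calc _ ≤ (‖c‖ * (∑ d, L d) * ‖x - y‖) ^ 2 := by
        rw [← sq_abs]; gcongr
    _ = ‖c‖ ^ 2 * ((∑ d, L d) ^ 2 * ‖x - y‖ ^ 2) := by ring
    _ ≤ (F c / δ) * (((∑ d, L d) ^ 2 + 1) * ‖x - y‖ ^ 2) := by
        gcongr
        linarith
    _ = _ := by field_simp

lemma scaled_est (k : ℕ) (ρ : ℝ) (hρ : 0 < ρ) : ∃ C > (0 : ℝ), ∀ q : MvPolynomial (Fin 2) ℝ,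
    q.totalDegree ≤ k → ∀ (z : 𝔼) (h : ℝ), 0 < h → ∀ x ∈ closedBall z h, ∀ y ∈ closedBall z h,
      (MvPolynomial.eval (fun i => x i) q - MvPolynomial.eval (fun i => y i) q) ^ 2 ≤
      C * ‖x - y‖ ^ 2 / h ^ 4 *
        ∫ x in closedBall z (ρ * h), (MvPolynomial.eval (fun i => x i) q) ^ 2 := by
  obtain ⟨C, hC, H⟩ := ref_est k ρ hρ
  refine ⟨C, hC, fun q hq z h hh x hx y hy => ?_⟩
  obtain ⟨q', hq', he⟩ := td_affine q k hq z h
  have hm : ∀ x ∈ closedBall z h, h⁻¹ • (x - z) ∈ closedBall (0 : 𝔼) 1 := by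
    intro x hx
    rw [mem_closedBall_zero_iff, norm_smul, norm_inv, Real.norm_of_nonneg hh.le,
      inv_mul_le_iff₀ hh, mul_one]
    simpa [dist_eq_norm] using hx
  have hb : ∀ x : 𝔼, z + h • h⁻¹ • (x - z) = x := by
    intro x; rw [smul_inv_smul₀ hh.ne']; abel
  have := H q' hq' _ (hm x hx) _ (hm y hy)
  simp only [he, hb] at this
  have hn : ‖h⁻¹ • (x - z) - h⁻¹ • (y - z)‖ = h⁻¹ * ‖x - y‖ := by
    rw [← smul_sub, norm_smul, norm_inv, Real.norm_of_nonneg hh.le]; congr 2; abel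
  rw [hn] at this
  have hi : ∫ x in closedBall (0 : 𝔼) ρ, (MvPolynomial.eval (fun i => (z + h • x) i) q) ^ 2
      = (h ^ 2)⁻¹ * ∫ x in closedBall z (ρ * h), (MvPolynomial.eval (fun i => x i) q) ^ 2 := by
    have h1 := Measure.setIntegral_comp_smul_of_pos (volume : Measure 𝔼)
      (fun x : 𝔼 => (MvPolynomial.eval (fun i => (z + x) i) q) ^ 2) (closedBall 0 ρ) hh
    rw [h1, smul_closedBall _ _ hρ.le, smul_zero, Real.norm_of_nonneg hh.le, mul_comm h ρ]
    simp only [finrank_euclideanSpace, Fintype.card_fin, smul_eq_mul]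
    congr 1
    have h2 := (measurePreserving_add_left (volume : Measure 𝔼) z).setIntegral_preimage_emb
      (MeasurableEquiv.addLeft z).measurableEmbedding
      (fun x : 𝔼 => (MvPolynomial.eval (fun i => x i) q) ^ 2) (closedBall z (ρ * h))
    rw [← h2]
    congr 2
    ext w; simp [dist_eq_norm]
  rw [hi] at this
  refine this.trans (le_of_eq ?_)
  field_simp

lemma sing_int (h : ℝ) (hh : 0 < h) (x : 𝔼) :
    IntegrableOn (fun y : 𝔼 => ‖x - y‖⁻¹) (closedBall x h) ∧
    ∫ y in closedBall x h, ‖x - y‖⁻¹ = 2 * volume.real (ball (0 : 𝔼) 1) * h := by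
  have key : ∀ y ∈ Ioi (0 : ℝ), y ^ (Module.finrank ℝ 𝔼 - 1) • (Iic h).indicator (fun t => t⁻¹) y
      = (Iic h).indicator (fun _ => (1 : ℝ)) y := by
    intro y (hy : 0 < y)
    by_cases hyh : y ≤ h
    · simp [hyh, hy.ne']
    · simp [hyh]
  have hi : Integrable (fun w : 𝔼 => (Iic h).indicator (fun t : ℝ => t⁻¹) ‖w‖) := by
    rw [integrable_fun_norm_addHaar volume (f := (Iic h).indicator (fun t : ℝ => t⁻¹)),
      integrableOn_congr_fun key measurableSet_Ioi, IntegrableOn,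
      integrable_indicator_iff measurableSet_Iic, IntegrableOn, Measure.restrict_restrict measurableSet_Iic, Iic_inter_Ioi]
    exact integrableOn_const (by simp)
  have hv : ∫ w : 𝔼, (Iic h).indicator (fun t : ℝ => t⁻¹) ‖w‖
      = 2 * volume.real (ball (0 : 𝔼) 1) * h := by
    rw [integral_fun_norm_addHaar volume ((Iic h).indicator (fun t : ℝ => t⁻¹)),
      setIntegral_congr_fun measurableSet_Ioi key, integral_indicator measurableSet_Iic,
      Measure.restrict_restrict measurableSet_Iic, Iic_inter_Ioi]
    simp [hh.le, mul_assoc]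
  have hcongr : (closedBall x h).indicator (fun y : 𝔼 => ‖x - y‖⁻¹) =
      fun y => (Iic h).indicator (fun t : ℝ => t⁻¹) ‖x - y‖ := by
    ext y
    simp [indicator, dist_eq_norm, norm_sub_rev x y]
  constructor
  · rw [← integrable_indicator_iff measurableSet_closedBall, hcongr]
    exact hi.comp_sub_left x
  · rw [← integral_indicator measurableSet_closedBall, hcongr,
      integral_sub_left_eq_self (fun w : 𝔼 => (Iic h).indicator (fun t : ℝ => t⁻¹) ‖w‖) volume x, hv]

/-- Polynomial fractional inverse estimate used in the proof of Proposition 3.11: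
`h_E |p|²_{5/2,E} ≤ C |p|²_{2,E}` for polynomials of degree ≤ k on shape-regular
elements, where `|p|²_{5/2,E}` is the Gagliardo seminorm of the Hessian. -/
theorem polynomial_fractional_inverse_inequality (k : ℕ) (ρ : ℝ)
    (hρ : ρ ∈ Set.Ioo (0 : ℝ) 1) :
    ∃ C > (0 : ℝ), ∀ E : Set (EuclideanSpace ℝ (Fin 2)),
      IsOpen E → Bornology.IsBounded E → ShapeRegular ρ E →
      ∀ p : EuclideanSpace ℝ (Fin 2) → ℝ, IsPolyDeg k p →
        Metric.diam E *
            (∫ x in E, ∫ y in E,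
              (∑ i : Fin 2, ∑ j : Fin 2, (pd2 p i j x - pd2 p i j y) ^ 2) / ‖x - y‖ ^ 3) ≤
          C * ∫ x in E, ∑ i : Fin 2, ∑ j : Fin 2, (pd2 p i j x) ^ 2 := by
  obtain ⟨C, hC, H⟩ := scaled_est k ρ hρ.1
  refine ⟨C * (2 * volume.real (ball (0 : 𝔼) 1)) * volume.real (ball (0 : 𝔼) 1) + 1,
    by positivity, ?_⟩
  rintro E hEo hEb ⟨z, hzB, -⟩ p ⟨q, hq, hp⟩
  obtain rfl : p = fun y : 𝔼 => MvPolynomial.eval (fun i => y i) q := funext hp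
  simp only [pd2_eval]
  set g : Fin 2 → Fin 2 → MvPolynomial (Fin 2) ℝ :=
    fun i j => MvPolynomial.pderiv j (MvPolynomial.pderiv i q) with hg
  have hgd : ∀ i j, (g i j).totalDegree ≤ k := fun i j =>
    (td_pderiv _ _).trans ((td_pderiv _ _).trans hq)
  set h := Metric.diam E with hh
  set I := ∫ x in E, ∑ i : Fin 2, ∑ j : Fin 2, (MvPolynomial.eval (fun i => x i) (g i j)) ^ 2
    with hI
  have hI0 : 0 ≤ I := integral_nonneg fun x => by positivity
  have hv0 : 0 ≤ volume.real (ball (0 : 𝔼) 1) := measureReal_nonneg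
  rcases (Metric.diam_nonneg : 0 ≤ Metric.diam E).eq_or_lt with h0 | hpos
  · rw [← hh] at h0
    rw [← h0, zero_mul]
    positivity
  rw [← hh] at hpos
  have hzE : z ∈ E := hzB (mem_closedBall_self (mul_nonneg hρ.1.le hpos.le))
  have hEx : ∀ x ∈ E, E ⊆ closedBall x h := fun x hx y hy => dist_le_diam_of_mem hEb hy hx
  -- integrals over the inner ball are controlled by those over `E`
  have hcont : ∀ i j, Continuous fun x : 𝔼 => (MvPolynomial.eval (fun i => x i) (g i j)) ^ 2 :=
    fun i j => (continuous_ev _).pow 2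
  have hint : ∀ i j, IntegrableOn
      (fun x : 𝔼 => (MvPolynomial.eval (fun i => x i) (g i j)) ^ 2) E := fun i j =>
    ((hcont i j).continuousOn.integrableOn_compact (isCompact_closedBall z h)).mono_set (hEx z hzE)
  have hIs : I = ∑ i, ∑ j, ∫ x in E, (MvPolynomial.eval (fun i => x i) (g i j)) ^ 2 := by
    rw [hI, integral_finsetSum _ fun i _ => integrable_finsetSum _ fun j _ => hint i j]
    refine Finset.sum_congr rfl fun i _ => ?_
    rw [integral_finsetSum _ fun j _ => hint i j]
  have hIB : ∀ i j, ∫ x in closedBall z (ρ * h), (MvPolynomial.eval (fun i => x i) (g i j)) ^ 2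
      ≤ ∫ x in E, (MvPolynomial.eval (fun i => x i) (g i j)) ^ 2 := fun i j =>
    setIntegral_mono_set (hint i j) (Filter.Eventually.of_forall fun x => sq_nonneg _)
      (Filter.Eventually.of_forall hzB)
  have hpt : ∀ x ∈ E, ∀ y ∈ E,
      (∑ i, ∑ j, (MvPolynomial.eval (fun i => x i) (g i j) -
        MvPolynomial.eval (fun i => y i) (g i j)) ^ 2) / ‖x - y‖ ^ 3
      ≤ C / h ^ 4 * I * ‖x - y‖⁻¹ := by
    intro x hx y hy
    rcases eq_or_ne x y with rfl | hne
    · simp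
    have hn : 0 < ‖x - y‖ := norm_pos_iff.2 (sub_ne_zero.2 hne)
    rw [div_le_iff₀ (by positivity)]
    have : C / h ^ 4 * I * ‖x - y‖⁻¹ * ‖x - y‖ ^ 3 = C * ‖x - y‖ ^ 2 / h ^ 4 * I := by
      field_simp
    rw [this, hIs, Finset.mul_sum]
    refine Finset.sum_le_sum fun i _ => ?_
    rw [Finset.mul_sum]
    refine Finset.sum_le_sum fun j _ => ?_
    refine (H (g i j) (hgd i j) z h hpos x (hEx z hzE hx) y (hEx z hzE hy)).trans ?_
    exact mul_le_mul_of_nonneg_left (hIB i j) (by positivity)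
  have hEm := hEo.measurableSet
  have hinner : ∀ x ∈ E, (∫ y in E,
      (∑ i, ∑ j, (MvPolynomial.eval (fun i => x i) (g i j) -
        MvPolynomial.eval (fun i => y i) (g i j)) ^ 2) / ‖x - y‖ ^ 3)
      ≤ C / h ^ 4 * I * (2 * volume.real (ball (0 : 𝔼) 1) * h) := by
    intro x hx
    obtain ⟨s1, s2⟩ := sing_int h hpos x
    have s3 : IntegrableOn (fun y : 𝔼 => ‖x - y‖⁻¹) E := s1.mono_set (hEx x hx)
    refine (integral_mono_of_nonneg (g := fun y : 𝔼 => C / h ^ 4 * I * ‖x - y‖⁻¹)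
      (Filter.Eventually.of_forall fun y => by dsimp only [Pi.zero_apply]; positivity)
      (s3.const_mul _) ?_).trans ?_
    · filter_upwards [ae_restrict_mem hEm] with y hy using hpt x hx y hy
    · rw [integral_const_mul]
      refine mul_le_mul_of_nonneg_left ?_ (by positivity)
      rw [← s2]
      exact setIntegral_mono_set s1 (Filter.Eventually.of_forall fun y => by
        dsimp only [Pi.zero_apply]; positivity) (Filter.Eventually.of_forall (hEx x hx))
  have hEfin : volume E ≠ ⊤ := hEb.measure_lt_top.ne
  have hvol : volume.real E ≤ h ^ 2 * volume.real (ball (0 : 𝔼) 1) := by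
    refine (measureReal_mono (hEx z hzE) measure_closedBall_lt_top.ne).trans (le_of_eq ?_)
    rw [Measure.real, Measure.addHaar_closedBall _ _ hpos.le, ENNReal.toReal_mul,
      ENNReal.toReal_ofReal (by positivity)]
    simp [Measure.real]
  have hconst : Integrable
      (fun _ : 𝔼 => C / h ^ 4 * I * (2 * volume.real (ball (0 : 𝔼) 1) * h))
      (volume.restrict E) := integrableOn_const hEfin enorm_ne_top
  have houter : (∫ x in E, ∫ y in E,
      (∑ i, ∑ j, (MvPolynomial.eval (fun i => x i) (g i j) -
        MvPolynomial.eval (fun i => y i) (g i j)) ^ 2) / ‖x - y‖ ^ 3)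
      ≤ volume.real E * (C / h ^ 4 * I * (2 * volume.real (ball (0 : 𝔼) 1) * h)) := by
    refine (integral_mono_of_nonneg
      (g := fun _ : 𝔼 => C / h ^ 4 * I * (2 * volume.real (ball (0 : 𝔼) 1) * h))
      (Filter.Eventually.of_forall fun x => integral_nonneg fun y => by
        dsimp only [Pi.zero_apply]; positivity)
      hconst ?_).trans ?_
    · filter_upwards [ae_restrict_mem hEm] with x hx using hinner x hx
    · simp
  calc _ ≤ h * (h ^ 2 * volume.real (ball (0 : 𝔼) 1) *
        (C / h ^ 4 * I * (2 * volume.real (ball (0 : 𝔼) 1) * h))) := by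
        refine mul_le_mul_of_nonneg_left (houter.trans ?_) hpos.le
        exact mul_le_mul_of_nonneg_right hvol (by positivity)
    _ = C * (2 * volume.real (ball (0 : 𝔼) 1)) * volume.real (ball (0 : 𝔼) 1) * I := by
        field_simp
    _ ≤ _ := by
        rw [add_mul]; linarith
end
end
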